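/- Let q ≥ 4 be an even integer. There is a constant C_q > 0, depending only on q, such that for all real x ≥ e^e, |E_q(x) − H_q·x/(log x)^{1−1/φ(q)}| ≤ C_q·x·(log log x)²/(log x)^{1−1/(2φ(q))}. -/

import Mathlib

noncomputable section

def IsInvFactorDecomp (G : Type*) [CommGroup G] {k : ℕ} (d : Fin k → ℕ) : Prop :=
  (∀ i, 1 < d i) ∧ (∀ i j : Fin k, i ≤ j → d i ∣ d j) ∧
    Nonempty (G ≃* ((i : Fin k) → Multiplicative (ZMod (d i))))

/-- The least invariant factor of a (nontrivial) commutative group. -/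
def leastInvFactor (G : Type*) [CommGroup G] : ℕ :=
  sInf {m | ∃ (k : ℕ) (d : Fin (k + 1) → ℕ), IsInvFactorDecomp G d ∧ d 0 = m}

/-- `λ₁(n)`: the least invariant factor of `(ℤ/nℤ)ˣ` for `n ≥ 3`, and `1` for `n = 1, 2`. -/
def lambda1 (n : ℕ) : ℕ := if n ≤ 2 then 1 else leastInvFactor (ZMod n)ˣ

open scoped Classical in
/-- The constant `G_q` of the paper. -/
def Gq (q : ℕ) : ℝ :=
  if hq : q = 0 then 0 else
    haveI : NeZero q := ⟨hq⟩
    (1 / Real.Gamma (1 / q.totient)) *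
      (((q.totient : ℝ) / q) *
          (∏ χ : DirichletCharacter ℂ q,
            if χ ≠ 1 then DirichletCharacter.LFunction χ 1 else 1).re) ^
        ((1 : ℝ) / q.totient) *
      ∏' p : Nat.Primes,
        (if ¬(p : ℕ) ∣ q ∧ (((p : ℕ) : ZMod q) ≠ 1) then
          (1 - ((p : ℕ) : ℝ) ^ (-(orderOf (((p : ℕ) : ZMod q)) : ℝ))) ^
            ((1 : ℝ) / (orderOf (((p : ℕ) : ZMod q)) : ℝ))
        else 1)

open scoped Classical in
/-- The constant `H_q` of the paper. -/
def Hq (q : ℕ) : ℝ :=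
  if h : ∃ p : ℕ, p.Prime ∧ p ≠ 2 ∧ p ∣ q ∧ (q / p ^ (q.factorization p)) ∣ (p - 1) then
    3 * Gq q / 2 *
      (1 + 1 / ((h.choose : ℝ) ^ (q.factorization h.choose) * ((h.choose : ℝ) - 1)))
  else 3 * Gq q / 2

/-- `E_q(x)`: the number of `n ≤ x` with `λ₁(n) = q`. -/
def Ecount (q : ℕ) (x : ℝ) : ℕ := {n : ℕ | 0 < n ∧ (n : ℝ) ≤ x ∧ lambda1 n = q}.ncard

open Complex MeasureTheory Set Filter Topology in
/-- The partial sums of a Dirichlet character are linear up to a bounded error. -/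
theorem DirichletCharacter.exists_norm_sum_sub_linear_le {q : ℕ} [NeZero q]
    (χ : DirichletCharacter ℂ q) :
    ∃ (m : ℂ) (K : ℝ), ∀ n : ℕ, ‖∑ k ∈ Finset.Icc 1 n, χ (k : ZMod q) - m * n‖ ≤ K := by
  set f : ℕ → ℂ := fun k => χ (k : ZMod q) with hf
  set T : ℂ := ∑ k ∈ Finset.range q, f (k + 1) with hT
  have hq0 : (q : ℂ) ≠ 0 := Nat.cast_ne_zero.mpr (NeZero.ne q)
  set g : ℕ → ℂ := fun n => ∑ k ∈ Finset.Icc 1 n, f k - (T / q) * n with hg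
  have hIcc : ∀ n, ∑ k ∈ Finset.Icc 1 n, f k = ∑ k ∈ Finset.range n, f (k + 1) := by
    intro n
    rw [Finset.range_eq_Ico, Finset.sum_Ico_add' f 0 n 1]
    rfl
  have hper : ∀ k, f (k + q) = f k := by intro k; simp [hf]
  have hblock : ∀ n, ∑ k ∈ Finset.range q, f (n + k + 1) = T := by
    intro n
    induction n with
    | zero => simp [hT]
    | succ n ih =>
      rw [← ih]
      have h1 := Finset.sum_range_succ (fun k => f (n + k + 1)) q
      have h2 := Finset.sum_range_succ' (fun k => f (n + k + 1)) q
      rw [h1] at h2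
      have h3 : f (n + q + 1) = f (n + 0 + 1) := by
        rw [show n + q + 1 = (n + 1) + q by ring, hper]
      rw [h3] at h2
      rw [add_right_cancel h2]
      refine Finset.sum_congr rfl fun k _ => ?_
      congr 1; ring
  have hgper : Function.Periodic g q := by
    intro n
    simp only [hg, hIcc]
    rw [Finset.sum_range_add]
    rw [hblock n]
    push_cast
    field_simp
    ring
  refine ⟨T / q, ∑ r ∈ Finset.range q, ‖g r‖, fun n => ?_⟩
  change ‖g n‖ ≤ _
  rw [← hgper.map_mod_nat n]
  exact Finset.single_le_sum (f := fun r => ‖g r‖) (fun _ _ => norm_nonneg _)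
    (Finset.mem_range.mpr (Nat.mod_lt _ (NeZero.pos q)))

open Complex MeasureTheory Set Filter Topology in
theorem integral_Ioi_sub_mul_cpow {N : ℝ} (hN : 0 < N) {s : ℂ} (hs : 1 < s.re) :
    IntegrableOn (fun t : ℝ => ((t : ℂ) - N) * (t : ℂ) ^ (-(s + 1))) (Ioi N) ∧
    s * ∫ t in Ioi N, ((t : ℂ) - N) * (t : ℂ) ^ (-(s + 1)) = (N : ℂ) ^ (1 - s) / (s - 1) := by
  have hs0 : s ≠ 0 := by intro h; rw [h] at hs; simp at hs; linarith
  have hs1 : s - 1 ≠ 0 := by intro h; rw [sub_eq_zero.mp h] at hs; simp at hs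
  have e1 : ∀ t ∈ Ioi N, ((t : ℂ) - N) * (t : ℂ) ^ (-(s + 1)) =
      (t : ℂ) ^ (-s) - N * (t : ℂ) ^ (-(s + 1)) := by
    intro t ht
    have ht0 : (t : ℂ) ≠ 0 := by
      have : 0 < t := hN.trans ht
      exact_mod_cast this.ne'
    rw [sub_mul]
    congr 1
    rw [show -s = 1 + -(s + 1) by ring, cpow_add _ _ ht0, cpow_one]
  have i1 : IntegrableOn (fun t : ℝ => (t : ℂ) ^ (-s)) (Ioi N) :=
    integrableOn_Ioi_cpow_of_lt (by simpa using hs) hN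
  have i2 : IntegrableOn (fun t : ℝ => (t : ℂ) ^ (-(s + 1))) (Ioi N) :=
    integrableOn_Ioi_cpow_of_lt (by simp; linarith) hN
  refine ⟨(integrableOn_congr_fun e1 measurableSet_Ioi).mpr (i1.sub (i2.const_mul _)), ?_⟩
  rw [setIntegral_congr_fun measurableSet_Ioi e1, integral_sub i1 (i2.const_mul _),
    integral_const_mul, integral_Ioi_cpow_of_lt (by simpa using hs) hN,
    integral_Ioi_cpow_of_lt (by simp; linarith) hN]
  have hN0 : (N : ℂ) ≠ 0 := by exact_mod_cast hN.ne'
  have e2 : (N : ℂ) ^ (1 - s) = N * (N : ℂ) ^ (-s) := by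
    rw [show 1 - s = 1 + -s by ring, cpow_add _ _ hN0, cpow_one]
  rw [show -s + 1 = 1 - s by ring, show -(s + 1) + 1 = -s by ring, e2]
  have : (1 - s) ≠ 0 := by intro h; apply hs1; linear_combination -h
  field_simp
  ring

open Complex MeasureTheory Set Filter Topology in
/-- A truncated Dirichlet series representation on `re s > 0` off the real axis. -/
theorem DirichletCharacter.LFunction_truncation {q : ℕ} [NeZero q]
    (χ : DirichletCharacter ℂ q) :
    ∃ (m : ℂ) (K : ℝ), 0 ≤ K ∧ ∀ N : ℕ, 1 ≤ N → ∀ s : ℂ, 0 < s.re → s.im ≠ 0 →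
      ‖LFunction χ s - ∑ n ∈ Finset.Icc 1 N, χ (n : ZMod q) * (n : ℂ) ^ (-s) -
        m * (N : ℂ) ^ (1 - s) / (s - 1)‖ ≤ ‖s‖ * (K * ((N : ℝ) ^ (-s.re) / s.re)) := by
  obtain ⟨m, K, hK⟩ := χ.exists_norm_sum_sub_linear_le
  have hK0 : 0 ≤ K := (norm_nonneg _).trans (hK 0)
  refine ⟨m, ‖m‖ + 2 * K, by positivity, fun N hN s hs hsi => ?_⟩
  have hN0 : (0 : ℝ) < N := by exact_mod_cast hN
  set A : ℕ → ℂ := fun n => ∑ k ∈ Finset.Icc 1 n, χ (k : ZMod q) with hA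
  set ρ : ℝ → ℂ := fun t => A ⌊t⌋₊ - A N - m * (t - N) with hρ
  have hρm : Measurable ρ := by
    have h1 : Measurable (fun t : ℝ => A ⌊t⌋₊) := (measurable_from_nat (f := A)).comp Nat.measurable_floor
    fun_prop
  have hρb : ∀ t ∈ Ioi (N : ℝ), ‖ρ t‖ ≤ ‖m‖ + 2 * K := by
    intro t ht
    have ht0 : 0 ≤ t := hN0.le.trans (le_of_lt ht)
    have e : ρ t = (A ⌊t⌋₊ - m * ⌊t⌋₊) - (A N - m * N) - m * (((t - ⌊t⌋₊ : ℝ)) : ℂ) := by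
      simp only [hρ]; push_cast; ring
    rw [e]
    have h3 : ‖m * (((t - ⌊t⌋₊ : ℝ)) : ℂ)‖ ≤ ‖m‖ := by
      rw [norm_mul, norm_real, Real.norm_eq_abs, abs_of_nonneg (by
        linarith [Nat.floor_le ht0])]
      exact mul_le_of_le_one_right (norm_nonneg _) (by linarith [Nat.lt_floor_add_one t])
    have := norm_sub_le ((A ⌊t⌋₊ - m * ⌊t⌋₊) - (A N - m * N)) (m * (((t - ⌊t⌋₊ : ℝ)) : ℂ))
    have := norm_sub_le (A ⌊t⌋₊ - m * ⌊t⌋₊) (A N - m * N)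
    linarith [hK ⌊t⌋₊, hK N]
  have key : ∀ z : ℂ, 0 < z.re → IntegrableOn (fun t : ℝ => ρ t * (t : ℂ) ^ (-(z + 1))) (Ioi (N:ℝ)) ∧
      ‖∫ t in Ioi (N:ℝ), ρ t * (t : ℂ) ^ (-(z + 1))‖ ≤ (‖m‖ + 2 * K) * ((N : ℝ) ^ (-z.re) / z.re) := by
    intro z hz
    have i0 : IntegrableOn (fun t : ℝ => (t : ℂ) ^ (-(z + 1))) (Ioi (N:ℝ)) :=
      integrableOn_Ioi_cpow_of_lt (by simp; linarith) hN0
    have i1 : IntegrableOn (fun t : ℝ => t ^ (-(z.re + 1))) (Ioi (N:ℝ)) :=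
      integrableOn_Ioi_rpow_of_lt (by linarith) hN0
    refine ⟨?_, ?_⟩
    · refine Integrable.bdd_mul (c := ‖m‖ + 2 * K) i0 hρm.aestronglyMeasurable ?_
      exact (ae_restrict_iff' measurableSet_Ioi).mpr (ae_of_all _ hρb)
    · have : ∫ t in Ioi (N:ℝ), (‖m‖ + 2 * K) * t ^ (-(z.re + 1)) =
          (‖m‖ + 2 * K) * ((N : ℝ) ^ (-z.re) / z.re) := by
        rw [integral_const_mul, integral_Ioi_rpow_of_lt (by linarith) hN0]
        rw [show -(z.re + 1) + 1 = -z.re by ring]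
        field_simp
      rw [← this]
      refine norm_integral_le_of_norm_le (i1.const_mul _) ?_
      refine (ae_restrict_iff' measurableSet_Ioi).mpr (ae_of_all _ fun t ht => ?_)
      rw [norm_mul, norm_cpow_eq_rpow_re_of_pos (hN0.trans ht)]
      simp only [neg_re, add_re, one_re]
      exact mul_le_mul_of_nonneg_right (hρb t ht) (Real.rpow_nonneg (hN0.trans ht).le _)
  set J : ℂ → ℂ := fun z => ∫ t in Ioi (N:ℝ), ρ t * (t : ℂ) ^ (-(z + 1)) with hJ
  have hJd : ∀ z : ℂ, 0 < z.re → DifferentiableAt ℂ J z := by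
    intro z hz
    have e : J = fun z => mellin ((Ioi (N:ℝ)).indicator ρ) (-z) := by
      funext z
      rw [hJ, mellin]
      simp only
      have : ∀ t : ℝ, (t:ℂ) ^ (-z - 1) • (Ioi (N:ℝ)).indicator ρ t =
          (Ioi (N:ℝ)).indicator (fun t : ℝ => ρ t * (t : ℂ) ^ (-(z + 1))) t := by
        intro t
        by_cases ht : t ∈ Ioi (N:ℝ)
        · simp only [indicator_of_mem ht, smul_eq_mul]
          rw [mul_comm]; congr 2; ring
        · simp [indicator_of_notMem ht]
      simp_rw [this]
      rw [setIntegral_indicator measurableSet_Ioi]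
      congr 2
      ext t
      simp only [mem_Ioi, mem_inter_iff]
      exact ⟨fun h => ⟨hN0.trans h, h⟩, fun h => h.2⟩
    rw [e]
    have hind : ∀ t, ‖(Ioi (N:ℝ)).indicator ρ t‖ ≤ ‖m‖ + 2 * K := by
      intro t
      by_cases ht : t ∈ Ioi (N:ℝ)
      · rw [indicator_of_mem ht]; exact hρb t ht
      · rw [indicator_of_notMem ht]; simp; positivity
    have hd : DifferentiableAt ℂ (mellin ((Ioi (N:ℝ)).indicator ρ)) (-z) := by
      refine mellin_differentiableAt_of_isBigO_rpow (a := 0) (b := -z.re - 1) ?_ ?_ (by simpa using hz) ?_ (by simp)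
      · refine LocallyIntegrable.locallyIntegrableOn ?_ _
        refine (locallyIntegrable_const (‖m‖ + 2 * K)).mono
          (hρm.indicator measurableSet_Ioi).aestronglyMeasurable (ae_of_all _ fun t => ?_)
        rw [Real.norm_of_nonneg (by positivity)]
        exact hind t
      · simp only [neg_zero, Real.rpow_zero]
        exact Asymptotics.isBigO_of_le' (c := ‖m‖ + 2 * K) _ fun t => by simpa using hind t
      · refine Asymptotics.IsBigO.of_bound 1 ?_
        have : ∀ᶠ t : ℝ in 𝓝[>] 0, t < N := (tendsto_nhdsWithin_of_tendsto_nhds tendsto_id).eventually (gt_mem_nhds hN0)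
        filter_upwards [this] with t ht
        rw [indicator_of_notMem (by simp; exact ht.le)]
        simp
    exact hd.comp z differentiable_neg.differentiableAt
  set R : ℂ → ℂ := fun s => ∑ n ∈ Finset.Icc 1 N, χ (n : ZMod q) * (n : ℂ) ^ (-s) +
        m * (N : ℂ) ^ (1 - s) / (s - 1) + s * J s with hR
  have hNC : (N : ℂ) ≠ 0 := by exact_mod_cast hN0.ne'
  have hRd : ∀ z : ℂ, 0 < z.re → z ≠ 1 → DifferentiableAt ℂ R z := by
    intro z hz hz1
    have h1 : DifferentiableAt ℂ (fun s => ∑ n ∈ Finset.Icc 1 N, χ (n : ZMod q) * (n : ℂ) ^ (-s)) z := by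
      refine DifferentiableAt.fun_sum fun n hn => ?_
      have : (n : ℂ) ≠ 0 := by
        have := (Finset.mem_Icc.mp hn).1
        exact_mod_cast (by lia)
      exact (DifferentiableAt.const_cpow differentiable_neg.differentiableAt (Or.inl this)).const_mul _
    have h2 : DifferentiableAt ℂ (fun s => m * (N : ℂ) ^ (1 - s) / (s - 1)) z := by
      refine DifferentiableAt.div ?_ (by fun_prop) (sub_ne_zero.mpr hz1)
      exact (DifferentiableAt.const_cpow (by fun_prop) (Or.inl hNC)).const_mul _
    exact (h1.add h2).add (differentiableAt_id.mul (hJd z hz))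
  have hbig : ∀ z : ℂ, 1 < z.re → LFunction χ z = R z := by
    intro z hz
    rw [LFunction_eq_LSeries χ hz]
    set f1 : ℕ → ℂ := fun n => if n ≤ N then χ (n : ZMod q) else 0
    set f2 : ℕ → ℂ := fun n => if n ≤ N then 0 else χ (n : ZMod q)
    have hf : (fun n : ℕ => χ (n : ZMod q)) = f1 + f2 := by
      funext n
      simp only [f1, f2, Pi.add_apply]
      split_ifs <;> simp
    have hle : ∀ n : ℕ, ‖χ (n : ZMod q)‖ ≤ 1 := fun n => χ.norm_le_one _
    have hs1 : LSeriesSummable f1 z := LSeriesSummable_of_bounded_of_one_lt_re (m := 1)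
      (fun n _ => by simp only [f1]; split_ifs <;> simp [hle]) hz
    have hs2 : LSeriesSummable f2 z := LSeriesSummable_of_bounded_of_one_lt_re (m := 1)
      (fun n _ => by simp only [f2]; split_ifs <;> simp [hle]) hz
    rw [hf, LSeries_add hs1 hs2]
    simp only [hR]
    rw [add_assoc]
    congr 1
    · rw [LSeries, tsum_eq_sum (s := Finset.Icc 1 N)]
      · refine Finset.sum_congr rfl fun n hn => ?_
        have hn := Finset.mem_Icc.mp hn
        rw [LSeries.term_of_ne_zero (by lia)]
        simp only [f1, if_pos hn.2]
        rw [cpow_neg, div_eq_mul_inv]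
      · intro n hn
        rcases Nat.eq_zero_or_pos n with rfl | h0
        · simp
        · rw [LSeries.term_of_ne_zero h0.ne']
          have : ¬ n ≤ N := fun h => hn (Finset.mem_Icc.mpr ⟨h0, h⟩)
          simp [f1, this]
    · have hsum : ∀ n : ℕ, ‖∑ k ∈ Finset.Icc 1 n, f2 k‖ ≤ 1 * ‖((n:ℝ) ^ (1:ℝ))‖ := by
        intro n
        refine (norm_sum_le _ _).trans ?_
        have : ∑ k ∈ Finset.Icc 1 n, ‖f2 k‖ ≤ ∑ k ∈ Finset.Icc 1 n, (1:ℝ) :=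
          Finset.sum_le_sum fun k _ => by simp only [f2]; split_ifs <;> simp [hle]
        simpa using this
      rw [LSeries_eq_mul_integral f2 zero_le_one hz hs2
        (Asymptotics.isBigO_of_le' _ hsum)]
      obtain ⟨j1, j2⟩ := integral_Ioi_sub_mul_cpow hN0 hz
      have hsumf : ∀ n : ℕ, N ≤ n → ∑ k ∈ Finset.Icc 1 n, f2 k = A n - A N := by
        intro n hn
        induction n, hn using Nat.le_induction with
        | base =>
          rw [sub_self]
          refine Finset.sum_eq_zero fun k hk => ?_
          simp [f2, (Finset.mem_Icc.mp hk).2]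
        | succ n hn ih =>
          have h1 : A (n + 1) = A n + χ ((n + 1 : ℕ) : ZMod q) := by
            simp only [hA]; rw [Finset.sum_Icc_succ_top (by lia)]
          rw [Finset.sum_Icc_succ_top (by lia), ih, h1]
          have : f2 (n + 1) = χ ((n + 1 : ℕ) : ZMod q) := by
            simp only [f2]; rw [if_neg (by lia)]
          rw [this]; ring
      have hsmall : ∀ n : ℕ, n ≤ N → ∑ k ∈ Finset.Icc 1 n, f2 k = 0 := by
        intro n hn
        refine Finset.sum_eq_zero fun k hk => ?_
        simp [f2, (Finset.mem_Icc.mp hk).2.trans hn]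
      have hI : ∫ t in Ioi (1:ℝ), (∑ k ∈ Finset.Icc 1 ⌊t⌋₊, f2 k) * (t:ℂ) ^ (-(z + 1)) =
          ∫ t in Ioi (N:ℝ), (m * (((t : ℂ) - N) * (t : ℂ) ^ (-(z + 1))) + ρ t * (t : ℂ) ^ (-(z + 1))) := by
        have hN1 : Ioi (N:ℝ) ⊆ Ioi 1 := Ioi_subset_Ioi (by exact_mod_cast hN)
        rw [setIntegral_eq_of_subset_of_forall_sdiff_eq_zero measurableSet_Ioi hN1]
        · refine setIntegral_congr_fun measurableSet_Ioi fun t ht => ?_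
          have : N ≤ ⌊t⌋₊ := Nat.le_floor (le_of_lt ht)
          rw [hsumf _ this, hρ]
          simp only [ofReal_natCast]
          ring
        · intro t ht
          have : ⌊t⌋₊ ≤ N := by
            have h : t ≤ N := not_lt.mp ht.2
            exact (Nat.floor_le_floor h).trans (by simp)
          rw [hsmall _ this, zero_mul]
      rw [hI, integral_add (by simpa using j1.const_mul m) (key z (by linarith)).1, mul_add, integral_const_mul]
      congr 1
      rw [mul_left_comm, show (N : ℂ) = ((N : ℝ) : ℂ) by simp, j2]
      ring
  have hmain : LFunction χ s = R s := by
    rcases lt_or_gt_of_ne hsi with hneg | hpos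
    · have hU : IsOpen {z : ℂ | 0 < z.re ∧ z.im < 0} :=
        (isOpen_lt continuous_const continuous_re).inter (isOpen_lt continuous_im continuous_const)
      have hne : ∀ z ∈ {z : ℂ | 0 < z.re ∧ z.im < 0}, z ≠ 1 := by
        rintro z hz rfl; simp at hz
      have hconv : Convex ℝ {z : ℂ | 0 < z.re ∧ z.im < 0} :=
        (convex_halfSpace_re_gt 0).inter (convex_halfSpace_im_lt 0)
      refine AnalyticOnNhd.eqOn_of_preconnected_of_eventuallyEq (U := {z : ℂ | 0 < z.re ∧ z.im < 0})
        (z₀ := 2 - I)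
        (DifferentiableOn.analyticOnNhd (fun z hz => (differentiableAt_LFunction χ z (Or.inl (hne z hz))).differentiableWithinAt) hU)
        (DifferentiableOn.analyticOnNhd (fun z hz => (hRd z hz.1 (hne z hz)).differentiableWithinAt) hU)
        hconv.isPreconnected (by simp) ?_ ⟨hs, hneg⟩
      have : ∀ᶠ z : ℂ in 𝓝 (2 - I), 1 < z.re :=
        (isOpen_lt continuous_const continuous_re).mem_nhds (by simp)
      exact this.mono hbig
    · have hU : IsOpen {z : ℂ | 0 < z.re ∧ 0 < z.im} :=
        (isOpen_lt continuous_const continuous_re).inter (isOpen_lt continuous_const continuous_im)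
      have hne : ∀ z ∈ {z : ℂ | 0 < z.re ∧ 0 < z.im}, z ≠ 1 := by
        rintro z hz rfl; simp at hz
      have hconv : Convex ℝ {z : ℂ | 0 < z.re ∧ 0 < z.im} :=
        (convex_halfSpace_re_gt 0).inter (convex_halfSpace_im_gt 0)
      refine AnalyticOnNhd.eqOn_of_preconnected_of_eventuallyEq (U := {z : ℂ | 0 < z.re ∧ 0 < z.im})
        (z₀ := 2 + I)
        (DifferentiableOn.analyticOnNhd (fun z hz => (differentiableAt_LFunction χ z (Or.inl (hne z hz))).differentiableWithinAt) hU)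
        (DifferentiableOn.analyticOnNhd (fun z hz => (hRd z hz.1 (hne z hz)).differentiableWithinAt) hU)
        hconv.isPreconnected (by simp) ?_ ⟨hs, hpos⟩
      have : ∀ᶠ z : ℂ in 𝓝 (2 + I), 1 < z.re :=
        (isOpen_lt continuous_const continuous_re).mem_nhds (by simp)
      exact this.mono hbig
  rw [hmain, hR]
  simp only [add_sub_cancel_left, add_assoc]
  rw [norm_mul]
  exact mul_le_mul_of_nonneg_left (key s hs).2 (norm_nonneg _)

open Complex Set in
theorem DirichletCharacter.exists_norm_LFunction_le_wide {q : ℕ} [NeZero q]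
    (χ : DirichletCharacter ℂ q) :
    ∃ C : ℝ, 0 < C ∧ ∀ s : ℂ, 15 / 16 ≤ s.re → s.re ≤ 3 → 1 / 2 ≤ |s.im| →
      ‖LFunction χ s‖ ≤ C * |s.im| ^ (1 / 8 : ℝ) := by
  obtain ⟨m, K, hK0, hK⟩ := χ.LFunction_truncation
  refine ⟨(17 + 2 * ‖m‖ + 8 * K) * 3, by positivity, fun s h1 h2 h3 => ?_⟩
  have him : s.im ≠ 0 := by intro h; rw [h] at h3; norm_num at h3
  set N : ℕ := ⌊|s.im|⌋₊ + 1 with hN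
  have hN1 : 1 ≤ N := by lia
  have hNt : |s.im| ≤ N := by
    have := Nat.lt_floor_add_one |s.im|; rw [hN]; push_cast; exact this.le
  have hNt' : (N : ℝ) ≤ 3 * |s.im| := by
    have := Nat.floor_le (abs_nonneg s.im); rw [hN]; push_cast; linarith
  have hN1' : (1 : ℝ) ≤ N := by exact_mod_cast hN1
  have hN0 : (0 : ℝ) < N := by linarith
  have hk := hK N hN1 s (by linarith) him
  have hP1 : (1 : ℝ) ≤ (N : ℝ) ^ (1 / 16 : ℝ) := Real.one_le_rpow hN1' (by norm_num)
  have hP2 : (N : ℝ) ^ (1 / 8 : ℝ) = (N : ℝ) ^ (1 / 16 : ℝ) * (N : ℝ) ^ (1 / 16 : ℝ) := by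
    rw [← Real.rpow_add hN0]; norm_num
  have hlog : Real.log N ≤ 16 * (N : ℝ) ^ (1 / 16 : ℝ) := by
    have := Real.log_le_rpow_div hN0.le (ε := 1 / 16) (by norm_num)
    linarith [this]
  -- the finite sum
  have b1 : ‖∑ n ∈ Finset.Icc 1 N, χ (n : ZMod q) * (n : ℂ) ^ (-s)‖ ≤
      17 * (N : ℝ) ^ (1 / 8 : ℝ) := by
    have hterm : ∀ n ∈ Finset.Icc 1 N, ‖χ (n : ZMod q) * (n : ℂ) ^ (-s)‖ ≤
        (N : ℝ) ^ (1 / 16 : ℝ) * ((n : ℝ))⁻¹ := by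
      intro n hn
      have hn := Finset.mem_Icc.mp hn
      have hn0 : (0 : ℝ) < n := by exact_mod_cast hn.1
      have hn1 : (1 : ℝ) ≤ n := by exact_mod_cast hn.1
      rw [norm_mul]
      refine (mul_le_of_le_one_left (norm_nonneg _) (χ.norm_le_one _)).trans ?_
      rw [norm_natCast_cpow_of_pos hn.1, neg_re]
      calc (n : ℝ) ^ (-s.re) ≤ (n : ℝ) ^ (1 / 16 + (-1) : ℝ) :=
            Real.rpow_le_rpow_of_exponent_le hn1 (by linarith)
        _ = (n : ℝ) ^ (1 / 16 : ℝ) * ((n : ℝ))⁻¹ := by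
            rw [Real.rpow_add hn0, Real.rpow_neg_one]
        _ ≤ _ := by
            gcongr
            exact_mod_cast hn.2
    refine (norm_sum_le_of_le _ hterm).trans ?_
    rw [← Finset.mul_sum]
    have hharm : ∑ n ∈ Finset.Icc 1 N, ((n : ℝ))⁻¹ ≤ 1 + Real.log N := by
      have := harmonic_le_one_add_log N
      rw [harmonic_eq_sum_Icc] at this
      push_cast at this
      exact this
    rw [hP2]
    nlinarith [mul_le_mul_of_nonneg_left hharm (zero_le_one.trans hP1)]
  have b2 : ‖m * (N : ℂ) ^ (1 - s) / (s - 1)‖ ≤ 2 * ‖m‖ * (N : ℝ) ^ (1 / 8 : ℝ) := by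
    have hs1 : 1 / 2 ≤ ‖s - 1‖ := by
      have := abs_im_le_norm (s - 1)
      simp at this
      linarith
    rw [norm_div, norm_mul, norm_natCast_cpow_of_pos hN1, div_le_iff₀ (by linarith)]
    have : (N : ℝ) ^ (1 - s).re ≤ (N : ℝ) ^ (1 / 8 : ℝ) :=
      Real.rpow_le_rpow_of_exponent_le hN1' (by simp; linarith)
    have hm := norm_nonneg m
    have hp : 0 ≤ ‖m‖ * (N : ℝ) ^ (1 / 8 : ℝ) := by positivity
    nlinarith [mul_le_mul_of_nonneg_left this hm, mul_le_mul_of_nonneg_left hs1 hp]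
  have b3 : ‖s‖ * (K * ((N : ℝ) ^ (-s.re) / s.re)) ≤ 8 * K * (N : ℝ) ^ (1 / 8 : ℝ) := by
    have hs : ‖s‖ ≤ 4 * N := by
      have := norm_le_abs_re_add_abs_im s
      rw [abs_of_nonneg (by linarith : (0:ℝ) ≤ s.re)] at this
      linarith
    have h5 : (N : ℝ) ^ (-s.re) ≤ (N : ℝ) ^ (1 / 8 : ℝ) * ((N : ℝ))⁻¹ := by
      rw [← Real.rpow_neg_one, ← Real.rpow_add hN0]
      exact Real.rpow_le_rpow_of_exponent_le hN1' (by linarith)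
    have h6 : (N : ℝ) ^ (-s.re) / s.re ≤ 2 * ((N : ℝ) ^ (1 / 8 : ℝ) * ((N : ℝ))⁻¹) := by
      rw [div_le_iff₀ (by linarith)]
      have : 0 ≤ (N : ℝ) ^ (1 / 8 : ℝ) * ((N : ℝ))⁻¹ := by positivity
      nlinarith
    calc ‖s‖ * (K * ((N : ℝ) ^ (-s.re) / s.re))
        ≤ (4 * N) * (K * (2 * ((N : ℝ) ^ (1 / 8 : ℝ) * ((N : ℝ))⁻¹))) := by gcongr
      _ = 8 * K * (N : ℝ) ^ (1 / 8 : ℝ) := by field_simp; ring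
  have htri : ‖LFunction χ s‖ ≤ (17 + 2 * ‖m‖ + 8 * K) * (N : ℝ) ^ (1 / 8 : ℝ) := by
    have e : LFunction χ s = (LFunction χ s - ∑ n ∈ Finset.Icc 1 N, χ (n : ZMod q) * (n : ℂ) ^ (-s) -
        m * (N : ℂ) ^ (1 - s) / (s - 1)) + (∑ n ∈ Finset.Icc 1 N, χ (n : ZMod q) * (n : ℂ) ^ (-s)) +
        m * (N : ℂ) ^ (1 - s) / (s - 1) := by ring
    rw [e]
    refine (norm_add₃_le).trans ?_
    linarith
  refine htri.trans ?_
  rw [mul_assoc]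
  gcongr
  calc (N : ℝ) ^ (1 / 8 : ℝ) ≤ (3 * |s.im|) ^ (1 / 8 : ℝ) := by gcongr
    _ = 3 ^ (1 / 8 : ℝ) * |s.im| ^ (1 / 8 : ℝ) := Real.mul_rpow (by norm_num) (abs_nonneg _)
    _ ≤ 3 * |s.im| ^ (1 / 8 : ℝ) := by
      gcongr
      calc (3 : ℝ) ^ (1 / 8 : ℝ) ≤ 3 ^ (1 : ℝ) :=
            Real.rpow_le_rpow_of_exponent_le (by norm_num) (by norm_num)
        _ = 3 := Real.rpow_one 3

open Complex Set in
theorem DirichletCharacter.exists_norm_LFunction_le {q : ℕ} [NeZero q]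
    (χ : DirichletCharacter ℂ q) :
    ∃ C : ℝ, 0 < C ∧ ∀ s : ℂ, 1 ≤ s.re → s.re ≤ 2 → 1 ≤ |s.im| →
      ‖LFunction χ s‖ ≤ C * |s.im| ^ (1 / 8 : ℝ) ∧
      ‖deriv (LFunction χ) s‖ ≤ C * |s.im| ^ (1 / 8 : ℝ) := by
  obtain ⟨C, hC, h⟩ := χ.exists_norm_LFunction_le_wide
  refine ⟨32 * C, by positivity, fun s h1 h2 h3 => ⟨?_, ?_⟩⟩
  · have hp : 0 ≤ C * |s.im| ^ (1 / 8 : ℝ) := by positivity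
    have := h s (by linarith) (by linarith) (by linarith)
    nlinarith
  · have hb : ∀ z ∈ Metric.sphere s (1 / 16), ‖LFunction χ z‖ ≤ 2 * C * |s.im| ^ (1 / 8 : ℝ) := by
      intro z hz
      rw [mem_sphere_iff_norm] at hz
      have hre := abs_re_le_norm (z - s)
      have him := abs_im_le_norm (z - s)
      rw [hz] at hre him
      rw [sub_re, abs_le] at hre
      rw [sub_im] at him
      have e1 : |z.im| ≤ |s.im| + 1 / 16 := by
        have := abs_sub_abs_le_abs_sub z.im s.im; linarith
      have e2 : |s.im| ≤ |z.im| + 1 / 16 := by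
        have := abs_sub_abs_le_abs_sub s.im z.im; rw [abs_sub_comm] at this; linarith
      refine (h z (by linarith) (by linarith) (by linarith)).trans ?_
      rw [mul_comm 2 C, mul_assoc]
      gcongr
      calc |z.im| ^ (1 / 8 : ℝ) ≤ (2 * |s.im|) ^ (1 / 8 : ℝ) := by gcongr; linarith
        _ = 2 ^ (1 / 8 : ℝ) * |s.im| ^ (1 / 8 : ℝ) := Real.mul_rpow (by norm_num) (abs_nonneg _)
        _ ≤ 2 * |s.im| ^ (1 / 8 : ℝ) := by
          gcongr
          calc (2 : ℝ) ^ (1 / 8 : ℝ) ≤ 2 ^ (1 : ℝ) :=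
                Real.rpow_le_rpow_of_exponent_le (by norm_num) (by norm_num)
            _ = 2 := Real.rpow_one 2
    have hd : DiffContOnCl ℂ (LFunction χ) (Metric.ball s (1 / 16)) := by
      refine DifferentiableOn.diffContOnCl fun z hz => ?_
      rw [closure_ball _ (by norm_num), Metric.mem_closedBall, dist_eq] at hz
      refine (differentiableAt_LFunction χ z (Or.inl ?_)).differentiableWithinAt
      rintro rfl
      have := (abs_im_le_norm (1 - s)).trans hz
      simp at this
      linarith
    have := Complex.norm_deriv_le_of_forall_mem_sphere_norm_le (by norm_num) hd hb
    refine this.trans (le_of_eq ?_)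
    ring

open Complex Set in
theorem DirichletCharacter.exists_norm_LFunctionTrivChar_le (q : ℕ) [NeZero q] :
    ∃ C : ℝ, 0 < C ∧ ∀ x : ℝ, 0 < x → x ≤ 1 → ‖LFunctionTrivChar q (1 + x)‖ ≤ C / x := by
  have hc : ContinuousOn (fun x : ℝ => LFunctionTrivChar₁ q (1 + x)) (Icc 0 1) :=
    ((differentiable_LFunctionTrivChar₁ q).continuous.comp (by fun_prop)).continuousOn
  obtain ⟨C, hC⟩ := isCompact_Icc.exists_bound_of_continuousOn hc
  refine ⟨|C| + 1, by positivity, fun x h0 h1 => ?_⟩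
  have := hC x ⟨h0.le, h1⟩
  have hx : (x : ℂ) ≠ 0 := by exact_mod_cast h0.ne'
  rw [LFunctionTrivChar₁, Function.update_of_ne (by simpa using h0.ne')] at this
  rw [add_sub_cancel_left, norm_mul, norm_real, Real.norm_of_nonneg h0.le] at this
  rw [le_div_iff₀ h0, mul_comm]
  linarith [le_abs_self C]

open Complex Set in
theorem DirichletCharacter.exists_le_norm_LFunction {q : ℕ} [NeZero q]
    (χ : DirichletCharacter ℂ q) :
    ∃ c : ℝ, 0 < c ∧ ∀ s : ℂ, 1 < s.re → s.re ≤ 2 → 1 ≤ |s.im| →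
      c * |s.im| ^ (-(1 / 2) : ℝ) ≤ ‖LFunction χ s‖ := by
  obtain ⟨C0, hC0, h0⟩ := exists_norm_LFunctionTrivChar_le q
  obtain ⟨A1, hA1, h1⟩ := χ.exists_norm_LFunction_le
  obtain ⟨A2, hA2, h2⟩ := (χ ^ 2).exists_norm_LFunction_le
  set D : ℝ := (1 / (2 * A2 * C0 ^ 3)) ^ (1 / 4 : ℝ) with hD
  have hD0 : 0 < D := by positivity
  have hD4 : D ^ 4 = 1 / (2 * A2 * C0 ^ 3) := by
    rw [hD, ← Real.rpow_natCast, ← Real.rpow_mul (by positivity)]; norm_num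
  set b : ℝ := min 1 (D / (2 * A1)) with hb
  have hb0 : 0 < b := by positivity
  have hb1 : b ≤ 1 := min_le_left _ _
  have hbA : b * A1 ≤ D / 2 := by
    have : b ≤ D / (2 * A1) := min_le_right _ _
    rw [le_div_iff₀ (by positivity)] at this
    linarith
  refine ⟨D * b ^ 3 / 2, by positivity, fun s hs1 hs2 ht => ?_⟩
  set τ := |s.im| with hτ
  have hτ0 : 0 < τ := by linarith
  set w : ℝ := τ ^ (-(1 / 32) : ℝ) with hw
  have hw0 : 0 < w := by positivity
  have hw1 : w ≤ 1 := Real.rpow_le_one_of_one_le_of_nonpos ht (by norm_num)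
  have hP : τ ^ (1 / 8 : ℝ) * w ^ 4 = 1 := by
    rw [hw, ← Real.rpow_natCast, ← Real.rpow_mul hτ0.le, ← Real.rpow_add hτ0]; norm_num
  have hw16 : τ ^ (-(1 / 2) : ℝ) = w ^ 16 := by
    rw [hw, ← Real.rpow_natCast, ← Real.rpow_mul hτ0.le]; norm_num
  rw [hw16]
  set P := τ ^ (1 / 8 : ℝ) with hPd
  have hP0 : 0 < P := by positivity
  -- the lower bound from the 3-4-1 inequality
  have lower : ∀ x : ℝ, 0 < x → x ≤ 1 → x ^ 3 * (D ^ 4 * w ^ 4) ≤ ‖LFunction χ (1 + x + I * s.im)‖ ^ 4 := by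
    intro x hx0 hx1
    have h3 := χ.norm_LFunction_product_ge_one hx0 s.im
    rw [norm_mul, norm_mul, norm_pow, norm_pow] at h3
    have ha := h0 x hx0 hx1
    have hc := (h2 (1 + x + 2 * I * s.im) (by simp; linarith) (by simp; linarith)
      (by simp; linarith)).1
    have him : |(1 + x + 2 * I * s.im : ℂ).im| = 2 * τ := by simp [hτ]
    have hc' : ‖LFunction (χ ^ 2) (1 + x + 2 * I * s.im)‖ ≤ 2 * A2 * P := by
      refine hc.trans ?_
      rw [him, Real.mul_rpow (by norm_num) hτ0.le]
      have : (2 : ℝ) ^ (1 / 8 : ℝ) ≤ 2 := by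
        calc (2 : ℝ) ^ (1 / 8 : ℝ) ≤ 2 ^ (1 : ℝ) :=
                Real.rpow_le_rpow_of_exponent_le (by norm_num) (by norm_num)
            _ = 2 := Real.rpow_one 2
      calc A2 * (2 ^ (1 / 8 : ℝ) * P) ≤ A2 * (2 * P) := by gcongr
        _ = _ := by ring
    have h4 : (1 : ℝ) ≤ (C0 / x) ^ 3 * ‖LFunction χ (1 + x + I * s.im)‖ ^ 4 * (2 * A2 * P) := by
      refine h3.le.trans ?_
      gcongr
    rw [hD4]
    have e : x ^ 3 * (1 / (2 * A2 * C0 ^ 3) * w ^ 4) =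
        (x ^ 3 * (1 / (2 * A2 * C0 ^ 3) * w ^ 4)) * 1 := by ring
    rw [e]
    calc _ ≤ (x ^ 3 * (1 / (2 * A2 * C0 ^ 3) * w ^ 4)) *
          ((C0 / x) ^ 3 * ‖LFunction χ (1 + x + I * s.im)‖ ^ 4 * (2 * A2 * P)) := by gcongr
      _ = (P * w ^ 4) * ‖LFunction χ (1 + x + I * s.im)‖ ^ 4 := by field_simp
      _ = _ := by rw [hP, one_mul]
  set δ : ℝ := b ^ 4 * w ^ 20 with hδ
  have hδ0 : 0 < δ := by positivity
  have hδ1 : δ ≤ 1 := mul_le_one₀ (pow_le_one₀ hb0.le hb1) (by positivity) (pow_le_one₀ hw0.le hw1)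
  have big : ∀ x : ℝ, δ ≤ x → x ≤ 1 → D * b ^ 3 * w ^ 16 ≤ ‖LFunction χ (1 + x + I * s.im)‖ := by
    intro x hx0 hx1
    refine le_of_pow_le_pow_left₀ (n := 4) (by norm_num) (norm_nonneg _) ?_
    refine le_trans ?_ (lower x (hδ0.trans_le hx0) hx1)
    calc (D * b ^ 3 * w ^ 16) ^ 4 = δ ^ 3 * (D ^ 4 * w ^ 4) := by rw [hδ]; ring
      _ ≤ _ := by gcongr
  have es : s = 1 + ((s.re - 1 : ℝ) : ℂ) + I * s.im := by
    apply Complex.ext <;> simp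
  rcases le_total δ (s.re - 1) with hle | hle
  · have := big (s.re - 1) hle (by linarith)
    rw [← es] at this
    have hp : 0 ≤ D * b ^ 3 * w ^ 16 := by positivity
    linarith
  · have h5 := big δ le_rfl hδ1
    have hmv : ‖LFunction χ (1 + δ + I * s.im) - LFunction χ s‖ ≤ A1 * P * ‖(1 + δ + I * s.im) - s‖ := by
      refine Convex.norm_image_sub_le_of_norm_deriv_le (s := {z : ℂ | 1 ≤ z.re ∧ z.re ≤ 2 ∧ z.im = s.im})
        ?_ ?_ ?_ ⟨hs1.le, hs2, rfl⟩ ?_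
      · rintro z ⟨hz1, hz2, hz3⟩
        refine differentiableAt_LFunction χ z (Or.inl ?_)
        rintro rfl
        rw [hτ, ← hz3] at ht
        norm_num at ht
      · rintro z ⟨hz1, hz2, hz3⟩
        have := (h1 z hz1 hz2 (by rw [hz3]; exact ht)).2
        rwa [hz3] at this
      · intro z hz y hy a c ha hc hac
        simp only [mem_ofPred_eq] at *
        simp only [real_smul, add_re, mul_re, ofReal_re, ofReal_im, zero_mul, sub_zero, add_im, mul_im, add_zero]
        obtain ⟨hz1, hz2, hz3⟩ := hz
        obtain ⟨hy1, hy2, hy3⟩ := hy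
        refine ⟨by nlinarith, by nlinarith, ?_⟩
        rw [hz3, hy3, ← add_mul, hac, one_mul]
      · refine ⟨by simp; linarith, by simp; linarith, by simp⟩
    have hdist : ‖(1 + δ + I * s.im) - s‖ ≤ δ := by
      have : (1 + δ + I * s.im) - s = ((δ - (s.re - 1) : ℝ) : ℂ) := by
        nth_rw 2 [es]; push_cast; ring
      rw [this, norm_real, Real.norm_of_nonneg (by linarith)]
      linarith
    have h6 : A1 * P * ‖(1 + δ + I * s.im) - s‖ ≤ D / 2 * b ^ 3 * w ^ 16 := by
      calc _ ≤ A1 * P * δ := by gcongr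
        _ = (b * A1) * b ^ 3 * w ^ 16 * (P * w ^ 4) := by rw [hδ]; ring
        _ = (b * A1) * b ^ 3 * w ^ 16 := by rw [hP, mul_one]
        _ ≤ _ := by gcongr
    have h7 := norm_sub_norm_le (LFunction χ (1 + δ + I * s.im)) (LFunction χ s)
    linarith

noncomputable section

/-- `n` is nonzero and all its prime factors are congruent to `1` modulo `q`. -/
def PrimesOneMod (q n : ℕ) : Prop := n ≠ 0 ∧ ∀ p : ℕ, p.Prime → p ∣ n → (p : ZMod q) = 1

theorem PrimesOneMod.one (q : ℕ) : PrimesOneMod q 1 :=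
  ⟨one_ne_zero, fun _ hp h => absurd (Nat.dvd_one.mp h) hp.ne_one⟩

theorem primesOneMod_mul {q m n : ℕ} :
    PrimesOneMod q (m * n) ↔ PrimesOneMod q m ∧ PrimesOneMod q n := by
  constructor
  · rintro ⟨h0, h⟩
    exact ⟨⟨left_ne_zero_of_mul h0, fun p hp hd => h p hp (hd.mul_right n)⟩,
      ⟨right_ne_zero_of_mul h0, fun p hp hd => h p hp (hd.mul_left m)⟩⟩
  · rintro ⟨⟨h0, h⟩, ⟨h0', h'⟩⟩
    refine ⟨mul_ne_zero h0 h0', fun p hp hd => ?_⟩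
    rcases hp.dvd_mul.mp hd with hd | hd
    exacts [h p hp hd, h' p hp hd]

theorem primesOneMod_prime {q p : ℕ} (hp : p.Prime) :
    PrimesOneMod q p ↔ (p : ZMod q) = 1 := by
  refine ⟨fun h => h.2 p hp dvd_rfl, fun h => ⟨hp.ne_zero, fun r hr hd => ?_⟩⟩
  rwa [(Nat.prime_dvd_prime_iff_eq hr hp).mp hd]

open scoped Classical in
/-- The indicator function of the integers composed of primes congruent to `1` modulo `q`. -/
def oneModInd (q n : ℕ) : ℝ := if PrimesOneMod q n then 1 else 0

theorem oneModInd_nonneg (q n : ℕ) : 0 ≤ oneModInd q n := by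
  unfold oneModInd; split_ifs <;> simp

theorem oneModInd_le_one (q n : ℕ) : oneModInd q n ≤ 1 := by
  unfold oneModInd; split_ifs <;> simp

@[simp] theorem oneModInd_one (q : ℕ) : oneModInd q 1 = 1 := by
  simp [oneModInd, PrimesOneMod.one]

@[simp] theorem oneModInd_zero (q : ℕ) : oneModInd q 0 = 0 := by
  simp [oneModInd, PrimesOneMod]

theorem oneModInd_mul (q m n : ℕ) : oneModInd q (m * n) = oneModInd q m * oneModInd q n := by
  unfold oneModInd
  by_cases hm : PrimesOneMod q m <;> by_cases hn : PrimesOneMod q n <;>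
    simp [primesOneMod_mul, hm, hn]

theorem norm_oneModInd_le (q n : ℕ) : ‖((oneModInd q n : ℝ) : ℂ)‖ ≤ 1 := by
  rw [Complex.norm_real, Real.norm_of_nonneg (oneModInd_nonneg q n)]
  exact oneModInd_le_one q n

/-- The completely multiplicative function `n ↦ 1_{S}(n) n^{-s}`. -/
def oneModSummandHom (q : ℕ) {s : ℂ} (_hs : s ≠ 0) : ℕ →*₀ ℂ where
  toFun n := (oneModInd q n : ℂ) * (n : ℂ) ^ (-s)
  map_zero' := by simp
  map_one' := by simp
  map_mul' m n := by
    rw [oneModInd_mul]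
    simp_rw [← Complex.ofReal_natCast]
    rw [Nat.cast_mul, Complex.ofReal_mul, Complex.ofReal_mul,
      Complex.mul_cpow_ofReal_nonneg m.cast_nonneg n.cast_nonneg]
    ring

/-- The Dirichlet series of the integers composed of primes congruent to `1` modulo `q`. -/
def oneModF (q : ℕ) (s : ℂ) : ℂ := LSeries (fun n => (oneModInd q n : ℂ)) s

open Complex

theorem oneMod_lseriesSummable (q : ℕ) {s : ℂ} (hs : 1 < s.re) :
    LSeriesSummable (fun n => (oneModInd q n : ℂ)) s :=
  LSeriesSummable_of_bounded_of_one_lt_re (m := 1) (fun n _ => norm_oneModInd_le q n) hs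

theorem oneMod_term_eq (q : ℕ) {s : ℂ} (hs : s ≠ 0) (n : ℕ) :
    LSeries.term (fun n => (oneModInd q n : ℂ)) s n = oneModSummandHom q hs n := by
  rcases eq_or_ne n 0 with rfl | hn
  · simp
  · rw [LSeries.term_of_ne_zero hn]
    simp [oneModSummandHom, cpow_neg, div_eq_mul_inv]

theorem oneMod_summable_hom (q : ℕ) {s : ℂ} (hs : 1 < s.re) :
    Summable (fun n => ‖oneModSummandHom q (ne_zero_of_one_lt_re hs) n‖) := by
  have := (oneMod_lseriesSummable q hs).norm
  simpa only [LSeriesSummable, oneMod_term_eq q (ne_zero_of_one_lt_re hs)] using this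

theorem oneModF_eq_exp (q : ℕ) {s : ℂ} (hs : 1 < s.re) :
    Summable (fun p : Nat.Primes => -log (1 - (oneModInd q p : ℂ) * (p : ℂ) ^ (-s))) ∧
    exp (∑' p : Nat.Primes, -log (1 - (oneModInd q p : ℂ) * (p : ℂ) ^ (-s))) = oneModF q s := by
  have h := oneMod_summable_hom q hs
  refine ⟨(h.of_norm.clog_one_sub.neg.subtype Nat.Prime), ?_⟩
  have := EulerProduct.exp_tsum_primes_log_eq_tsum h
  rw [oneModF, LSeries]
  simp only [oneMod_term_eq q (ne_zero_of_one_lt_re hs)]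
  exact this

/-- Averaging `-log (1 - χ a z)` over all characters. -/
theorem DirichletCharacter.sum_neg_log_one_sub {q : ℕ} [NeZero q] {a : ZMod q} (ha : IsUnit a)
    {z : ℂ} (hz : ‖z‖ < 1) :
    ∑ χ : DirichletCharacter ℂ q, -log (1 - χ a * z) =
      (q.totient : ℂ) * (-(1 / (orderOf a : ℂ)) * log (1 - z ^ orderOf a)) := by
  set f := orderOf a with hf
  have hf0 : 0 < f := by
    obtain ⟨u, rfl⟩ := ha
    rw [hf, orderOf_units]; exact orderOf_pos u
  have hfC : (f : ℂ) ≠ 0 := by exact_mod_cast hf0.ne'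
  have h1 : HasSum (fun n : ℕ => ∑ χ : DirichletCharacter ℂ q, (χ a * z) ^ n / n)
      (∑ χ : DirichletCharacter ℂ q, -log (1 - χ a * z)) := by
    refine hasSum_sum fun χ _ => hasSum_taylorSeries_neg_log ?_
    rw [norm_mul]
    exact (mul_le_of_le_one_left (norm_nonneg _) (χ.norm_le_one _)).trans_lt hz
  have h2 : HasSum (fun n : ℕ => (z ^ f) ^ n / n) (-log (1 - z ^ f)) := by
    refine hasSum_taylorSeries_neg_log ?_
    rw [norm_pow]
    exact pow_lt_one₀ (norm_nonneg _) hz hf0.ne'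
  have h3 := h2.mul_left ((q.totient : ℂ) * (1 / f))
  have hinj : Function.Injective (fun n : ℕ => f * n) := fun m n h => Nat.eq_of_mul_eq_mul_left hf0 h
  have e : ∀ n : ℕ, ∑ χ : DirichletCharacter ℂ q, (χ a * z) ^ n / n =
      if f ∣ n then (q.totient : ℂ) * (z ^ n / n) else 0 := by
    intro n
    have : ∀ χ : DirichletCharacter ℂ q, (χ a * z) ^ n / n = χ (a ^ n) * (z ^ n / n) := by
      intro χ; rw [mul_pow, map_pow]; ring
    simp only [this]
    rw [← Finset.sum_mul, DirichletCharacter.sum_characters_eq]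
    simp only [hf, orderOf_dvd_iff_pow_eq_one]
    split_ifs <;> simp
  simp only [e] at h1
  rw [← hinj.hasSum_iff] at h1
  · refine h1.unique ?_
    have e2 : (q.totient : ℂ) * (-(1 / (f : ℂ)) * log (1 - z ^ f)) =
      (q.totient : ℂ) * (1 / f) * (-log (1 - z ^ f)) := by ring
    rw [e2]
    refine h3.congr_fun fun n => ?_
    simp only [Function.comp, dvd_mul_right, if_true]
    rw [pow_mul]; push_cast
    field_simp
  · intro n hn
    rw [if_neg]
    rintro ⟨m, rfl⟩
    exact hn ⟨m, rfl⟩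

open scoped Classical in
/-- The contribution to the Euler product of the primes not congruent to `1` modulo `q`. -/
def oneModWterm (q : ℕ) (p : Nat.Primes) (s : ℂ) : ℂ :=
  if ¬(p : ℕ) ∣ q ∧ ((p : ℕ) : ZMod q) ≠ 1 then
    -(1 / (orderOf ((p : ℕ) : ZMod q) : ℂ)) * log (1 - ((p : ℂ) ^ (-s)) ^ orderOf ((p : ℕ) : ZMod q))
  else 0

/-- The sum of the contributions of the primes not congruent to `1` modulo `q`. -/
def oneModW (q : ℕ) (s : ℂ) : ℂ := ∑' p : Nat.Primes, oneModWterm q p s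

theorem two_le_orderOf_of_ne_one {q : ℕ} [NeZero q] {a : ZMod q} (ha : IsUnit a) (h1 : a ≠ 1) :
    2 ≤ orderOf a := by
  obtain ⟨u, rfl⟩ := ha
  rw [orderOf_units]
  have h0 := orderOf_pos u
  have : orderOf u ≠ 1 := by rw [Ne, orderOf_eq_one_iff]; rintro rfl; simp at h1
  lia

theorem isUnit_prime_of_not_dvd {q p : ℕ} (hp : p.Prime) (h : ¬ p ∣ q) : IsUnit (p : ZMod q) :=
  (ZMod.isUnit_iff_coprime p q).mpr ((Nat.Prime.coprime_iff_not_dvd hp).mpr h)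

theorem norm_prime_cpow_pow_le (p : Nat.Primes) {s : ℂ} (hs : 3 / 4 ≤ s.re) {f : ℕ} (hf : 2 ≤ f) :
    ‖((p : ℂ) ^ (-s)) ^ f‖ ≤ ((p : ℕ) : ℝ) ^ (-(3 / 2) : ℝ) ∧ ((p : ℕ) : ℝ) ^ (-(3 / 2) : ℝ) ≤ 1 / 2 := by
  have hp2 : (2 : ℝ) ≤ (p : ℕ) := by exact_mod_cast p.prop.two_le
  have hp0 : (0 : ℝ) < (p : ℕ) := by linarith
  constructor
  · rw [norm_pow, norm_natCast_cpow_of_pos p.prop.pos, neg_re, ← Real.rpow_natCast,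
      ← Real.rpow_mul hp0.le]
    refine Real.rpow_le_rpow_of_exponent_le (by linarith) ?_
    have : (2 : ℝ) ≤ f := by exact_mod_cast hf
    nlinarith
  · calc ((p : ℕ) : ℝ) ^ (-(3 / 2) : ℝ) ≤ ((p : ℕ) : ℝ) ^ (-1 : ℝ) :=
          Real.rpow_le_rpow_of_exponent_le (by linarith) (by norm_num)
      _ = ((p : ℕ) : ℝ)⁻¹ := Real.rpow_neg_one _
      _ ≤ 1 / 2 := by rw [one_div]; gcongr

theorem norm_oneModWterm_le (q : ℕ) [NeZero q] (p : Nat.Primes) {s : ℂ} (hs : 3 / 4 ≤ s.re) :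
    ‖oneModWterm q p s‖ ≤ 3 / 2 * ((p : ℕ) : ℝ) ^ (-(3 / 2) : ℝ) := by
  unfold oneModWterm
  split_ifs with h
  · have hf := two_le_orderOf_of_ne_one (isUnit_prime_of_not_dvd p.prop h.1) h.2
    obtain ⟨h1, h2⟩ := norm_prime_cpow_pow_le p hs hf
    have h3 := norm_log_one_add_half_le_self (z := -((p : ℂ) ^ (-s)) ^ orderOf ((p : ℕ) : ZMod q))
      (by rw [norm_neg]; exact h1.trans h2)
    rw [norm_neg, ← sub_eq_add_neg] at h3
    rw [norm_mul, norm_neg, norm_div, norm_one, norm_natCast]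
    have hf' : (2 : ℝ) ≤ orderOf ((p : ℕ) : ZMod q) := by exact_mod_cast hf
    refine (mul_le_of_le_one_left (norm_nonneg _) ?_).trans (h3.trans (by gcongr))
    rw [div_le_one (by linarith)]
    linarith
  · simp; positivity

theorem summable_oneModW_bound :
    Summable (fun p : Nat.Primes => 3 / 2 * ((p : ℕ) : ℝ) ^ (-(3 / 2) : ℝ)) :=
  (Nat.Primes.summable_rpow.mpr (by norm_num)).mul_left _

theorem summable_oneModWterm (q : ℕ) [NeZero q] {s : ℂ} (hs : 3 / 4 ≤ s.re) :
    Summable (fun p => oneModWterm q p s) :=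
  Summable.of_norm_bounded summable_oneModW_bound fun p => norm_oneModWterm_le q p hs

theorem exists_norm_oneModW_le (q : ℕ) [NeZero q] :
    ∃ C : ℝ, 0 < C ∧ ∀ s : ℂ, 3 / 4 ≤ s.re → ‖oneModW q s‖ ≤ C := by
  refine ⟨|∑' p : Nat.Primes, 3 / 2 * ((p : ℕ) : ℝ) ^ (-(3 / 2) : ℝ)| + 1, by positivity,
    fun s hs => ?_⟩
  refine (tsum_of_norm_bounded summable_oneModW_bound.hasSum
    fun p => norm_oneModWterm_le q p hs).trans ?_
  linarith [le_abs_self (∑' p : Nat.Primes, 3 / 2 * ((p : ℕ) : ℝ) ^ (-(3 / 2) : ℝ))]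

theorem differentiableOn_oneModW (q : ℕ) [NeZero q] :
    DifferentiableOn ℂ (oneModW q) {s : ℂ | 3 / 4 < s.re} := by
  refine differentiableOn_tsum_of_summable_norm summable_oneModW_bound (fun p => ?_)
    (isOpen_re_gt _) fun p s hs => norm_oneModWterm_le q p (le_of_lt hs)
  unfold oneModWterm
  split_ifs with h
  · intro s hs
    have hf := two_le_orderOf_of_ne_one (isUnit_prime_of_not_dvd p.prop h.1) h.2
    obtain ⟨h1, h2⟩ := norm_prime_cpow_pow_le p (le_of_lt hs) hf
    have hp0 : ((p : ℕ) : ℂ) ≠ 0 := by exact_mod_cast p.prop.ne_zero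
    refine DifferentiableAt.differentiableWithinAt ?_
    refine DifferentiableAt.const_mul ?_ _
    refine DifferentiableAt.clog ?_ ?_
    · exact (((DifferentiableAt.const_cpow differentiable_neg.differentiableAt (Or.inl hp0))).pow _).const_sub _
    · rw [sub_eq_add_neg]
      refine mem_slitPlane_of_norm_lt_one ?_
      rw [norm_neg]
      linarith
  · exact differentiableOn_const _

theorem prod_LFunction_eq (q : ℕ) [NeZero q] {s : ℂ} (hs : 1 < s.re) :
    ∏ χ : DirichletCharacter ℂ q, DirichletCharacter.LFunction χ s =
      oneModF q s ^ q.totient * exp (q.totient * oneModW q s) := by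
  obtain ⟨hV, hF⟩ := oneModF_eq_exp q hs
  have hW := summable_oneModWterm q (s := s) (by linarith)
  have h1 : ∀ χ : DirichletCharacter ℂ q, DirichletCharacter.LFunction χ s =
      exp (∑' p : Nat.Primes, -log (1 - χ p * (p : ℂ) ^ (-s))) := fun χ => by
    rw [DirichletCharacter.LSeries_eulerProduct_exp_log χ hs, DirichletCharacter.LFunction_eq_LSeries χ hs]
  simp only [h1]
  rw [← exp_sum, ← Summable.tsum_finsetSum
    (fun χ _ => χ.summable_neg_log_one_sub_mul_prime_cpow hs), ← hF, ← exp_nat_mul, ← exp_add,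
    oneModW, ← tsum_mul_left, ← tsum_mul_left, ← (hV.mul_left _).tsum_add (hW.mul_left _)]
  congr 1
  refine tsum_congr fun p => ?_
  have hz : ‖(p : ℂ) ^ (-s)‖ < 1 := by
    rw [norm_natCast_cpow_of_pos p.prop.pos]
    exact Real.rpow_lt_one_of_one_lt_of_neg (by exact_mod_cast p.prop.one_lt) (by simp; linarith)
  by_cases hp : (p : ℕ) ∣ q
  · have hnu : ¬ IsUnit (((p : ℕ)) : ZMod q) := by
      rw [ZMod.isUnit_iff_coprime, Nat.Prime.coprime_iff_not_dvd p.prop]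
      simpa using hp
    have hw : oneModWterm q p s = 0 := by simp [oneModWterm, hp]
    have hv : oneModInd q p = 0 := by
      rw [oneModInd, if_neg]
      rw [primesOneMod_prime p.prop]
      intro h; exact hnu (h ▸ isUnit_one)
    rw [hw, hv]
    simp [MulChar.map_nonunit _ hnu]
  · have hu := isUnit_prime_of_not_dvd p.prop hp
    rw [DirichletCharacter.sum_neg_log_one_sub hu hz, ← mul_add]
    congr 1
    by_cases h1 : ((p : ℕ) : ZMod q) = 1
    · have hw : oneModWterm q p s = 0 := by simp [oneModWterm, h1]
      have hv : oneModInd q p = 1 := by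
        rw [oneModInd, if_pos ((primesOneMod_prime p.prop).mpr h1)]
      rw [hw, hv, h1]
      simp
    · have hw : oneModWterm q p s = -(1 / (orderOf ((p : ℕ) : ZMod q) : ℂ)) * log (1 - ((p : ℂ) ^ (-s)) ^ orderOf ((p : ℕ) : ZMod q)) := by
        simp [oneModWterm, h1, hp]
      have hv : oneModInd q p = 0 := by
        rw [oneModInd, if_neg]
        rwa [primesOneMod_prime p.prop]
      rw [hw, hv]
      simp
end

noncomputable section

open Complex

/-- The function `(s - 1) F(s)^φ(q)`, continued beyond `re s = 1`. -/
def oneModP (q : ℕ) [NeZero q] (s : ℂ) : ℂ :=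
  DirichletCharacter.LFunctionTrivChar₁ q s *
    (∏ χ ∈ (Finset.univ.erase (1 : DirichletCharacter ℂ q)), DirichletCharacter.LFunction χ s) *
    exp (-(q.totient * oneModW q s))

theorem differentiableOn_oneModP (q : ℕ) [NeZero q] :
    DifferentiableOn ℂ (oneModP q) {s : ℂ | 3 / 4 < s.re} := by
  unfold oneModP
  refine DifferentiableOn.mul (DifferentiableOn.mul ?_ ?_) ?_
  · exact (DirichletCharacter.differentiable_LFunctionTrivChar₁ q).differentiableOn
  · refine DifferentiableOn.fun_finsetProd fun χ hχ => ?_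
    exact (DirichletCharacter.differentiable_LFunction (Finset.ne_of_mem_erase hχ)).differentiableOn
  · exact (((differentiableOn_oneModW q).const_mul _).neg).cexp

theorem oneModP_ne_zero (q : ℕ) [NeZero q] {s : ℂ} (hs : 1 ≤ s.re) : oneModP q s ≠ 0 := by
  unfold oneModP
  refine mul_ne_zero (mul_ne_zero ?_ ?_) (exp_ne_zero _)
  · rcases eq_or_ne s 1 with rfl | h1
    · exact DirichletCharacter.LFunctionTrivChar₁_apply_one_ne_zero q
    · rw [DirichletCharacter.LFunctionTrivChar₁, Function.update_of_ne h1]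
      exact mul_ne_zero (sub_ne_zero.mpr h1)
        (DirichletCharacter.LFunction_ne_zero_of_one_le_re 1 (Or.inr h1) hs)
  · refine Finset.prod_ne_zero_iff.mpr fun χ hχ => ?_
    exact DirichletCharacter.LFunction_ne_zero_of_one_le_re χ (Or.inl (Finset.ne_of_mem_erase hχ)) hs

theorem oneModP_eq (q : ℕ) [NeZero q] {s : ℂ} (hs : 1 < s.re) :
    oneModP q s = (s - 1) * oneModF q s ^ q.totient := by
  have h1 : s ≠ 1 := by rintro rfl; simp at hs
  have h := prod_LFunction_eq q hs
  rw [← Finset.mul_prod_erase _ _ (Finset.mem_univ (1 : DirichletCharacter ℂ q))] at h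
  rw [oneModP, DirichletCharacter.LFunctionTrivChar₁, Function.update_of_ne h1, mul_assoc (s - 1),
    DirichletCharacter.LFunctionTrivChar, h, mul_assoc, mul_assoc, ← exp_add]
  simp

theorem oneModF_ne_zero (q : ℕ) {s : ℂ} (hs : 1 < s.re) : oneModF q s ≠ 0 := by
  rw [← (oneModF_eq_exp q hs).2]; exact exp_ne_zero _

theorem oneMod_abscissa_lt (q : ℕ) {s : ℂ} (hs : 1 < s.re) :
    LSeries.abscissaOfAbsConv (fun n => (oneModInd q n : ℂ)) < s.re := by
  refine (LSeries.abscissaOfAbsConv_le_one_of_isBigO_one ?_).trans_lt (by exact_mod_cast hs)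
  refine Asymptotics.isBigO_of_le _ fun n => ?_
  simpa using norm_oneModInd_le q n

theorem hasDerivAt_oneModF (q : ℕ) {s : ℂ} (hs : 1 < s.re) :
    HasDerivAt (oneModF q) (-LSeries (LSeries.logMul fun n => (oneModInd q n : ℂ)) s) s :=
  LSeries_hasDerivAt (oneMod_abscissa_lt q hs)

theorem exists_oneModF_ofReal (q : ℕ) {σ : ℝ} (hσ : 1 < σ) :
    ∃ r : ℝ, 0 < r ∧ oneModF q σ = r := by
  have e : ∀ n : ℕ, LSeries.term (fun n => (oneModInd q n : ℂ)) σ n =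
      ((if n = 0 then 0 else oneModInd q n / (n : ℝ) ^ σ : ℝ) : ℂ) := by
    intro n
    rcases eq_or_ne n 0 with rfl | hn
    · simp
    · rw [LSeries.term_of_ne_zero hn, if_neg hn]
      push_cast
      rw [ofReal_cpow (Nat.cast_nonneg n)]
      simp
  refine ⟨∑' n : ℕ, (if n = 0 then 0 else oneModInd q n / (n : ℝ) ^ σ), ?_, ?_⟩
  · have h0 : 0 ≤ ∑' n : ℕ, (if n = 0 then 0 else oneModInd q n / (n : ℝ) ^ σ) := by
      refine tsum_nonneg fun n => ?_
      split_ifs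
      · rfl
      · exact div_nonneg (oneModInd_nonneg q n) (by positivity)
    refine lt_of_le_of_ne h0 fun h => ?_
    refine oneModF_ne_zero q (s := σ) (by simpa using hσ) ?_
    rw [oneModF, LSeries, tsum_congr e, ← ofReal_tsum, ← h, ofReal_zero]
  · rw [oneModF, LSeries, tsum_congr e, ← ofReal_tsum]

/-- The function `F(s) (s-1)^{1/φ(q)}`. -/
def oneModH (q : ℕ) (s : ℂ) : ℂ := oneModF q s * (s - 1) ^ ((q.totient : ℂ)⁻¹)

theorem totient_ne_zero_of_neZero (q : ℕ) [NeZero q] : q.totient ≠ 0 :=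
  (Nat.totient_pos.mpr (NeZero.pos q)).ne'

theorem oneModH_pow (q : ℕ) [NeZero q] {s : ℂ} (hs : 1 < s.re) :
    oneModH q s ^ q.totient = oneModP q s := by
  rw [oneModH, mul_pow, cpow_nat_inv_pow _ (totient_ne_zero_of_neZero q), oneModP_eq q hs, mul_comm]

theorem norm_oneModH (q : ℕ) [NeZero q] {s : ℂ} (hs : 1 < s.re) :
    ‖oneModH q s‖ = ‖oneModP q s‖ ^ ((1 : ℝ) / q.totient) := by
  rw [← oneModH_pow q hs, norm_pow, one_div, Real.pow_rpow_inv_natCast (norm_nonneg _)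
    (totient_ne_zero_of_neZero q)]

theorem sub_one_mem_slitPlane {s : ℂ} (hs : 1 < s.re) : s - 1 ∈ slitPlane :=
  Or.inl (by simpa using hs)

theorem differentiableAt_oneModH (q : ℕ) {s : ℂ} (hs : 1 < s.re) :
    DifferentiableAt ℂ (oneModH q) s := by
  refine (hasDerivAt_oneModF q hs).differentiableAt.mul ?_
  exact DifferentiableAt.cpow (by fun_prop) (by fun_prop) (sub_one_mem_slitPlane hs)

theorem deriv_oneModH (q : ℕ) [NeZero q] {s : ℂ} (hs : 1 < s.re) :
    deriv (oneModH q) s = oneModH q s * (deriv (oneModP q) s / oneModP q s) / q.totient := by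
  have hφ : (q.totient : ℂ) ≠ 0 := by exact_mod_cast totient_ne_zero_of_neZero q
  have hd := differentiableAt_oneModH q hs
  have h1 : deriv (oneModP q) s = q.totient * oneModH q s ^ (q.totient - 1) * deriv (oneModH q) s := by
    have : oneModP q =ᶠ[nhds s] (fun z => oneModH q z ^ q.totient) := by
      filter_upwards [(isOpen_re_gt 1).mem_nhds hs] with z hz using (oneModH_pow q hz).symm
    rw [this.deriv_eq]
    exact (hd.hasDerivAt.pow q.totient).deriv
  have h0 : oneModH q s ≠ 0 := by
    intro h
    have := oneModH_pow q hs
    rw [h, zero_pow (totient_ne_zero_of_neZero q)] at this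
    exact oneModP_ne_zero q hs.le this.symm
  have h2 : oneModH q s ^ q.totient = oneModH q s ^ (q.totient - 1) * oneModH q s := by
    rw [← pow_succ, Nat.sub_add_cancel (Nat.totient_pos.mpr (NeZero.pos q))]
  rw [h1, ← oneModH_pow q hs, h2]
  field_simp

/-- The positive real number `lim_{s → 1} F(s) (s-1)^{1/φ(q)}`. -/
def oneModH1 (q : ℕ) [NeZero q] : ℝ := ‖oneModP q 1‖ ^ ((1 : ℝ) / q.totient)

theorem oneModH_ofReal (q : ℕ) [NeZero q] {σ : ℝ} (hσ : 1 < σ) :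
    oneModH q σ = ((‖oneModP q σ‖ ^ ((1 : ℝ) / q.totient) : ℝ) : ℂ) := by
  rw [← norm_oneModH q (by simpa using hσ)]
  obtain ⟨r, hr, h⟩ := exists_oneModF_ofReal q hσ
  have : oneModH q σ = ((r * (σ - 1) ^ ((q.totient : ℝ)⁻¹) : ℝ) : ℂ) := by
    rw [oneModH, h]
    push_cast
    rw [ofReal_cpow (by linarith)]
    push_cast
    rfl
  rw [this, norm_real, Real.norm_of_nonneg]
  exact mul_nonneg hr.le (Real.rpow_nonneg (by linarith) _)

open Filter Topology in
theorem tendsto_oneModP (q : ℕ) [NeZero q] :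
    Tendsto (fun σ : ℝ => oneModP q σ) (𝓝[>] 1) (𝓝 (oneModP q 1)) := by
  have h1 : ContinuousAt (oneModP q) ((1 : ℝ) : ℂ) :=
    ((differentiableOn_oneModP q).differentiableAt
      ((isOpen_re_gt _).mem_nhds (by norm_num))).continuousAt
  have := (h1.comp continuous_ofReal.continuousAt).tendsto
  rw [show (oneModP q ∘ ofReal) 1 = oneModP q 1 by simp] at this
  exact tendsto_nhdsWithin_of_tendsto_nhds this

open Filter Topology in
theorem tendsto_oneModH (q : ℕ) [NeZero q] :
    Tendsto (fun σ : ℝ => oneModH q σ) (𝓝[>] 1) (𝓝 (oneModH1 q : ℂ)) := by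
  have h1 : Tendsto (fun σ : ℝ => ((‖oneModP q σ‖ ^ ((1 : ℝ) / q.totient) : ℝ) : ℂ)) (𝓝[>] 1)
      (𝓝 (oneModH1 q : ℂ)) := by
    refine (continuous_ofReal.tendsto _).comp ?_
    exact (tendsto_oneModP q).norm.rpow_const (Or.inr (by positivity))
  refine h1.congr' ?_
  filter_upwards [self_mem_nhdsWithin] with σ hσ using (oneModH_ofReal q hσ).symm

open Filter Topology in
theorem oneModP_one_eq_norm (q : ℕ) [NeZero q] : oneModP q 1 = ((‖oneModP q 1‖ : ℝ) : ℂ) := by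
  have h1 : Tendsto (fun σ : ℝ => ((‖oneModP q σ‖ : ℝ) : ℂ)) (𝓝[>] 1) (𝓝 ((‖oneModP q 1‖ : ℝ) : ℂ)) :=
    (continuous_ofReal.tendsto _).comp (tendsto_oneModP q).norm
  refine tendsto_nhds_unique (tendsto_oneModP q) (h1.congr' ?_)
  filter_upwards [self_mem_nhdsWithin] with σ hσ
  have hσ : 1 < σ := hσ
  obtain ⟨r, hr, h⟩ := exists_oneModF_ofReal q hσ
  have : oneModP q σ = (((σ - 1) * r ^ q.totient : ℝ) : ℂ) := by
    rw [oneModP_eq q (by simpa using hσ), h]; push_cast; rfl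
  rw [this, norm_real, Real.norm_of_nonneg]
  exact mul_nonneg (by linarith) (by positivity)

/-- Local bounds for `H` near `s = 1`. -/
theorem exists_oneModH_bounds (q : ℕ) [NeZero q] :
    ∃ M : ℝ, 0 < M ∧ ∀ s : ℂ, 1 < s.re → s.re ≤ 2 → |s.im| ≤ 1 →
      ‖oneModH q s‖ ≤ M ∧ ‖deriv (oneModH q) s‖ ≤ M ∧ ‖oneModH q s - oneModH1 q‖ ≤ M * ‖s - 1‖ := by
  set K : Set ℂ := Set.Icc 1 2 ×ℂ Set.Icc (-1) 1 with hK
  have hKc : IsCompact K := isCompact_Icc.reProdIm isCompact_Icc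
  have hKU : K ⊆ {s : ℂ | 3 / 4 < s.re} := by
    intro s hs
    have := (mem_reProdIm.mp hs).1.1
    simp only [Set.mem_ofPred_eq]; linarith
  have c1 : ContinuousOn (oneModP q) K := (differentiableOn_oneModP q).continuousOn.mono hKU
  have c2 : ContinuousOn (fun s => deriv (oneModP q) s / oneModP q s) K := by
    refine ContinuousOn.div ?_ c1 fun s hs => oneModP_ne_zero q (mem_reProdIm.mp hs).1.1
    exact ((differentiableOn_oneModP q).deriv (isOpen_re_gt _)).continuousOn.mono hKU
  obtain ⟨M1, hM1⟩ := hKc.exists_bound_of_continuousOn c1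
  obtain ⟨M2, hM2⟩ := hKc.exists_bound_of_continuousOn c2
  have hφ1 : (1 : ℝ) ≤ q.totient := by exact_mod_cast Nat.totient_pos.mpr (NeZero.pos q)
  have hM10 : 0 ≤ M1 := (norm_nonneg _).trans (hM1 1 (by simp [hK, mem_reProdIm]))
  have hM20 : 0 ≤ M2 := (norm_nonneg _).trans (hM2 1 (by simp [hK, mem_reProdIm]))
  have hmem : ∀ s : ℂ, 1 < s.re → s.re ≤ 2 → |s.im| ≤ 1 → s ∈ K := fun s h1 h2 h3 =>
    mem_reProdIm.mpr ⟨⟨h1.le, h2⟩, abs_le.mp h3⟩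
  set M : ℝ := M1 ^ ((1 : ℝ) / q.totient) * (1 + M2) + 1 with hM
  have hp : 0 ≤ M1 ^ ((1 : ℝ) / q.totient) := by positivity
  have hb1 : ∀ s : ℂ, 1 < s.re → s.re ≤ 2 → |s.im| ≤ 1 → ‖oneModH q s‖ ≤ M1 ^ ((1 : ℝ) / q.totient) := by
    intro s h1 h2 h3
    rw [norm_oneModH q h1]
    exact Real.rpow_le_rpow (norm_nonneg _) (hM1 s (hmem s h1 h2 h3)) (by positivity)
  have hb2 : ∀ s : ℂ, 1 < s.re → s.re ≤ 2 → |s.im| ≤ 1 → ‖deriv (oneModH q) s‖ ≤ M := by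
    intro s h1 h2 h3
    rw [deriv_oneModH q h1, norm_div, norm_mul, norm_natCast]
    refine (div_le_self (by positivity) hφ1).trans ?_
    have := mul_le_mul (hb1 s h1 h2 h3) (hM2 s (hmem s h1 h2 h3)) (norm_nonneg _) hp
    nlinarith
  refine ⟨M, by positivity, fun s h1 h2 h3 => ⟨?_, hb2 s h1 h2 h3, ?_⟩⟩
  · have := hb1 s h1 h2 h3
    nlinarith
  · have hconv : Convex ℝ {s : ℂ | 1 < s.re ∧ s.re ≤ 2 ∧ |s.im| ≤ 1} := by
      have e : {s : ℂ | 1 < s.re ∧ s.re ≤ 2 ∧ |s.im| ≤ 1} =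
          {s : ℂ | 1 < s.re} ∩ ({s : ℂ | s.re ≤ 2} ∩ ({s : ℂ | -1 ≤ s.im} ∩ {s : ℂ | s.im ≤ 1})) := by
        ext s; simp [abs_le]
      rw [e]
      exact (convex_halfSpace_re_gt 1).inter ((convex_halfSpace_re_le 2).inter
        ((convex_halfSpace_im_ge (-1)).inter (convex_halfSpace_im_le 1)))
    have hlip : ∀ σ : ℝ, 1 < σ → σ ≤ 2 → ‖oneModH q s - oneModH q σ‖ ≤ M * ‖s - σ‖ := by
      intro σ hσ1 hσ2
      refine hconv.norm_image_sub_le_of_norm_deriv_le (𝕜 := ℂ)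
        (fun z hz => differentiableAt_oneModH q hz.1) (fun z hz => hb2 z hz.1 hz.2.1 hz.2.2) ?_ ⟨h1, h2, h3⟩
      simp [hσ1, hσ2]
    have t1 : Filter.Tendsto (fun σ : ℝ => ‖oneModH q s - oneModH q σ‖) (nhdsWithin 1 (Set.Ioi 1))
        (nhds ‖oneModH q s - oneModH1 q‖) := (tendsto_const_nhds.sub (tendsto_oneModH q)).norm
    have t2 : Filter.Tendsto (fun σ : ℝ => M * ‖s - σ‖) (nhdsWithin 1 (Set.Ioi 1))
        (nhds (M * ‖s - 1‖)) := by
      refine tendsto_nhdsWithin_of_tendsto_nhds ?_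
      have : Continuous (fun σ : ℝ => M * ‖s - σ‖) := by fun_prop
      simpa using this.tendsto 1
    refine le_of_tendsto_of_tendsto t1 t2 ?_
    filter_upwards [Ioo_mem_nhdsGT (show (1 : ℝ) < 2 by norm_num)] with σ hσ
    exact hlip σ hσ.1 hσ.2.le
end

noncomputable section

open Complex

open scoped Classical in
/-- The Euler factor at `p` in the definition of `G_q`. -/
def GqFactor (q : ℕ) (p : Nat.Primes) : ℝ :=
  if ¬(p : ℕ) ∣ q ∧ (((p : ℕ) : ZMod q) ≠ 1) then
    (1 - ((p : ℕ) : ℝ) ^ (-(orderOf (((p : ℕ) : ZMod q)) : ℝ))) ^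
      ((1 : ℝ) / (orderOf (((p : ℕ) : ZMod q)) : ℝ))
  else 1

theorem GqFactor_pos_and_log (q : ℕ) [NeZero q] (p : Nat.Primes) :
    0 < GqFactor q p ∧ oneModWterm q p 1 = ((-Real.log (GqFactor q p) : ℝ) : ℂ) := by
  unfold GqFactor oneModWterm
  split_ifs with h
  · set f := orderOf (((p : ℕ) : ZMod q))
    have hf : 2 ≤ f := two_le_orderOf_of_ne_one (isUnit_prime_of_not_dvd p.prop h.1) h.2
    have hp1 : (1 : ℝ) < (p : ℕ) := by exact_mod_cast p.prop.one_lt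
    have hlt : ((p : ℕ) : ℝ) ^ (-(f : ℝ)) < 1 :=
      Real.rpow_lt_one_of_one_lt_of_neg hp1 (by simp; lia)
    have hpos : 0 < 1 - ((p : ℕ) : ℝ) ^ (-(f : ℝ)) := by linarith
    refine ⟨Real.rpow_pos_of_pos hpos _, ?_⟩
    rw [Real.log_rpow hpos]
    push_cast
    rw [ofReal_log hpos.le]
    have : ((1 - ((p : ℕ) : ℝ) ^ (-(f : ℝ)) : ℝ) : ℂ) = 1 - ((p : ℂ) ^ (-(1 : ℂ))) ^ f := by
      push_cast
      rw [cpow_neg_one, Real.rpow_neg (by positivity), Real.rpow_natCast, inv_pow]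
      push_cast
      rfl
    rw [this]
    ring
  · simp

theorem summable_log_GqFactor (q : ℕ) [NeZero q] :
    Summable (fun p : Nat.Primes => Real.log (GqFactor q p)) := by
  have h := summable_oneModWterm q (s := 1) (by norm_num)
  have e : ∀ p, oneModWterm q p 1 = ((-Real.log (GqFactor q p) : ℝ) : ℂ) :=
    fun p => (GqFactor_pos_and_log q p).2
  simp only [e] at h
  have := Complex.summable_ofReal.mp h
  simpa using this.neg

theorem oneModW_one (q : ℕ) [NeZero q] :
    oneModW q 1 = ((-∑' p : Nat.Primes, Real.log (GqFactor q p) : ℝ) : ℂ) := by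
  have e : ∀ p, oneModWterm q p 1 = ((-Real.log (GqFactor q p) : ℝ) : ℂ) :=
    fun p => (GqFactor_pos_and_log q p).2
  rw [oneModW, tsum_congr e, ← ofReal_tsum, tsum_neg]

theorem Gq_eq (q : ℕ) [NeZero q] : Gq q = oneModH1 q / Real.Gamma (1 / q.totient) := by
  classical
  set w : ℝ := ∑' p : Nat.Primes, Real.log (GqFactor q p) with hw
  set R : ℝ := (q.totient : ℝ) / q with hR
  have hq0 : (q : ℝ) ≠ 0 := by exact_mod_cast NeZero.ne q
  have hφ0 : (q.totient : ℝ) ≠ 0 := by exact_mod_cast totient_ne_zero_of_neZero q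
  have hR0 : 0 < R := by
    have : 0 < q := NeZero.pos q
    have := Nat.totient_pos.mpr this
    positivity
  set Pi0 : ℂ := ∏ χ ∈ (Finset.univ.erase (1 : DirichletCharacter ℂ q)),
    DirichletCharacter.LFunction χ 1 with hPi0
  have hprod : ∏ p ∈ q.primeFactors, (1 - (p : ℂ)⁻¹) = (R : ℂ) := by
    have h := Nat.totient_eq_mul_prod_factors q
    have h' : ((q.totient : ℚ) : ℂ) = ((q * ∏ p ∈ q.primeFactors, (1 - (p : ℚ)⁻¹) : ℚ) : ℂ) := by
      rw [h]
    push_cast at h'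
    rw [hR]
    push_cast
    rw [h', mul_div_cancel_left₀]
    exact_mod_cast hq0
  have hP : oneModP q 1 = (R : ℂ) * Pi0 * ((Real.exp (q.totient * w) : ℝ) : ℂ) := by
    rw [oneModP, oneModW_one, DirichletCharacter.LFunctionTrivChar₁, Function.update_self, hprod, ← hw, ← hPi0]
    simp only [ofReal_neg, ofReal_exp, ofReal_mul, ofReal_natCast, mul_neg, neg_neg]
  have hPn := oneModP_one_eq_norm q
  rw [hP] at hPn
  have hE := Real.exp_pos (q.totient * w)
  have hre : Pi0.re = ‖oneModP q 1‖ / (R * Real.exp (q.totient * w)) := by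
    rw [hP, eq_div_iff (by positivity)]
    have := congrArg Complex.re hPn
    rw [ofReal_re] at this
    rw [← this, mul_right_comm, ← ofReal_mul, re_ofReal_mul, mul_comm]
  have hPi1 : (∏ χ : DirichletCharacter ℂ q,
      if χ ≠ 1 then DirichletCharacter.LFunction χ 1 else 1) = Pi0 := by
    rw [← Finset.mul_prod_erase _ _ (Finset.mem_univ (1 : DirichletCharacter ℂ q)), hPi0]
    simp only [ne_eq, not_true_eq_false, if_false, one_mul]
    refine Finset.prod_congr rfl fun χ hχ => ?_
    rw [if_pos (Finset.ne_of_mem_erase hχ)]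
  have htprod : ∏' p : Nat.Primes, GqFactor q p = Real.exp w :=
    (Real.rexp_tsum_eq_tprod (fun p => (GqFactor_pos_and_log q p).1) (summable_log_GqFactor q)).symm
  have hG : Gq q = (1 / Real.Gamma (1 / q.totient)) *
      (R * Pi0.re) ^ ((1 : ℝ) / q.totient) * ∏' p : Nat.Primes, GqFactor q p := by
    rw [Gq, dif_neg (NeZero.ne q), ← hPi1]
    congr!
  rw [hG, htprod, hre, oneModH1]
  have e1 : R * (‖oneModP q 1‖ / (R * Real.exp (q.totient * w))) =
      ‖oneModP q 1‖ * Real.exp (-(q.totient * w)) := by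
    rw [Real.exp_neg]; field_simp
  rw [e1, Real.mul_rpow (norm_nonneg _) (Real.exp_pos _).le, ← Real.exp_mul]
  have e2 : -(q.totient * w) * ((1 : ℝ) / q.totient) = -w := by field_simp
  rw [e2, Real.exp_neg]
  field_simp

theorem logDeriv_oneModF (q : ℕ) [NeZero q] {s : ℂ} (hs : 1 < s.re) :
    (q.totient : ℂ) * (deriv (oneModF q) s / oneModF q s) =
      (∑ χ : DirichletCharacter ℂ q,
        deriv (DirichletCharacter.LFunction χ) s / DirichletCharacter.LFunction χ s) -
      q.totient * deriv (oneModW q) s := by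
  have h1 : s ≠ 1 := by rintro rfl; simp at hs
  have hFd := (hasDerivAt_oneModF q hs).differentiableAt
  have hWd : DifferentiableAt ℂ (oneModW q) s :=
    (differentiableOn_oneModW q).differentiableAt ((isOpen_re_gt _).mem_nhds (by
      simp only [Set.mem_ofPred_eq]; linarith))
  have e : (fun z => ∏ χ : DirichletCharacter ℂ q, DirichletCharacter.LFunction χ z) =ᶠ[nhds s]
      (fun z => oneModF q z ^ q.totient * exp (q.totient * oneModW q z)) := by
    filter_upwards [(isOpen_re_gt 1).mem_nhds hs] with z hz using prod_LFunction_eq q hz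
  have h2 := (logDeriv_congr_nhds e).eq_of_nhds
  have hEd : DifferentiableAt ℂ (fun z => exp (q.totient * oneModW q z)) s :=
    (hWd.const_mul _).cexp
  rw [logDeriv_prod (fun χ _ => DirichletCharacter.LFunction_ne_zero_of_one_le_re χ (Or.inr h1) hs.le)
    (fun χ _ => DirichletCharacter.differentiableAt_LFunction χ s (Or.inl h1)),
    logDeriv_mul (f := fun z => oneModF q z ^ q.totient)
      (g := fun z => exp (q.totient * oneModW q z)) s
      (pow_ne_zero _ (oneModF_ne_zero q hs)) (exp_ne_zero _) (hFd.pow _) hEd,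
    logDeriv_fun_pow hFd] at h2
  have h3 : logDeriv (fun z => exp (q.totient * oneModW q z)) s = q.totient * deriv (oneModW q) s := by
    rw [logDeriv_apply, ((hWd.hasDerivAt.const_mul (q.totient : ℂ)).cexp).deriv,
      mul_div_cancel_left₀ _ (exp_ne_zero _)]
  rw [h3] at h2
  simp only [logDeriv_apply] at h2
  rw [h2]; ring

theorem exists_norm_deriv_oneModW_le (q : ℕ) [NeZero q] :
    ∃ C : ℝ, 0 < C ∧ ∀ s : ℂ, 1 ≤ s.re → ‖deriv (oneModW q) s‖ ≤ C := by
  obtain ⟨C, hC, h⟩ := exists_norm_oneModW_le q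
  refine ⟨C / (1 / 8), by positivity, fun s hs => ?_⟩
  have hball : ∀ z ∈ Metric.closedBall s (1 / 8), 3 / 4 < z.re := by
    intro z hz
    rw [mem_closedBall_iff_norm] at hz
    have := (abs_re_le_norm (z - s)).trans hz
    rw [sub_re, abs_le] at this
    linarith
  refine Complex.norm_deriv_le_of_forall_mem_sphere_norm_le (by norm_num) ?_
    fun z hz => h z (hball z (Metric.sphere_subset_closedBall hz)).le
  refine DifferentiableOn.diffContOnCl ?_
  rw [closure_ball _ (by norm_num)]
  exact (differentiableOn_oneModW q).mono hball

theorem exists_norm_deriv_oneModF_le (q : ℕ) [NeZero q] :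
    ∃ C : ℝ, 0 < C ∧ ∀ s : ℂ, 1 < s.re → s.re ≤ 2 → 1 ≤ |s.im| →
      ‖deriv (oneModF q) s‖ ≤ C * |s.im| := by
  choose A hA0 hA using fun χ : DirichletCharacter ℂ q => χ.exists_norm_LFunction_le
  choose c hc0 hc using fun χ : DirichletCharacter ℂ q => χ.exists_le_norm_LFunction
  obtain ⟨CW, hCW0, hCW⟩ := exists_norm_oneModW_le q
  obtain ⟨CW', hCW'0, hCW'⟩ := exists_norm_deriv_oneModW_le q
  set A0 : ℝ := ∑ χ : DirichletCharacter ℂ q, A χ with hA0d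
  have hAle : ∀ χ, A χ ≤ A0 := fun χ =>
    Finset.single_le_sum (f := A) (fun i _ => (hA0 i).le) (Finset.mem_univ χ)
  have hA0pos : 0 < A0 := (hA0 1).trans_le (hAle 1)
  set D : ℝ := (∑ χ : DirichletCharacter ℂ q, A χ / c χ) + q.totient * CW' with hD
  have hD0 : 0 ≤ D := by
    have : 0 ≤ ∑ χ : DirichletCharacter ℂ q, A χ / c χ :=
      Finset.sum_nonneg fun χ _ => (div_pos (hA0 χ) (hc0 χ)).le
    positivity
  have hφ1 : (1 : ℝ) ≤ q.totient := by exact_mod_cast Nat.totient_pos.mpr (NeZero.pos q)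
  refine ⟨A0 * Real.exp CW * D + 1, by positivity, fun s h1 h2 h3 => ?_⟩
  set τ := |s.im| with hτ
  have hτ0 : 0 < τ := by linarith
  have hP1 : 1 ≤ τ ^ (1 / 8 : ℝ) := Real.one_le_rpow h3 (by norm_num)
  have hF : ‖oneModF q s‖ ≤ A0 * Real.exp CW * τ ^ (1 / 8 : ℝ) := by
    refine le_of_pow_le_pow_left₀ (totient_ne_zero_of_neZero q) (by positivity) ?_
    have e := prod_LFunction_eq q h1
    have e2 : oneModF q s ^ q.totient =
        (∏ χ : DirichletCharacter ℂ q, DirichletCharacter.LFunction χ s) *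
          exp (-(q.totient * oneModW q s)) := by
      rw [e, mul_assoc, ← exp_add]; simp
    rw [← norm_pow, e2, norm_mul, norm_prod]
    have b1 : ∏ χ : DirichletCharacter ℂ q, ‖DirichletCharacter.LFunction χ s‖ ≤
        (A0 * τ ^ (1 / 8 : ℝ)) ^ q.totient := by
      have hcard : (Finset.univ : Finset (DirichletCharacter ℂ q)).card = q.totient := by
        rw [Finset.card_univ, ← Nat.card_eq_fintype_card]
        exact DirichletCharacter.card_eq_totient_of_hasEnoughRootsOfUnity ℂ q
      rw [← hcard, ← Finset.prod_const]
      refine Finset.prod_le_prod (fun _ _ => norm_nonneg _) fun χ _ => ?_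
      refine (hA χ s h1.le h2 h3).1.trans ?_
      gcongr
      exact hAle χ
    have b2 : ‖exp (-(q.totient * oneModW q s))‖ ≤ Real.exp CW ^ q.totient := by
      rw [norm_exp, ← Real.exp_nat_mul]
      refine Real.exp_le_exp.mpr ?_
      refine (re_le_norm _).trans ?_
      rw [norm_neg, norm_mul, norm_natCast]
      gcongr
      exact hCW s (by linarith)
    calc _ ≤ (A0 * τ ^ (1 / 8 : ℝ)) ^ q.totient * Real.exp CW ^ q.totient := by gcongr
      _ = _ := by rw [← mul_pow]; ring
  have hL : ‖deriv (oneModF q) s / oneModF q s‖ ≤ D * τ ^ (5 / 8 : ℝ) := by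
    have h58 : 1 ≤ τ ^ (5 / 8 : ℝ) := Real.one_le_rpow h3 (by norm_num)
    have e := logDeriv_oneModF q h1
    have e' : ‖(q.totient : ℂ) * (deriv (oneModF q) s / oneModF q s)‖ ≤ D * τ ^ (5 / 8 : ℝ) := by
      rw [e]
      refine (norm_sub_le _ _).trans ?_
      rw [hD, add_mul]
      refine add_le_add ?_ ?_
      · rw [Finset.sum_mul]
        refine norm_sum_le_of_le _ fun χ _ => ?_
        rw [norm_div, div_le_iff₀]
        · calc ‖deriv (DirichletCharacter.LFunction χ) s‖ ≤ A χ * τ ^ (1 / 8 : ℝ) := (hA χ s h1.le h2 h3).2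
            _ = A χ / c χ * τ ^ (5 / 8 : ℝ) * (c χ * τ ^ (-(1 / 2) : ℝ)) := by
              have : τ ^ (1 / 8 : ℝ) = τ ^ (5 / 8 : ℝ) * τ ^ (-(1 / 2) : ℝ) := by
                rw [← Real.rpow_add hτ0]; norm_num
              have hc' := (hc0 χ).ne'
              rw [this]; field_simp
            _ ≤ _ := by
              have := hA0 χ
              have := hc0 χ
              gcongr
              exact hc χ s h1 h2 h3
        · refine lt_of_lt_of_le ?_ (hc χ s h1 h2 h3)
          have := hc0 χ
          positivity
      · rw [norm_mul, norm_natCast]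
        have := hCW' s h1.le
        calc (q.totient : ℝ) * ‖deriv (oneModW q) s‖ ≤ q.totient * CW' * 1 := by
              rw [mul_one]; gcongr
          _ ≤ _ := by gcongr
    rw [norm_mul, norm_natCast] at e'
    refine le_trans ?_ e'
    exact le_mul_of_one_le_left (norm_nonneg _) hφ1
  have hne := oneModF_ne_zero q h1
  calc ‖deriv (oneModF q) s‖ = ‖oneModF q s‖ * ‖deriv (oneModF q) s / oneModF q s‖ := by
        rw [← norm_mul, mul_div_cancel₀ _ hne]
    _ ≤ (A0 * Real.exp CW * τ ^ (1 / 8 : ℝ)) * (D * τ ^ (5 / 8 : ℝ)) := by gcongr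
    _ = A0 * Real.exp CW * D * τ ^ (3 / 4 : ℝ) := by
      rw [show (3 / 4 : ℝ) = 1 / 8 + 5 / 8 by norm_num, Real.rpow_add hτ0]; ring
    _ ≤ A0 * Real.exp CW * D * τ := by
      gcongr
      calc τ ^ (3 / 4 : ℝ) ≤ τ ^ (1 : ℝ) := Real.rpow_le_rpow_of_exponent_le h3 (by norm_num)
        _ = τ := Real.rpow_one τ
    _ ≤ _ := by nlinarith

/-- The Dirichlet series `-F'(s)/s` compared with its singular part at `s = 1`. -/
theorem exists_norm_neg_deriv_oneModF_sub_le (q : ℕ) [NeZero q] :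
    ∃ C : ℝ, 0 < C ∧ ∀ s : ℂ, 1 < s.re → s.re ≤ 2 → s.im ≠ 0 →
      ‖-deriv (oneModF q) s / s - (Gq q * Real.Gamma (1 / q.totient + 1) : ℝ) *
        (s - 1) ^ (-(1 / q.totient : ℝ) - 1 : ℂ)‖ ≤ C * (1 + |s.im| ^ (-(1 / q.totient : ℝ))) := by
  obtain ⟨M, hM0, hM⟩ := exists_oneModH_bounds q
  obtain ⟨C, hC0, hC⟩ := exists_norm_deriv_oneModF_le q
  have hφ1 : (1 : ℝ) ≤ q.totient := by exact_mod_cast Nat.totient_pos.mpr (NeZero.pos q)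
  set κ : ℝ := 1 / q.totient with hκ
  have hκ0 : 0 < κ := by positivity
  have hκ1 : κ ≤ 1 := by rw [hκ, div_le_one (by linarith)]; exact hφ1
  have hconst : Gq q * Real.Gamma (κ + 1) = κ * oneModH1 q := by
    rw [Gq_eq, Real.Gamma_add_one hκ0.ne']
    have := (Real.Gamma_pos_of_pos hκ0).ne'
    rw [← hκ]; field_simp
  set h1 := oneModH1 q with hh1
  have hh10 : 0 ≤ h1 := by rw [hh1, oneModH1]; positivity
  rw [hconst]
  refine ⟨C + h1 + 4 * M + h1, by positivity, fun s hs1 hs2 hs3 => ?_⟩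
  have hs0 : s ≠ 0 := by rintro rfl; simp at hs1; linarith
  have hns : 1 ≤ ‖s‖ := by
    have := abs_re_le_norm s
    rw [abs_of_pos (by linarith)] at this; linarith
  have hsp := sub_one_mem_slitPlane hs1
  have hsm : s - 1 ≠ 0 := slitPlane_ne_zero hsp
  have him : |s.im| ≤ ‖s - 1‖ := by
    have := abs_im_le_norm (s - 1); simpa using this
  have hτ0 : 0 < |s.im| := abs_pos.mpr hs3
  have hnorm : ∀ a : ℝ, ‖(s - 1) ^ (a : ℂ)‖ = ‖s - 1‖ ^ a := by
    intro a
    rw [norm_cpow_of_ne_zero hsm]; simp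
  have hpw : ‖s - 1‖ ^ (-κ) ≤ |s.im| ^ (-κ) :=
    Real.rpow_le_rpow_of_nonpos hτ0 him (by linarith)
  have hτκ : 0 ≤ |s.im| ^ (-κ) := by positivity
  rcases le_total 1 |s.im| with hτ | hτ
  · have b1 : ‖-deriv (oneModF q) s / s‖ ≤ C := by
      rw [norm_div, norm_neg, div_le_iff₀ (by linarith)]
      refine (hC s hs1 hs2 hτ).trans ?_
      gcongr
      exact abs_im_le_norm s
    have b2 : ‖((κ * h1 : ℝ) : ℂ) * (s - 1) ^ (-(κ : ℂ) - 1)‖ ≤ h1 := by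
      rw [norm_mul, show (-(κ : ℂ) - 1) = ((-κ - 1 : ℝ) : ℂ) by push_cast; ring, hnorm, norm_real,
        Real.norm_of_nonneg (by positivity)]
      have : ‖s - 1‖ ^ (-κ - 1) ≤ 1 :=
        Real.rpow_le_one_of_one_le_of_nonpos (hτ.trans him) (by linarith)
      have h' : κ * h1 ≤ h1 := mul_le_of_le_one_left hh10 hκ1
      have h'' : 0 ≤ κ * h1 := by positivity
      calc κ * h1 * ‖s - 1‖ ^ (-κ - 1) ≤ κ * h1 * 1 := by gcongr
        _ ≤ h1 := by linarith
    refine (norm_sub_le _ _).trans ?_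
    nlinarith
  · obtain ⟨m1, m2, m3⟩ := hM s hs1 hs2 hτ
    have eF : deriv (oneModF q) s = deriv (oneModH q) s * (s - 1) ^ (-(κ : ℂ)) -
        κ * oneModH q s * (s - 1) ^ (-(κ : ℂ) - 1) := by
      have e1 : oneModF q =ᶠ[nhds s] fun z => oneModH q z * (z - 1) ^ (-(κ : ℂ)) := by
        filter_upwards [(isOpen_re_gt 1).mem_nhds hs1] with z hz
        have hz1 : z - 1 ≠ 0 := slitPlane_ne_zero (sub_one_mem_slitPlane hz)
        rw [oneModH, mul_assoc, hκ]
        push_cast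
        rw [one_div, ← cpow_add _ _ hz1]
        simp
      rw [e1.deriv_eq]
      have d1 := (differentiableAt_oneModH q hs1).hasDerivAt
      have d2 : HasDerivAt (fun z : ℂ => (z - 1) ^ (-(κ : ℂ))) (-(κ : ℂ) * (s - 1) ^ (-(κ : ℂ) - 1) * 1) s :=
        ((hasDerivAt_id s).sub_const 1).cpow_const hsp
      rw [(d1.fun_mul d2).deriv]
      ring
    have eB : -deriv (oneModF q) s / s - ((κ * h1 : ℝ) : ℂ) * (s - 1) ^ (-(κ : ℂ) - 1) =
        -(deriv (oneModH q) s * (s - 1) ^ (-(κ : ℂ)) / s) +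
        κ * ((s - 1) ^ (-(κ : ℂ) - 1) * ((oneModH q s - h1) / s - h1 * (s - 1) / s)) := by
      rw [eF]
      push_cast
      field_simp
      ring
    rw [eB]
    have b1 : ‖deriv (oneModH q) s * (s - 1) ^ (-(κ : ℂ)) / s‖ ≤ M * |s.im| ^ (-κ) := by
      rw [norm_div, norm_mul]
      refine (div_le_self (by positivity) hns).trans ?_
      rw [show -(κ : ℂ) = ((-κ : ℝ) : ℂ) by push_cast; ring, hnorm]
      gcongr
    have b2 : ‖(oneModH q s - h1) / s - h1 * (s - 1) / s‖ ≤ (M + h1) * ‖s - 1‖ := by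
      refine (norm_sub_le _ _).trans ?_
      rw [norm_div, norm_div, norm_mul, norm_real, Real.norm_of_nonneg hh10, add_mul]
      exact add_le_add ((div_le_self (norm_nonneg _) hns).trans m3)
        (div_le_self (by positivity) hns)
    have b3 : ‖(κ : ℂ) * ((s - 1) ^ (-(κ : ℂ) - 1) * ((oneModH q s - h1) / s - h1 * (s - 1) / s))‖ ≤
        (M + h1) * |s.im| ^ (-κ) := by
      rw [norm_mul, norm_mul, norm_real, Real.norm_of_nonneg hκ0.le,
        show (-(κ : ℂ) - 1) = ((-κ - 1 : ℝ) : ℂ) by push_cast; ring, hnorm]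
      refine (mul_le_of_le_one_left (by positivity) hκ1).trans ?_
      calc ‖s - 1‖ ^ (-κ - 1) * ‖(oneModH q s - h1) / s - h1 * (s - 1) / s‖
          ≤ ‖s - 1‖ ^ (-κ - 1) * ((M + h1) * ‖s - 1‖) := by gcongr
        _ = (M + h1) * ‖s - 1‖ ^ (-κ) := by
          rw [Real.rpow_sub_one (norm_ne_zero_iff.mpr hsm)]
          have := norm_ne_zero_iff.mpr hsm
          field_simp
        _ ≤ _ := by gcongr
    refine (norm_add_le _ _).trans ?_
    rw [norm_neg]
    nlinarith
end

noncomputable section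

open Complex MeasureTheory

theorem integrableOn_rpow_mul_exp_neg_mul {a b : ℝ} (ha : -1 < a) (hb : 0 < b) :
    IntegrableOn (fun t : ℝ => t ^ a * Real.exp (-b * t)) (Set.Ioi 0) := by
  simpa using integrableOn_rpow_mul_exp_neg_mul_rpow ha one_pos hb

theorem aestronglyMeasurable_rpow_mul_cexp (a : ℝ) (r : ℂ) :
    AEStronglyMeasurable (fun t : ℝ => ((t ^ a : ℝ) : ℂ) * exp (-(r * t)))
      (volume.restrict (Set.Ioi 0)) := by
  refine ContinuousOn.aestronglyMeasurable (fun t ht => ?_) measurableSet_Ioi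
  refine ContinuousAt.continuousWithinAt ?_
  have : ContinuousAt (fun t : ℝ => t ^ a) t :=
    Real.continuousAt_rpow_const _ _ (Or.inl (ne_of_gt ht))
  exact (continuous_ofReal.continuousAt.comp this).mul (by fun_prop)

theorem norm_rpow_mul_cexp (a : ℝ) (r : ℂ) {t : ℝ} (ht : 0 < t) :
    ‖((t ^ a : ℝ) : ℂ) * exp (-(r * t))‖ = t ^ a * Real.exp (-r.re * t) := by
  rw [norm_mul, norm_real, Real.norm_of_nonneg (Real.rpow_nonneg ht.le _), norm_exp]
  simp

theorem integrableOn_rpow_mul_cexp {a : ℝ} (ha : -1 < a) {r : ℂ} (hr : 0 < r.re) :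
    IntegrableOn (fun t : ℝ => ((t ^ a : ℝ) : ℂ) * exp (-(r * t))) (Set.Ioi 0) := by
  refine Integrable.mono' (integrableOn_rpow_mul_exp_neg_mul ha hr)
    (aestronglyMeasurable_rpow_mul_cexp a r) ?_
  filter_upwards [ae_restrict_mem measurableSet_Ioi] with t ht
  exact (norm_rpow_mul_cexp a r ht).le

theorem hasDerivAt_integral_rpow_mul_cexp {a : ℝ} (ha : -1 < a) {r : ℂ} (hr : 0 < r.re) :
    DifferentiableAt ℂ (fun z : ℂ => ∫ t in Set.Ioi (0 : ℝ), ((t ^ a : ℝ) : ℂ) * exp (-(z * t))) r := by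
  have key := hasDerivAt_integral_of_dominated_loc_of_deriv_le
    (μ := volume.restrict (Set.Ioi (0 : ℝ))) (x₀ := r) (s := Metric.ball r (r.re / 2))
    (F := fun (z : ℂ) (t : ℝ) => ((t ^ a : ℝ) : ℂ) * exp (-(z * t)))
    (F' := fun (z : ℂ) (t : ℝ) => -(((t ^ (a + 1) : ℝ) : ℂ) * exp (-(z * t))))
    (bound := fun t => t ^ (a + 1) * Real.exp (-(r.re / 2) * t))
    (Metric.ball_mem_nhds r (by linarith))
    (Filter.Eventually.of_forall fun z => aestronglyMeasurable_rpow_mul_cexp a z)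
    (integrableOn_rpow_mul_cexp ha hr) (aestronglyMeasurable_rpow_mul_cexp (a + 1) r).neg ?_
    (integrableOn_rpow_mul_exp_neg_mul (by linarith) (by linarith)) ?_
  · exact key.2.differentiableAt
  · filter_upwards [ae_restrict_mem measurableSet_Ioi] with t ht z hz
    have ht' : 0 < t := ht
    rw [norm_neg, norm_rpow_mul_cexp _ _ ht]
    have : |(z - r).re| ≤ ‖z - r‖ := abs_re_le_norm _
    rw [mem_ball_iff_norm] at hz
    rw [sub_re] at this
    have h2 := abs_le.mp (this.trans hz.le)
    gcongr
    linarith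
  · filter_upwards [ae_restrict_mem measurableSet_Ioi] with t ht z hz
    have ht' : 0 < t := ht
    have h1 : HasDerivAt (fun z : ℂ => exp (-(z * t))) (exp (-(z * t)) * (-(1 * t))) z :=
      (((hasDerivAt_id z).mul_const (t : ℂ)).neg).cexp
    have h2 := h1.const_mul ((t ^ a : ℝ) : ℂ)
    refine h2.congr_deriv ?_
    rw [Real.rpow_add_one ht'.ne']
    push_cast
    ring

theorem integral_rpow_mul_cexp {a : ℝ} (ha : 0 < a) {r : ℂ} (hr : 0 < r.re) :
    ∫ t in Set.Ioi (0 : ℝ), ((t ^ (a - 1) : ℝ) : ℂ) * exp (-(r * t)) =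
      (Real.Gamma a : ℂ) * r ^ (-(a : ℂ)) := by
  have hU : IsOpen {z : ℂ | 0 < z.re} := isOpen_re_gt 0
  have hf : AnalyticOnNhd ℂ (fun z : ℂ => ∫ t in Set.Ioi (0 : ℝ),
      ((t ^ (a - 1) : ℝ) : ℂ) * exp (-(z * t))) {z : ℂ | 0 < z.re} :=
    DifferentiableOn.analyticOnNhd (fun z hz =>
      (hasDerivAt_integral_rpow_mul_cexp (by linarith) hz).differentiableWithinAt) hU
  have hg : AnalyticOnNhd ℂ (fun z : ℂ => (Real.Gamma a : ℂ) * z ^ (-(a : ℂ))) {z : ℂ | 0 < z.re} :=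
    DifferentiableOn.analyticOnNhd (fun z hz => by
      refine DifferentiableAt.differentiableWithinAt ?_
      exact (differentiableAt_id.cpow_const (Or.inl hz)).const_mul _) hU
  refine hf.eqOn_of_preconnected_of_frequently_eq hg
    (convex_halfSpace_re_gt 0).isPreconnected (z₀ := 1) (by simp) ?_ hr
  have hreal : ∀ x : ℝ, 0 < x → (∫ t in Set.Ioi (0 : ℝ), ((t ^ (a - 1) : ℝ) : ℂ) * exp (-(x * t))) =
      (Real.Gamma a : ℂ) * (x : ℂ) ^ (-(a : ℂ)) := by
    intro x hx
    have h := integral_cpow_mul_exp_neg_mul_Ioi (a := a) (r := x) (by simpa using ha) hx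
    rw [Gamma_ofReal] at h
    rw [mul_comm, cpow_neg, ← inv_cpow _ _ (by rw [arg_ofReal_of_nonneg hx.le]; exact Real.pi_pos.ne),
      ← one_div, ← h]
    refine setIntegral_congr_fun measurableSet_Ioi fun t ht => ?_
    have ht' : 0 < t := ht
    rw [ofReal_cpow ht'.le]
    push_cast
    rfl
  have htend : Filter.Tendsto (fun n : ℕ => ((1 + 1 / ((n : ℝ) + 1) : ℝ) : ℂ)) Filter.atTop
      (nhdsWithin 1 {1}ᶜ) := by
    refine tendsto_nhdsWithin_iff.mpr ⟨?_, Filter.Eventually.of_forall fun n => ?_⟩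
    · have : Filter.Tendsto (fun n : ℕ => 1 + 1 / ((n : ℝ) + 1)) Filter.atTop (nhds (1 + 0)) :=
        tendsto_one_div_add_atTop_nhds_zero_nat.const_add 1
      rw [add_zero] at this
      exact (continuous_ofReal.tendsto' 1 1 (by simp)).comp this
    · have : (0 : ℝ) < 1 / ((n : ℝ) + 1) := by positivity
      simp only [Set.mem_compl_iff, Set.mem_singleton_iff]
      intro h
      have h' : (1 + 1 / ((n : ℝ) + 1) : ℝ) = 1 := by exact_mod_cast h
      linarith
  refine htend.frequently (Filter.Frequently.of_forall fun n => ?_)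
  exact hreal _ (by positivity)

/-- The partial sums of `n ↦ 1_S(n) log n`. -/
def oneModLogSum (q : ℕ) (u : ℝ) : ℝ := ∑ n ∈ Finset.Icc 1 ⌊u⌋₊, oneModInd q n * Real.log n

theorem oneModLogSum_nonneg (q : ℕ) (u : ℝ) : 0 ≤ oneModLogSum q u :=
  Finset.sum_nonneg fun n _ => mul_nonneg (oneModInd_nonneg q n) (Real.log_natCast_nonneg n)

theorem oneModLogSum_mono (q : ℕ) : Monotone (oneModLogSum q) := by
  intro u v huv
  refine Finset.sum_le_sum_of_subset_of_nonneg
    (Finset.Icc_subset_Icc le_rfl (Nat.floor_mono huv))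
    fun n _ _ => mul_nonneg (oneModInd_nonneg q n) (Real.log_natCast_nonneg n)

theorem oneModLogSum_le (q : ℕ) {u : ℝ} (hu : 1 ≤ u) : oneModLogSum q u ≤ u * Real.log u := by
  have hlog := Real.log_nonneg hu
  calc oneModLogSum q u ≤ ∑ n ∈ Finset.Icc 1 ⌊u⌋₊, Real.log u := by
        refine Finset.sum_le_sum fun n hn => ?_
        rw [Finset.mem_Icc] at hn
        have h1 : (n : ℝ) ≤ u := (Nat.le_floor_iff (by linarith)).mp hn.2
        have h0 : (0 : ℝ) < n := by exact_mod_cast hn.1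
        calc oneModInd q n * Real.log n ≤ 1 * Real.log n :=
              mul_le_mul_of_nonneg_right (oneModInd_le_one q n) (Real.log_natCast_nonneg n)
          _ ≤ Real.log u := by rw [one_mul]; exact Real.log_le_log h0 h1
    _ = ⌊u⌋₊ * Real.log u := by simp
    _ ≤ u * Real.log u := by gcongr; exact Nat.floor_le (by linarith)

theorem neg_deriv_oneModF_eq (q : ℕ) {s : ℂ} (hs : 1 < s.re) :
    -deriv (oneModF q) s / s =
      ∫ v in Set.Ioi (0 : ℝ), ((oneModLogSum q (Real.exp v) * Real.exp (-v) : ℝ) : ℂ) *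
        exp (-((s - 1) * v)) := by
  have hs0 : s ≠ 0 := ne_zero_of_one_lt_re hs
  set r : ℝ := (1 + s.re) / 2 with hr
  have hO : (fun n => ∑ k ∈ Finset.Icc 1 n, oneModInd q k * Real.log k) =O[Filter.atTop]
      fun n => (n : ℝ) ^ r := by
    have h1 : (fun x : ℝ => x * Real.log x) =O[Filter.atTop] fun x : ℝ => x ^ r := by
      have h2 := (isLittleO_log_rpow_atTop (r := r - 1) (by linarith)).isBigO
      have h3 := (Asymptotics.isBigO_refl (fun x : ℝ => x) Filter.atTop).mul h2
      refine h3.congr' Filter.EventuallyEq.rfl ?_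
      filter_upwards [Filter.eventually_gt_atTop 0] with x hx
      rw [Real.rpow_sub_one hx.ne']
      field_simp
    refine Asymptotics.IsBigO.trans (Asymptotics.IsBigO.of_bound 1 ?_)
      (h1.comp_tendsto tendsto_natCast_atTop_atTop)
    filter_upwards [Filter.eventually_ge_atTop 1] with n hn
    have hn' : (1 : ℝ) ≤ n := by exact_mod_cast hn
    have h := oneModLogSum_le q hn'
    have h0 := oneModLogSum_nonneg q n
    simp only [oneModLogSum, Nat.floor_natCast] at h h0
    rw [one_mul, Real.norm_of_nonneg h0]
    exact h.trans (Real.le_norm_self _)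
  have h := LSeries_eq_mul_integral_of_nonneg (fun n => oneModInd q n * Real.log n)
    (r := r) (by linarith) (s := s) (by linarith) hO
    fun n => mul_nonneg (oneModInd_nonneg q n) (Real.log_natCast_nonneg n)
  have e1 : (fun n : ℕ => ((oneModInd q n * Real.log n : ℝ) : ℂ)) =
      LSeries.logMul fun n => (oneModInd q n : ℂ) := by
    funext n
    simp [LSeries.logMul, mul_comm, natCast_log]
  rw [(hasDerivAt_oneModF q hs).deriv, neg_neg, ← e1, h, mul_div_cancel_left₀ _ hs0,
    ← Real.exp_zero, ← integral_comp_exp_Ioi]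
  refine setIntegral_congr_fun measurableSet_Ioi fun v _ => ?_
  simp only [real_smul, oneModLogSum]
  rw [cpow_def_of_ne_zero (by exact_mod_cast (Real.exp_pos v).ne'), ← ofReal_log (Real.exp_pos v).le,
    Real.log_exp]
  push_cast
  have e2 : exp (v * -(s + 1)) = exp (-v) * exp (-v) * exp (-((s - 1) * v)) := by
    rw [← exp_add, ← exp_add]; congr 1; ring
  rw [e2]
  have e3 : exp (v : ℂ) * exp (-(v : ℂ)) = 1 := by rw [← exp_add]; simp
  linear_combination (∑ k ∈ Finset.Icc 1 ⌊Real.exp v⌋₊, (oneModInd q k : ℂ) *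
    Complex.log k) * exp (-(v : ℂ)) * exp (-((s - 1) * v)) * e3

end

noncomputable section

open Complex MeasureTheory

open FourierTransform in
theorem exists_bump_eq_integral_cexp :
    ∃ (b : ℝ → ℝ) (k : ℝ → ℂ), Continuous b ∧ (∀ y, 0 ≤ b y) ∧ (∀ y, b y ≠ 0 → 0 ≤ y ∧ y ≤ 1) ∧
      Integrable b ∧ 0 < ∫ y, b y ∧ Integrable k ∧ Continuous k ∧ (∃ M : ℝ, ∀ w, ‖k w‖ ≤ M) ∧
      ∀ y, (b y : ℂ) = ∫ w : ℝ, exp (2 * Real.pi * w * y * I) * k w := by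
  let f : ContDiffBump (1 / 2 : ℝ) := ⟨1 / 4, 1 / 2, by norm_num, by norm_num⟩
  have hsupp : HasCompactSupport (fun y => ((f y : ℝ) : ℂ)) :=
    f.hasCompactSupport.comp_left (g := fun x : ℝ => (x : ℂ)) (by simp)
  have hsm : ContDiff ℝ ((⊤ : ℕ∞) : WithTop ℕ∞) (fun y => ((f y : ℝ) : ℂ)) :=
    ofRealCLM.contDiff.comp f.contDiff
  let F : SchwartzMap ℝ ℂ := hsupp.toSchwartzMap hsm
  have hfi : Integrable (fun y => f y) := f.continuous.integrable_of_hasCompactSupport f.hasCompactSupport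
  refine ⟨f, (𝓕 F : SchwartzMap ℝ ℂ), f.continuous, f.nonneg', fun y hy => ?_, hfi, ?_,
    (𝓕 F).integrable, (𝓕 F).continuous, ?_, fun y => ?_⟩
  · by_contra h
    refine hy (f.zero_of_le_dist ?_)
    rw [Real.dist_eq]
    change 1 / 2 ≤ |y - 1 / 2|
    by_contra h'
    have := abs_lt.mp (not_le.mp h')
    exact h ⟨by linarith, by linarith⟩
  · rw [integral_pos_iff_support_of_nonneg f.nonneg' hfi, f.support_eq]
    exact Metric.measure_ball_pos _ _ f.rOut_pos
  · obtain ⟨C, _, hC⟩ := (𝓕 F).decay 0 0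
    exact ⟨C, fun w => by simpa using hC w⟩
  · have h1 : 𝓕⁻ (𝓕 F) = F := FourierTransform.fourierInv_fourier_eq F
    have h2 : F y = 𝓕⁻ ((𝓕 F : SchwartzMap ℝ ℂ) : ℝ → ℂ) y := by
      rw [← SchwartzMap.fourierInv_coe, h1]
    rw [Real.fourierInv_eq'] at h2
    change F y = _
    rw [h2]
    refine integral_congr_ae (Filter.Eventually.of_forall fun w => ?_)
    simp only [smul_eq_mul]
    congr 2
    simp
    ring

theorem integrable_mul_abs_rpow {k : ℝ → ℂ} (hk : Integrable k) {M : ℝ} (hM : ∀ w, ‖k w‖ ≤ M)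
    (hk' : Continuous k) {κ : ℝ} (hκ0 : 0 ≤ κ) (hκ : κ < 1) :
    Integrable (fun w => ‖k w‖ * |w| ^ (-κ)) := by
  have hmeas : AEStronglyMeasurable (fun w => ‖k w‖ * |w| ^ (-κ)) volume := by
    refine (hk'.norm.measurable.mul ?_).aestronglyMeasurable
    exact measurable_id.abs.pow_const _
  have h1 : IntegrableOn (fun w => ‖k w‖ * |w| ^ (-κ)) (Metric.ball 0 1) := by
    refine integrableOn_ball_of_norm_le_rpow (by simp) (C := M) (α := κ) (by simpa using hκ)
      (Filter.Eventually.of_forall fun w => ?_) hmeas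
    rw [Real.norm_of_nonneg (by positivity), Real.norm_eq_abs]
    gcongr
    exact hM w
  have h2 : IntegrableOn (fun w => ‖k w‖ * |w| ^ (-κ)) (Metric.ball 0 1)ᶜ := by
    refine Integrable.mono' hk.norm.integrableOn hmeas.restrict ?_
    filter_upwards [ae_restrict_mem Metric.isOpen_ball.measurableSet.compl] with w hw
    have hw' : 1 ≤ |w| := by simpa using hw
    rw [Real.norm_of_nonneg (by positivity)]
    exact mul_le_of_le_one_right (norm_nonneg _)
      (Real.rpow_le_one_of_one_le_of_nonpos hw' (by linarith))
  rw [← integrableOn_univ, ← Set.union_compl_self (Metric.ball (0 : ℝ) 1)]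
  exact h1.union h2

theorem integral_mul_bump_eq {μ : Measure ℝ} [SFinite μ] {g : ℝ → ℂ} (hg : Integrable g μ)
    {b : ℝ → ℝ} {k : ℝ → ℂ} (hk : Integrable k)
    (hb : ∀ y, (b y : ℂ) = ∫ w : ℝ, exp (2 * Real.pi * w * y * I) * k w) (T V : ℝ) :
    ∫ v, g v * b (T * (v - V)) ∂μ =
      ∫ w : ℝ, k w * exp (-(2 * Real.pi * w * T * V * I)) *
        ∫ v, g v * exp (2 * Real.pi * w * T * v * I) ∂μ := by
  have e1 : ∀ v, g v * b (T * (v - V)) =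
      ∫ w : ℝ, g v * k w * exp (2 * Real.pi * w * (T * (v - V)) * I) := by
    intro v
    rw [hb, ← integral_const_mul]
    refine integral_congr_ae (Filter.Eventually.of_forall fun w => ?_)
    push_cast
    ring
  have e2 : ∀ w : ℝ, k w * exp (-(2 * Real.pi * w * T * V * I)) *
        ∫ v, g v * exp (2 * Real.pi * w * T * v * I) ∂μ =
      ∫ v, g v * k w * exp (2 * Real.pi * w * (T * (v - V)) * I) ∂μ := by
    intro w
    rw [← integral_const_mul]
    refine integral_congr_ae (Filter.Eventually.of_forall fun v => ?_)
    simp only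
    rw [show (2 * Real.pi * w * (T * (v - V)) * I : ℂ) =
      -(2 * Real.pi * w * T * V * I) + 2 * Real.pi * w * T * v * I by ring, exp_add]
    ring
  simp_rw [e1, e2]
  refine integral_integral_swap ?_
  have hprod : Integrable (fun z : ℝ × ℝ => g z.1 * k z.2) (μ.prod volume) := hg.mul_prod hk
  have := hprod.bdd_mul (c := 1)
    (f := fun z : ℝ × ℝ => exp (2 * Real.pi * z.2 * (T * (z.1 - V)) * I))
    (Continuous.aestronglyMeasurable (by fun_prop)) ?_
  · refine this.congr (Filter.Eventually.of_forall fun z => ?_)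
    simp only [Function.uncurry]
    ring
  · refine Filter.Eventually.of_forall fun z => ?_
    rw [show (2 * Real.pi * z.2 * (T * (z.1 - V)) * I : ℂ) =
      ((2 * Real.pi * z.2 * (T * (z.1 - V)) : ℝ) : ℂ) * I by push_cast; ring, norm_exp_ofReal_mul_I]

/-- The normalised partial sums `v ↦ e^{-v} ∑_{n ≤ e^v} 1_S(n) log n`. -/
def oneModNorm (q : ℕ) (v : ℝ) : ℝ := oneModLogSum q (Real.exp v) * Real.exp (-v)

theorem oneModNorm_nonneg (q : ℕ) (v : ℝ) : 0 ≤ oneModNorm q v :=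
  mul_nonneg (oneModLogSum_nonneg q _) (Real.exp_pos _).le

theorem oneModNorm_le (q : ℕ) {v : ℝ} (hv : 0 ≤ v) : oneModNorm q v ≤ v := by
  have h := oneModLogSum_le q (Real.one_le_exp hv)
  rw [Real.log_exp] at h
  calc oneModNorm q v ≤ Real.exp v * v * Real.exp (-v) := by
        unfold oneModNorm; gcongr
    _ = v := by rw [mul_right_comm, ← Real.exp_add]; simp

theorem measurable_oneModNorm (q : ℕ) : Measurable (oneModNorm q) :=
  ((oneModLogSum_mono q).measurable.comp Real.measurable_exp).mul (by fun_prop)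

theorem integrableOn_oneModNorm_mul_cexp (q : ℕ) {r : ℂ} (hr : 0 < r.re) :
    IntegrableOn (fun v : ℝ => (oneModNorm q v : ℂ) * exp (-(r * v))) (Set.Ioi 0) := by
  refine Integrable.mono' (integrableOn_rpow_mul_exp_neg_mul (a := 1) (by norm_num) hr) ?_ ?_
  · exact ((measurable_oneModNorm q).complex_ofReal.mul (by fun_prop)).aestronglyMeasurable
  · filter_upwards [ae_restrict_mem measurableSet_Ioi] with t ht
    have ht' : (0 : ℝ) < t := ht
    rw [norm_mul, norm_real, Real.norm_of_nonneg (oneModNorm_nonneg q t), norm_exp, Real.rpow_one]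
    have := oneModNorm_le q ht'.le
    simp only [neg_re, mul_re, ofReal_re, ofReal_im, mul_zero, sub_zero, neg_mul]
    gcongr

theorem exists_smoothed_bound (q : ℕ) [NeZero q] (hφ : 2 ≤ q.totient) :
    ∃ (b : ℝ → ℝ) (C : ℝ), Continuous b ∧ (∀ y, 0 ≤ b y) ∧ (∀ y, b y ≠ 0 → 0 ≤ y ∧ y ≤ 1) ∧
      Integrable b ∧ 0 < ∫ y, b y ∧ 0 < C ∧ ∀ δ T V : ℝ, 0 < δ → δ ≤ 1 → 1 ≤ T →
        |∫ v in Set.Ioi (0 : ℝ), (oneModNorm q v - Gq q * v ^ (1 / q.totient : ℝ)) *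
          Real.exp (-(δ * v)) * b (T * (v - V))| ≤ C := by
  obtain ⟨b, k, hbc, hb0, hbs, hbi, hbp, hk, hkc, ⟨M, hM⟩, hbk⟩ := exists_bump_eq_integral_cexp
  obtain ⟨C, hC0, hC⟩ := exists_norm_neg_deriv_oneModF_sub_le q
  have hφ1 : (2 : ℝ) ≤ q.totient := by exact_mod_cast hφ
  set κ : ℝ := 1 / q.totient with hκ
  have hκ0 : 0 < κ := by positivity
  have hκ1 : κ < 1 := by rw [hκ, div_lt_one (by positivity)]; linarith
  have hint := integrable_mul_abs_rpow hk hM hkc hκ0.le hκ1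
  have hint2 : Integrable (fun w => C * (‖k w‖ + ‖k w‖ * |w| ^ (-κ))) := (hk.norm.add hint).const_mul C
  have hI0 : 0 ≤ ∫ w, C * (‖k w‖ + ‖k w‖ * |w| ^ (-κ)) := integral_nonneg fun w => by positivity
  refine ⟨b, (∫ w, C * (‖k w‖ + ‖k w‖ * |w| ^ (-κ))) + 1, hbc, hb0, hbs, hbi, hbp, by linarith,
    fun δ T V hδ0 hδ1 hT => ?_⟩
  have hBint : ∀ r : ℂ, 0 < r.re → IntegrableOn (fun v : ℝ =>
      ((oneModNorm q v - Gq q * v ^ κ : ℝ) : ℂ) * exp (-(r * v))) (Set.Ioi 0) := by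
    intro r hr
    have := (integrableOn_oneModNorm_mul_cexp q hr).sub
      ((integrableOn_rpow_mul_cexp (a := κ) (by linarith) hr).const_mul (Gq q : ℂ))
    refine this.congr (Filter.Eventually.of_forall fun v => ?_)
    simp only [Pi.sub_apply]
    push_cast
    ring
  have hBeq : ∀ s : ℂ, 1 < s.re → ∫ v in Set.Ioi (0 : ℝ),
      ((oneModNorm q v - Gq q * v ^ κ : ℝ) : ℂ) * exp (-((s - 1) * v)) =
      -deriv (oneModF q) s / s - (Gq q * Real.Gamma (κ + 1) : ℝ) * (s - 1) ^ (-(κ : ℂ) - 1) := by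
    intro s hs
    have hs' : 0 < (s - 1).re := by simp; linarith
    have h1 := integral_rpow_mul_cexp (a := κ + 1) (by linarith) hs'
    rw [add_sub_cancel_right] at h1
    have h0 : -deriv (oneModF q) s / s =
      ∫ v in Set.Ioi (0 : ℝ), (oneModNorm q v : ℂ) * exp (-((s - 1) * v)) :=
      neg_deriv_oneModF_eq q hs
    rw [h0, show (-(κ : ℂ) - 1) = -((κ + 1 : ℝ) : ℂ) by push_cast; ring,
      ofReal_mul, mul_assoc, ← h1, ← integral_const_mul, ← integral_sub
        (integrableOn_oneModNorm_mul_cexp q hs')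
        ((integrableOn_rpow_mul_cexp (a := κ) (by linarith) hs').const_mul (Gq q : ℂ))]
    refine integral_congr_ae (Filter.Eventually.of_forall fun v => ?_)
    push_cast
    ring
  have hδ : 0 < ((δ : ℝ) : ℂ).re := by simpa using hδ0
  have key := integral_mul_bump_eq (hBint δ hδ) hk hbk T V
  have hcast : ((∫ v in Set.Ioi (0 : ℝ), (oneModNorm q v - Gq q * v ^ κ) *
          Real.exp (-(δ * v)) * b (T * (v - V)) : ℝ) : ℂ) =
      ∫ v in Set.Ioi (0 : ℝ), ((oneModNorm q v - Gq q * v ^ κ : ℝ) : ℂ) * exp (-(δ * v)) *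
        b (T * (v - V)) := by
    refine (integral_ofReal (𝕜 := ℂ)).symm.trans ?_
    refine integral_congr_ae (Filter.Eventually.of_forall fun v => ?_)
    simp
  rw [← Real.norm_eq_abs, ← norm_real, hcast, key]
  refine (norm_integral_le_of_norm_le hint2 ?_).trans (by linarith)
  filter_upwards [Measure.ae_ne volume (0 : ℝ)] with w hw
  have hs : (1 : ℝ) < ((1 + δ : ℝ) - (2 * Real.pi * w * T : ℝ) * I : ℂ).re := by simp; linarith
  have e : ∫ v in Set.Ioi (0 : ℝ), ((oneModNorm q v - Gq q * v ^ κ : ℝ) : ℂ) * exp (-(δ * v)) *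
      exp (2 * Real.pi * w * T * v * I) =
      ∫ v in Set.Ioi (0 : ℝ), ((oneModNorm q v - Gq q * v ^ κ : ℝ) : ℂ) *
        exp (-((((1 + δ : ℝ) - (2 * Real.pi * w * T : ℝ) * I : ℂ) - 1) * v)) := by
    refine integral_congr_ae (Filter.Eventually.of_forall fun v => ?_)
    simp only
    rw [mul_assoc, ← exp_add]
    congr 2
    push_cast
    ring
  rw [e, hBeq _ hs, norm_mul, norm_mul,
    show (-(2 * Real.pi * w * T * V * I) : ℂ) = ((-(2 * Real.pi * w * T * V) : ℝ) : ℂ) * I by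
      push_cast; ring, norm_exp_ofReal_mul_I, mul_one]
  have him : ((1 + δ : ℝ) - (2 * Real.pi * w * T : ℝ) * I : ℂ).im = -(2 * Real.pi * w * T) := by
    simp
  have hb := hC _ hs (by simp; linarith) (by
    rw [him]
    have := Real.pi_pos
    have : T ≠ 0 := by positivity
    simp [hw, this, Real.pi_ne_zero])
  rw [him, abs_neg] at hb
  have hw' : |w| ≤ |2 * Real.pi * w * T| := by
    rw [abs_mul, abs_mul, abs_mul, abs_of_pos Real.pi_pos, abs_of_pos (by linarith : 0 < T)]
    have h3 := Real.pi_gt_three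
    have : 1 ≤ 2 * Real.pi * T := by nlinarith
    simp only [Nat.abs_ofNat]
    nlinarith [abs_nonneg w]
  have hpow : |2 * Real.pi * w * T| ^ (-κ) ≤ |w| ^ (-κ) :=
    Real.rpow_le_rpow_of_nonpos (by positivity) hw' (by linarith)
  calc ‖k w‖ * _ ≤ ‖k w‖ * (C * (1 + |w| ^ (-κ))) := by
        refine mul_le_mul_of_nonneg_left (hb.trans ?_) (norm_nonneg _)
        gcongr
    _ = C * (‖k w‖ + ‖k w‖ * |w| ^ (-κ)) := by ring

end

noncomputable section

open MeasureTheory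

theorem Gq_nonneg (q : ℕ) [NeZero q] : 0 ≤ Gq q := by
  rw [Gq_eq, oneModH1]
  have : 0 < q.totient := Nat.totient_pos.mpr (NeZero.pos q)
  have := Real.Gamma_pos_of_pos (show (0 : ℝ) < 1 / q.totient by positivity)
  positivity

theorem bump_sandwich {b : ℝ → ℝ} (hbc : Continuous b) (hb0 : ∀ y, 0 ≤ b y)
    (hbs : ∀ y, b y ≠ 0 → 0 ≤ y ∧ y ≤ 1) (hbi : Integrable b) {h : ℝ → ℝ}
    (hh : AEStronglyMeasurable h (volume.restrict (Set.Ioi 0))) {V T m M : ℝ} (hV : 0 < V)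
    (hT : 0 < T) (hm : 0 ≤ m) (hmM : ∀ v, V ≤ v → v ≤ V + 1 / T → m ≤ h v ∧ h v ≤ M) :
    IntegrableOn (fun v => h v * b (T * (v - V))) (Set.Ioi 0) ∧
      m * ((∫ y, b y) / T) ≤ ∫ v in Set.Ioi (0 : ℝ), h v * b (T * (v - V)) ∧
      ∫ v in Set.Ioi (0 : ℝ), h v * b (T * (v - V)) ≤ M * ((∫ y, b y) / T) := by
  have hbT : Integrable (fun v => b (T * (v - V))) :=
    (hbi.comp_mul_left' hT.ne').comp_sub_right V
  have hzero : ∀ v ∉ Set.Ioi (0 : ℝ), b (T * (v - V)) = 0 := by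
    intro v hv
    by_contra hne
    have := (hbs _ hne).1
    rw [Set.mem_Ioi, not_lt] at hv
    nlinarith
  have hβ : ∫ v in Set.Ioi (0 : ℝ), b (T * (v - V)) = (∫ y, b y) / T := by
    rw [setIntegral_eq_integral_of_forall_compl_eq_zero hzero,
      integral_sub_right_eq_self (fun v => b (T * v)) V, Measure.integral_comp_mul_left]
    rw [smul_eq_mul, abs_of_pos (by positivity)]
    field_simp
  have hpt : ∀ v, m * b (T * (v - V)) ≤ h v * b (T * (v - V)) ∧
      h v * b (T * (v - V)) ≤ M * b (T * (v - V)) := by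
    intro v
    by_cases hne : b (T * (v - V)) = 0
    · simp [hne]
    · obtain ⟨h1, h2⟩ := hbs _ hne
      have h3 : 0 ≤ v - V := nonneg_of_mul_nonneg_right h1 hT
      have h4 : v - V ≤ 1 / T := by rw [le_div_iff₀ hT]; linarith
      obtain ⟨h5, h6⟩ := hmM v (by linarith) (by linarith)
      exact ⟨mul_le_mul_of_nonneg_right h5 (hb0 _), mul_le_mul_of_nonneg_right h6 (hb0 _)⟩
  have hint : IntegrableOn (fun v => h v * b (T * (v - V))) (Set.Ioi 0) := by
    refine Integrable.mono' (hbT.const_mul M).integrableOn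
      (hh.mul (Continuous.aestronglyMeasurable (by fun_prop))) (Filter.Eventually.of_forall fun v => ?_)
    rw [Real.norm_of_nonneg ((mul_nonneg hm (hb0 _)).trans (hpt v).1)]
    exact (hpt v).2
  refine ⟨hint, ?_, ?_⟩
  · rw [← hβ, ← integral_const_mul]
    exact integral_mono (hbT.const_mul m).integrableOn hint fun v => (hpt v).1
  · rw [← hβ, ← integral_const_mul]
    exact integral_mono hint (hbT.const_mul M).integrableOn fun v => (hpt v).2

set_option maxHeartbeats 1600000 in
theorem exists_abs_oneModNorm_sub_le (q : ℕ) [NeZero q] (hφ : 2 ≤ q.totient) :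
    ∃ K : ℝ, 0 < K ∧ ∀ V : ℝ, 2 ≤ V →
      |oneModNorm q V - Gq q * V ^ (1 / q.totient : ℝ)| ≤ K * V ^ (1 / q.totient / 2 : ℝ) := by
  obtain ⟨b, C, hbc, hb0, hbs, hbi, hβ, hC0, hC⟩ := exists_smoothed_bound q hφ
  have hG := Gq_nonneg q
  set G := Gq q
  have hφ1 : (2 : ℝ) ≤ q.totient := by exact_mod_cast hφ
  set κ : ℝ := 1 / q.totient with hκ
  have hκ0 : 0 < κ := by positivity
  have hκ1 : κ ≤ 1 := by rw [hκ, div_le_one (by positivity)]; linarith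
  set β := ∫ y, b y
  refine ⟨37 * G + 27 * C / β, by positivity, fun V hV => ?_⟩
  set T : ℝ := V ^ (κ / 2) with hTdef
  have hT1 : 1 ≤ T := Real.one_le_rpow (by linarith) (by positivity)
  have hT0 : 0 < T := by linarith
  have hV0 : 0 < V := by linarith
  have hTT : V ^ κ = T * T := by rw [hTdef, ← Real.rpow_add hV0]; ring_nf
  set δ : ℝ := 1 / V with hδ
  have hδ0 : 0 < δ := by positivity
  have hδ1 : δ ≤ 1 := by rw [hδ, div_le_one hV0]; linarith
  have hδV : δ * V = 1 := by rw [hδ]; field_simp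
  have hTi : 1 / T ≤ 1 := by rw [div_le_one hT0]; exact hT1
  have hTi0 : 0 < 1 / T := by positivity
  have hma : AEStronglyMeasurable (fun v => oneModNorm q v * Real.exp (-(δ * v)))
      (volume.restrict (Set.Ioi 0)) :=
    ((measurable_oneModNorm q).mul (by fun_prop)).aestronglyMeasurable
  have hmk : AEStronglyMeasurable (fun v : ℝ => v ^ κ * Real.exp (-(δ * v)))
      (volume.restrict (Set.Ioi 0)) :=
    ((measurable_id.pow_const κ).mul (by fun_prop)).aestronglyMeasurable
  -- comparison of the two smoothed integrals
  have hcmp : ∀ W : ℝ, IntegrableOn (fun v => oneModNorm q v * Real.exp (-(δ * v)) * b (T * (v - W)))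
      (Set.Ioi 0) → IntegrableOn (fun v : ℝ => v ^ κ * Real.exp (-(δ * v)) * b (T * (v - W)))
      (Set.Ioi 0) →
      |(∫ v in Set.Ioi (0 : ℝ), oneModNorm q v * Real.exp (-(δ * v)) * b (T * (v - W))) -
        G * ∫ v in Set.Ioi (0 : ℝ), v ^ κ * Real.exp (-(δ * v)) * b (T * (v - W))| ≤ C := by
    intro W h1 h2
    rw [← integral_const_mul, ← integral_sub h1 (h2.const_mul G)]
    refine le_trans (le_of_eq ?_) (hC δ T W hδ0 hδ1 hT1)
    congr 1
    refine integral_congr_ae (Filter.Eventually.of_forall fun v => ?_)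
    simp only
    ring
  have hnorm : ∀ v, oneModNorm q v * Real.exp (-(δ * v)) =
      oneModLogSum q (Real.exp v) * Real.exp (-((1 + δ) * v)) := by
    intro v
    rw [oneModNorm, mul_assoc, ← Real.exp_add]; ring_nf
  have hD0 := oneModLogSum_nonneg q
  have hDV : oneModLogSum q (Real.exp V) = oneModNorm q V * Real.exp V := by
    rw [oneModNorm, mul_assoc, ← Real.exp_add]; simp
  set A := oneModNorm q V with hA
  have hA0 : 0 ≤ A := oneModNorm_nonneg q V
  have he1 := Real.exp_one_lt_d9
  have hpow0 : 0 ≤ V ^ κ := by positivity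
  set y : ℝ := (1 + δ) * (1 / T) with hy
  have hy0 : 0 < y := by positivity
  have hy2 : y ≤ 2 * (1 / T) := by rw [hy]; gcongr; linarith
  have hexp : Real.exp (-((1 + δ) * V)) * Real.exp V = Real.exp (-1) := by
    rw [← Real.exp_add]; congr 1; linarith
  rw [abs_le]
  constructor
  · -- lower bound
    set W : ℝ := V - 1 / T with hW
    have hW0 : 0 < W := by linarith
    obtain ⟨i1, _, i2⟩ := bump_sandwich hbc hb0 hbs hbi hma hW0 hT0 le_rfl
      (M := oneModLogSum q (Real.exp V) * Real.exp (-((1 + δ) * W))) (fun v h1 h2 => by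
        rw [hnorm]
        refine ⟨mul_nonneg (hD0 _) (Real.exp_pos _).le, ?_⟩
        have : oneModLogSum q (Real.exp v) ≤ oneModLogSum q (Real.exp V) :=
          oneModLogSum_mono q (Real.exp_le_exp.mpr (by linarith))
        have h0 := hD0 (Real.exp V)
        gcongr)
    obtain ⟨i3, i4, _⟩ := bump_sandwich hbc hb0 hbs hbi hmk hW0 hT0
      (m := W ^ κ * Real.exp (-1)) (M := V ^ κ) (by positivity) (fun v h1 h2 => by
        have hv0 : 0 < v := by linarith
        have hvV : v ≤ V := by linarith
        constructor
        · have : δ * v ≤ 1 := by rw [← hδV]; gcongr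
          gcongr
        · have : Real.exp (-(δ * v)) ≤ 1 := Real.exp_le_one_iff.mpr (by nlinarith)
          calc v ^ κ * Real.exp (-(δ * v)) ≤ v ^ κ * 1 := by gcongr
            _ ≤ V ^ κ := by rw [mul_one]; gcongr)
    have h1 := (abs_le.mp (hcmp W i1 i3)).1
    have h2 : G * (W ^ κ * Real.exp (-1)) * (β / T) ≤
        oneModLogSum q (Real.exp V) * Real.exp (-((1 + δ) * W)) * (β / T) + C := by
      have := mul_le_mul_of_nonneg_left i4 hG
      rw [← mul_assoc] at this
      change _ ≤ _ * (β / T) at i2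
      change _ * (β / T) ≤ _ at this
      linarith
    have h3 : oneModLogSum q (Real.exp V) * Real.exp (-((1 + δ) * W)) =
        A * Real.exp (-1) * Real.exp y := by
      rw [hDV, show -((1 + δ) * W) = -((1 + δ) * V) + y by rw [hW, hy]; ring, Real.exp_add, ← hexp]
      ring
    rw [h3] at h2
    have h4 : G * W ^ κ ≤ A * Real.exp y + C * T / β * Real.exp 1 := by
      have e1 : Real.exp (-1) * Real.exp 1 = 1 := by rw [← Real.exp_add]; simp
      have e0 : 0 < Real.exp 1 * (T / β) := by positivity
      have := mul_le_mul_of_nonneg_right h2 e0.le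
      have e2 : (β / T) * (T / β) = 1 := by field_simp
      calc G * W ^ κ = G * (W ^ κ * Real.exp (-1)) * (β / T) * (Real.exp 1 * (T / β)) := by
            linear_combination (-(G * W ^ κ)) * e1 - G * W ^ κ * Real.exp (-1) * Real.exp 1 * e2
        _ ≤ _ := this
        _ = _ := by
            linear_combination (A * Real.exp y) * e1 + A * Real.exp y * Real.exp (-1) * Real.exp 1 * e2
    have h5 : G * W ^ κ * Real.exp (-y) ≤ A + C * T / β * Real.exp 1 := by
      have := mul_le_mul_of_nonneg_right h4 (Real.exp_pos (-y)).le
      have e3 : Real.exp y * Real.exp (-y) = 1 := by rw [← Real.exp_add]; simp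
      have e4 : Real.exp (-y) ≤ 1 := Real.exp_le_one_iff.mpr (by linarith)
      have e5 : C * T / β * Real.exp 1 * Real.exp (-y) ≤ C * T / β * Real.exp 1 :=
        mul_le_of_le_one_right (by positivity) e4
      have e6 : A * Real.exp y * Real.exp (-y) = A := by rw [mul_assoc, e3, mul_one]
      rw [add_mul, e6] at this
      linarith
    have h6 : V ^ κ * (1 - 1 / T) ≤ W ^ κ := by
      have e1 : W / V ≤ (W / V) ^ κ := by
        have : W / V ≤ 1 := by rw [div_le_one hV0]; linarith
        simpa using Real.rpow_le_rpow_of_exponent_ge (by positivity) this hκ1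
      have e2 : 1 - 1 / T ≤ W / V := by
        rw [le_div_iff₀ hV0]
        nlinarith
      have e3 : W ^ κ = V ^ κ * (W / V) ^ κ := by
        rw [← Real.mul_rpow hV0.le (by positivity)]; congr 1; field_simp
      rw [e3]
      gcongr
      linarith
    have h7 : 1 - 2 * (1 / T) ≤ Real.exp (-y) := by
      have := Real.add_one_le_exp (-y)
      linarith
    have h8 : V ^ κ * (1 - 3 * (1 / T)) ≤ W ^ κ * Real.exp (-y) := by
      have e1 : Real.exp (-y) ≤ 1 := Real.exp_le_one_iff.mpr (by linarith)
      have e2 : V ^ κ * (1 - 1 / T) * Real.exp (-y) ≤ W ^ κ * Real.exp (-y) := by gcongr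
      have e3 : 1 - 3 * (1 / T) ≤ (1 - 1 / T) * Real.exp (-y) := by nlinarith
      have := mul_le_mul_of_nonneg_left e3 hpow0
      rw [← mul_assoc] at this
      exact this.trans e2
    have h9 := mul_le_mul_of_nonneg_left h8 hG
    rw [← mul_assoc G (W ^ κ)] at h9
    have h10 : V ^ κ * (1 / T) = T := by rw [hTT]; field_simp
    have h11 : C * T / β * Real.exp 1 ≤ 27 * C / β * T := by
      have : 0 ≤ C * T / β := by positivity
      calc C * T / β * Real.exp 1 ≤ C * T / β * 27 := by gcongr; linarith
        _ = _ := by ring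
    have h12 : 0 ≤ G * T := by positivity
    have h13 : G * (V ^ κ * (1 - 3 * (1 / T))) = G * V ^ κ - 3 * (G * T) := by
      linear_combination (-3 * G) * h10
    have h14 : (37 * G + 27 * C / β) * T = 37 * (G * T) + 27 * C / β * T := by ring
    rw [h14]
    linarith
  · -- upper bound
    obtain ⟨i1, i2, _⟩ := bump_sandwich hbc hb0 hbs hbi hma hV0 hT0
      (m := oneModLogSum q (Real.exp V) * Real.exp (-((1 + δ) * (V + 1 / T))))
      (M := oneModLogSum q (Real.exp (V + 1 / T))) (mul_nonneg (hD0 _) (Real.exp_pos _).le)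
      (fun v h1 h2 => by
        rw [hnorm]
        constructor
        · have : oneModLogSum q (Real.exp V) ≤ oneModLogSum q (Real.exp v) :=
            oneModLogSum_mono q (Real.exp_le_exp.mpr (by linarith))
          have h0 := hD0 (Real.exp v)
          gcongr
        · have : oneModLogSum q (Real.exp v) ≤ oneModLogSum q (Real.exp (V + 1 / T)) :=
            oneModLogSum_mono q (Real.exp_le_exp.mpr (by linarith))
          have h3 : Real.exp (-((1 + δ) * v)) ≤ 1 := Real.exp_le_one_iff.mpr (by nlinarith)
          exact (mul_le_of_le_one_right (hD0 _) h3).trans this)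
    obtain ⟨i3, _, i4⟩ := bump_sandwich hbc hb0 hbs hbi hmk hV0 hT0 (m := 0)
      (M := (V + 1 / T) ^ κ * Real.exp (-1)) le_rfl (fun v h1 h2 => by
        have hv0 : 0 < v := by linarith
        refine ⟨by positivity, ?_⟩
        have : 1 ≤ δ * v := by rw [← hδV]; gcongr
        gcongr)
    have h1 := (abs_le.mp (hcmp V i1 i3)).2
    have h2 : oneModLogSum q (Real.exp V) * Real.exp (-((1 + δ) * (V + 1 / T))) * (β / T) ≤
        G * ((V + 1 / T) ^ κ * Real.exp (-1)) * (β / T) + C := by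
      have := mul_le_mul_of_nonneg_left i4 hG
      rw [← mul_assoc] at this
      change _ * (β / T) ≤ _ at i2
      change _ ≤ _ * (β / T) at this
      linarith
    have h3 : oneModLogSum q (Real.exp V) * Real.exp (-((1 + δ) * (V + 1 / T))) =
        A * Real.exp (-1) * Real.exp (-y) := by
      rw [hDV, show -((1 + δ) * (V + 1 / T)) = -((1 + δ) * V) + -y by rw [hy]; ring, Real.exp_add,
        ← hexp]
      ring
    rw [h3] at h2
    have h4 : A * Real.exp (-y) ≤ G * (V + 1 / T) ^ κ + C * T / β * Real.exp 1 := by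
      have e1 : Real.exp (-1) * Real.exp 1 = 1 := by rw [← Real.exp_add]; simp
      have e0 : 0 < Real.exp 1 * (T / β) := by positivity
      have := mul_le_mul_of_nonneg_right h2 e0.le
      have e2 : (β / T) * (T / β) = 1 := by field_simp
      set z := (V + 1 / T) ^ κ
      calc A * Real.exp (-y) = A * Real.exp (-1) * Real.exp (-y) * (β / T) * (Real.exp 1 * (T / β)) := by
            linear_combination (-(A * Real.exp (-y))) * e1 -
              A * Real.exp (-y) * Real.exp (-1) * Real.exp 1 * e2
        _ ≤ _ := this
        _ = _ := by
            linear_combination (G * z) * e1 + G * z * Real.exp (-1) * Real.exp 1 * e2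
    have e9 : Real.exp y ≤ 9 := by
      have : Real.exp y ≤ Real.exp (1 + 1) := Real.exp_le_exp.mpr (by linarith)
      rw [Real.exp_add] at this
      nlinarith [Real.exp_pos 1]
    have e18 : Real.exp y ≤ 1 + 18 * (1 / T) := by
      have e3 : Real.exp y * Real.exp (-y) = 1 := by rw [← Real.exp_add]; simp
      have := Real.add_one_le_exp (-y)
      nlinarith [Real.exp_pos y]
    have h5 : A ≤ (G * (V + 1 / T) ^ κ + C * T / β * Real.exp 1) * Real.exp y := by
      have := mul_le_mul_of_nonneg_right h4 (Real.exp_pos y).le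
      have e3 : Real.exp (-y) * Real.exp y = 1 := by rw [← Real.exp_add]; simp
      rwa [mul_assoc, e3, mul_one] at this
    have h6 : (V + 1 / T) ^ κ ≤ V ^ κ * (1 + 1 / T) := by
      have e0 : V + 1 / T ≤ V * (1 + 1 / T) := by nlinarith
      calc (V + 1 / T) ^ κ ≤ (V * (1 + 1 / T)) ^ κ := by gcongr
        _ = V ^ κ * (1 + 1 / T) ^ κ := Real.mul_rpow hV0.le (by positivity)
        _ ≤ V ^ κ * (1 + 1 / T) ^ (1 : ℝ) := by
            gcongr
            linarith
        _ = _ := by rw [Real.rpow_one]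
    have h7 : G * (V + 1 / T) ^ κ * Real.exp y ≤ G * V ^ κ + 37 * (G * T) := by
      have h10 : V ^ κ * (1 / T) = T := by rw [hTT]; field_simp
      calc G * (V + 1 / T) ^ κ * Real.exp y ≤ G * (V ^ κ * (1 + 1 / T)) * (1 + 18 * (1 / T)) := by
            gcongr
        _ = G * V ^ κ + 19 * (G * (V ^ κ * (1 / T))) + 18 * (G * (V ^ κ * (1 / T))) * (1 / T) := by ring
        _ ≤ G * V ^ κ + 19 * (G * (V ^ κ * (1 / T))) + 18 * (G * (V ^ κ * (1 / T))) * 1 := by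
            gcongr
        _ = _ := by rw [h10]; ring
    have h8 : C * T / β * Real.exp 1 * Real.exp y ≤ 27 * C / β * T := by
      have : 0 ≤ C * T / β := by positivity
      calc C * T / β * Real.exp 1 * Real.exp y ≤ C * T / β * 3 * 9 := by gcongr; linarith
        _ = _ := by ring
    have h14 : (37 * G + 27 * C / β) * T = 37 * (G * T) + 27 * C / β * T := by ring
    rw [h14]
    rw [add_mul] at h5
    linarith

end

noncomputable section

/-- The number of `n ≤ u` all of whose prime factors are congruent to `1` modulo `q`. -/
def oneModCount (q : ℕ) (u : ℝ) : ℝ := ∑ n ∈ Finset.Icc 1 ⌊u⌋₊, oneModInd q n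

theorem oneModCount_nonneg (q : ℕ) (u : ℝ) : 0 ≤ oneModCount q u :=
  Finset.sum_nonneg fun _ _ => oneModInd_nonneg _ _

theorem oneModCount_le (q : ℕ) {u : ℝ} (hu : 0 ≤ u) : oneModCount q u ≤ u := by
  calc oneModCount q u ≤ ∑ n ∈ Finset.Icc 1 ⌊u⌋₊, (1 : ℝ) :=
        Finset.sum_le_sum fun _ _ => oneModInd_le_one _ _
    _ = ⌊u⌋₊ := by simp
    _ ≤ u := Nat.floor_le hu

theorem oneModCount_eq_zero (q : ℕ) {u : ℝ} (hu : u < 1) : oneModCount q u = 0 := by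
  simp [oneModCount, Nat.floor_eq_zero.mpr hu]

theorem le_sum_log (N : ℕ) :
    (N : ℝ) * Real.log N - N ≤ ∑ n ∈ Finset.Icc 1 N, Real.log n := by
  induction N with
  | zero => simp
  | succ N ih =>
    rw [Finset.sum_Icc_succ_top (by omega)]
    rcases Nat.eq_zero_or_pos N with rfl | hN
    · simp
    · have hN' : (0 : ℝ) < N := by exact_mod_cast hN
      have h := Real.log_le_sub_one_of_pos (show (0 : ℝ) < (N + 1) / N by positivity)
      rw [Real.log_div (by positivity) hN'.ne'] at h
      have h2 : (N : ℝ) * (Real.log (N + 1) - Real.log N) ≤ 1 := by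
        calc (N : ℝ) * (Real.log (N + 1) - Real.log N) ≤ N * ((N + 1) / N - 1) := by gcongr
          _ = 1 := by field_simp; ring
      push_cast
      linarith

theorem sum_log_div_le {x : ℝ} (hx : 1 ≤ x) :
    ∑ n ∈ Finset.Icc 1 ⌊x⌋₊, (Real.log x - Real.log n) ≤ x := by
  have hN : 1 ≤ ⌊x⌋₊ := (Nat.one_le_floor_iff x).mpr hx
  have hN' : (0 : ℝ) < ⌊x⌋₊ := by exact_mod_cast hN
  have h := le_sum_log ⌊x⌋₊
  have h1 := Real.log_le_sub_one_of_pos (show (0 : ℝ) < x / ⌊x⌋₊ by positivity)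
  rw [Real.log_div (by positivity) hN'.ne'] at h1
  have h2 : (⌊x⌋₊ : ℝ) * (Real.log x - Real.log ⌊x⌋₊) ≤ x - ⌊x⌋₊ := by
    calc (⌊x⌋₊ : ℝ) * (Real.log x - Real.log ⌊x⌋₊) ≤ ⌊x⌋₊ * (x / ⌊x⌋₊ - 1) := by gcongr
      _ = _ := by field_simp
  rw [Finset.sum_sub_distrib]
  simp only [Finset.sum_const, Nat.card_Icc, nsmul_eq_mul, add_tsub_cancel_right]
  linarith

theorem abs_oneModCount_mul_log_sub_le (q : ℕ) {x : ℝ} (hx : 1 ≤ x) :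
    |oneModCount q x * Real.log x - oneModLogSum q x| ≤ x := by
  have hlog : ∀ n ∈ Finset.Icc 1 ⌊x⌋₊, 0 ≤ Real.log x - Real.log n := by
    intro n hn
    rw [Finset.mem_Icc] at hn
    have := Real.log_le_log (by exact_mod_cast hn.1) ((Nat.le_floor_iff (by linarith)).mp hn.2)
    linarith
  have heq : oneModCount q x * Real.log x - oneModLogSum q x =
      ∑ n ∈ Finset.Icc 1 ⌊x⌋₊, oneModInd q n * (Real.log x - Real.log n) := by
    rw [oneModCount, oneModLogSum, Finset.sum_mul, ← Finset.sum_sub_distrib]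
    simp only [mul_sub]
  rw [heq, abs_of_nonneg (Finset.sum_nonneg fun n hn =>
    mul_nonneg (oneModInd_nonneg _ _) (hlog n hn))]
  exact (Finset.sum_le_sum fun n hn =>
    mul_le_of_le_one_left (hlog n hn) (oneModInd_le_one _ _)).trans (sum_log_div_le hx)

theorem exists_abs_oneModCount_sub_le (q : ℕ) [NeZero q] (hφ : 2 ≤ q.totient) :
    ∃ K > 0, ∀ x : ℝ, 2 ≤ Real.log x → 0 < x →
      |oneModCount q x - Gq q * x * Real.log x ^ (1 / q.totient - 1 : ℝ)| ≤
        K * x * Real.log x ^ (1 / q.totient / 2 - 1 : ℝ) := by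
  obtain ⟨K, hK, h⟩ := exists_abs_oneModNorm_sub_le q hφ
  refine ⟨K + 1, by positivity, fun x hx hx0 => ?_⟩
  have hL : 0 < Real.log x := by linarith
  have hx1 : 1 ≤ x := by
    by_contra! hc
    linarith [Real.log_neg hx0 hc]
  set κ : ℝ := 1 / q.totient with hκ
  have hκ0 : 0 ≤ κ := by positivity
  have h1 := h _ hx
  rw [oneModNorm, Real.exp_log hx0, Real.exp_neg, Real.exp_log hx0] at h1
  have h2 := abs_oneModCount_mul_log_sub_le q hx1
  have h3 : |oneModLogSum q x - x * (Gq q * Real.log x ^ κ)| ≤ x * (K * Real.log x ^ (κ / 2)) := by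
    calc |oneModLogSum q x - x * (Gq q * Real.log x ^ κ)|
        = x * |oneModLogSum q x * x⁻¹ - Gq q * Real.log x ^ κ| := by
          rw [← abs_of_pos hx0, ← abs_mul, abs_of_pos hx0]
          congr 1
          field_simp
      _ ≤ _ := by gcongr
  have hone : 1 ≤ Real.log x ^ (κ / 2) := Real.one_le_rpow (by linarith) (by positivity)
  have h4 : |oneModCount q x * Real.log x - x * (Gq q * Real.log x ^ κ)| ≤
      (K + 1) * x * Real.log x ^ (κ / 2) := by
    have h5 := abs_sub_le (oneModCount q x * Real.log x) (oneModLogSum q x)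
      (x * (Gq q * Real.log x ^ κ))
    have : x * 1 ≤ x * Real.log x ^ (κ / 2) := by gcongr
    linarith
  rw [Real.rpow_sub hL, Real.rpow_sub hL, Real.rpow_one, ← mul_div_assoc, ← mul_div_assoc, le_div_iff₀ hL]
  calc _ = |oneModCount q x * Real.log x - x * (Gq q * Real.log x ^ κ)| := by
        conv_lhs => rw [← abs_of_pos hL, ← abs_mul, abs_of_pos hL]
        congr 1
        field_simp
    _ ≤ _ := h4

end

noncomputable section

theorem log_div_dichotomy {x d : ℝ} (hx : 0 < x) (hL : 2 ≤ Real.log x) (hd : 1 ≤ d) :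
    (2 ≤ Real.log (x / d) ∧ Real.log x / 2 ≤ Real.log (x / d)) ∨
      x / d ≤ 8 * (x * d ^ (-(3 / 4) : ℝ)) / Real.log x := by
  have hd0 : 0 < d := by linarith
  by_cases hc : Real.log d ≤ Real.log x / 2 ∧ 4 ≤ Real.log x
  · left
    rw [Real.log_div hx.ne' hd0.ne']
    constructor <;> linarith [hc.1, hc.2]
  · right
    have h1 : 1 ≤ d ^ (1 / 4 : ℝ) := Real.one_le_rpow hd (by norm_num)
    have h2 : Real.log x ≤ 8 * d ^ (1 / 4 : ℝ) := by
      rw [not_and_or, not_le, not_le] at hc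
      rcases hc with hc | hc
      · have := Real.log_le_rpow_div hd0.le (show (0 : ℝ) < 1 / 4 by norm_num)
        linarith
      · linarith
    rw [le_div_iff₀ (by linarith)]
    have h3 : d ^ (-(3 / 4) : ℝ) = d ^ (1 / 4 : ℝ) / d := by
      rw [← Real.rpow_sub_one hd0.ne']; norm_num
    rw [h3]
    calc x / d * Real.log x ≤ x / d * (8 * d ^ (1 / 4 : ℝ)) := by gcongr
      _ = _ := by ring

/-- A pointwise bound `F y ≤ K y (log y)^(-a)` passes to `F (x / d)` with a power saving in `d`. -/
theorem bound_div_of_bound {F : ℝ → ℝ} {K a : ℝ} (hK : 0 ≤ K) (ha0 : 0 ≤ a) (ha1 : a ≤ 1)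
    (hF : ∀ y, 0 ≤ y → F y ≤ y)
    (hF2 : ∀ y, 0 < y → 2 ≤ Real.log y → F y ≤ K * y * Real.log y ^ (-a))
    {x d : ℝ} (hx : 0 < x) (hL : 2 ≤ Real.log x) (hd : 1 ≤ d) :
    F (x / d) ≤ (2 * K + 8) * (x * d ^ (-(3 / 4) : ℝ)) * Real.log x ^ (-a) := by
  have hd0 : 0 < d := by linarith
  have hL0 : 0 < Real.log x := by linarith
  have hLa : 0 < Real.log x ^ (-a) := Real.rpow_pos_of_pos hL0 _
  have hdd : 0 < d ^ (-(3 / 4) : ℝ) := Real.rpow_pos_of_pos hd0 _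
  have hxd : 0 < x * d ^ (-(3 / 4) : ℝ) * Real.log x ^ (-a) := by positivity
  rcases log_div_dichotomy hx hL hd with ⟨h1, h2⟩ | h
  · have h3 : Real.log (x / d) ^ (-a) ≤ 2 * Real.log x ^ (-a) := by
      calc Real.log (x / d) ^ (-a) ≤ (Real.log x / 2) ^ (-a) :=
            Real.rpow_le_rpow_of_nonpos (by linarith) h2 (by linarith)
        _ = 2 ^ a * Real.log x ^ (-a) := by
            rw [Real.div_rpow hL0.le (by norm_num), Real.rpow_neg zero_le_two, div_inv_eq_mul,
              mul_comm]
        _ ≤ 2 ^ (1 : ℝ) * Real.log x ^ (-a) := by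
            gcongr
            norm_num
        _ = _ := by rw [Real.rpow_one]
    have h4 : x / d ≤ x * d ^ (-(3 / 4) : ℝ) := by
      rw [div_eq_mul_inv, ← Real.rpow_neg_one]
      gcongr
      norm_num
    calc F (x / d) ≤ K * (x / d) * Real.log (x / d) ^ (-a) := hF2 _ (by positivity) h1
      _ ≤ K * (x * d ^ (-(3 / 4) : ℝ)) * (2 * Real.log x ^ (-a)) := by gcongr
      _ ≤ _ := by nlinarith
  · have h3 : 1 / Real.log x ≤ Real.log x ^ (-a) := by
      rw [one_div, ← Real.rpow_neg_one]
      exact Real.rpow_le_rpow_of_exponent_le (by linarith) (by linarith)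
    calc F (x / d) ≤ x / d := hF _ (by positivity)
      _ ≤ 8 * (x * d ^ (-(3 / 4) : ℝ)) * (1 / Real.log x) := by rw [mul_one_div]; exact h
      _ ≤ 8 * (x * d ^ (-(3 / 4) : ℝ)) * Real.log x ^ (-a) := by gcongr
      _ ≤ _ := by nlinarith [mul_nonneg hK hxd.le]

theorem rpow_sub_rpow_le {l L a : ℝ} (hl : L / 2 ≤ l) (hlL : l ≤ L) (hL : 0 < L)
    (ha1 : a ≤ 1) : l ^ (-a) - L ^ (-a) ≤ 2 * L ^ (-a) * ((L - l) / L) := by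
  have hl0 : 0 < l := by linarith
  have h1 : l / L ≤ (l / L) ^ a := by
    have := Real.rpow_le_rpow_of_exponent_ge (show 0 < l / L by positivity)
      ((div_le_one hL).mpr hlL) ha1
    rwa [Real.rpow_one] at this
  have h2 : L ^ (-a) = l ^ (-a) * (l / L) ^ a := by
    rw [Real.div_rpow hl0.le hL.le, Real.rpow_neg hl0.le, Real.rpow_neg hL.le]
    have := Real.rpow_pos_of_pos hl0 a
    field_simp
  have h3 : l ^ (-a) ≤ 2 * L ^ (-a) := by
    have : 1 / 2 ≤ l / L := by rw [div_le_div_iff₀ two_pos hL]; linarith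
    rw [h2]
    have h4 : 1 / 2 ≤ (l / L) ^ a := this.trans h1
    nlinarith [Real.rpow_pos_of_pos hl0 (-a)]
  have h5 : (L - l) / L = 1 - l / L := by field_simp
  rw [h5]
  have h6 : 0 ≤ 1 - l / L := by rw [sub_nonneg]; exact (div_le_one hL).mpr hlL
  calc l ^ (-a) - L ^ (-a) = l ^ (-a) * (1 - (l / L) ^ a) := by rw [h2]; ring
    _ ≤ l ^ (-a) * (1 - l / L) := by gcongr
    _ ≤ _ := by gcongr

theorem exists_abs_oneModCount_div_sub_le (q : ℕ) [NeZero q] (hφ : 2 ≤ q.totient) :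
    ∃ K > 0, ∀ x : ℝ, 2 ≤ Real.log x → 0 < x → ∀ d : ℝ, 1 ≤ d →
      |oneModCount q (x / d) - Gq q * (x / d) * Real.log x ^ (1 / q.totient - 1 : ℝ)| ≤
        K * (x * d ^ (-(3 / 4) : ℝ)) * Real.log x ^ (1 / q.totient / 2 - 1 : ℝ) := by
  obtain ⟨K, hK, hA⟩ := exists_abs_oneModCount_sub_le q hφ
  set κ : ℝ := 1 / q.totient with hκ
  have hκ0 : 0 ≤ κ := by positivity
  have hφ' : (2 : ℝ) ≤ q.totient := by exact_mod_cast hφ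
  have hκ1 : κ ≤ 1 := by rw [hκ, div_le_one (by linarith)]; linarith
  have hG := Gq_nonneg q
  set F : ℝ → ℝ := fun y => if 2 ≤ Real.log y then
    |oneModCount q y - Gq q * y * Real.log y ^ (κ - 1)| / (1 + Gq q) else 0 with hFdef
  have hF : ∀ y, 0 ≤ y → F y ≤ y := by
    intro y hy
    simp only [hFdef]
    split_ifs with h
    · rw [div_le_iff₀ (by positivity)]
      have h1 := oneModCount_le q hy
      have h2 := oneModCount_nonneg q y
      have h3 : Real.log y ^ (κ - 1) ≤ 1 :=
        Real.rpow_le_one_of_one_le_of_nonpos (by linarith) (by linarith)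
      have h4 : 0 ≤ Real.log y ^ (κ - 1) := Real.rpow_nonneg (by linarith) _
      have h5 : Gq q * y * Real.log y ^ (κ - 1) ≤ Gq q * y * 1 := by gcongr
      have h6 : 0 ≤ Gq q * y * Real.log y ^ (κ - 1) := by positivity
      rw [abs_le]
      constructor <;> nlinarith [mul_nonneg hG hy]
    · exact hy
  have hF2 : ∀ y, 0 < y → 2 ≤ Real.log y → F y ≤ K * y * Real.log y ^ (-(1 - κ / 2)) := by
    intro y hy h
    simp only [hFdef, if_pos h]
    refine (div_le_self (abs_nonneg _) (by linarith)).trans ?_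
    have := hA y h hy
    rwa [show -(1 - κ / 2) = κ / 2 - 1 by ring]
  refine ⟨(1 + Gq q) * (2 * K + 8) + 8 * Gq q + 8 * (1 + Gq q), by positivity, ?_⟩
  intro x hL hx d hd
  have hd0 : 0 < d := by linarith
  have hL0 : 0 < Real.log x := by linarith
  have hmain := bound_div_of_bound hK.le (show 0 ≤ 1 - κ / 2 by linarith) (by linarith)
    hF hF2 hx hL hd
  rw [show -(1 - κ / 2) = κ / 2 - 1 by ring] at hmain
  have hLa : 0 < Real.log x ^ (κ / 2 - 1) := Real.rpow_pos_of_pos hL0 _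
  have hdd : 0 < d ^ (-(3 / 4) : ℝ) := Real.rpow_pos_of_pos hd0 _
  set B := x * d ^ (-(3 / 4) : ℝ) * Real.log x ^ (κ / 2 - 1) with hB
  have hB0 : 0 < B := by positivity
  have hxd : 0 < x / d := by positivity
  suffices h : |oneModCount q (x / d) - Gq q * (x / d) * Real.log x ^ (κ - 1)| ≤
      ((1 + Gq q) * (2 * K + 8) + 8 * Gq q + 8 * (1 + Gq q)) * B by
    refine h.trans (le_of_eq ?_); rw [hB]; ring
  rcases log_div_dichotomy hx hL hd with ⟨h1, h2⟩ | h
  · have h3 : |oneModCount q (x / d) - Gq q * (x / d) * Real.log (x / d) ^ (κ - 1)| ≤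
        (1 + Gq q) * (2 * K + 8) * B := by
      simp only [hFdef, if_pos h1] at hmain
      rw [div_le_iff₀ (by positivity)] at hmain
      refine hmain.trans (le_of_eq ?_); rw [hB]; ring
    have hlog : Real.log (x / d) = Real.log x - Real.log d := Real.log_div hx.ne' hd0.ne'
    have hlogd : 0 ≤ Real.log d := Real.log_nonneg hd
    have h4 := rpow_sub_rpow_le (a := 1 - κ) h2 (by linarith) hL0 (by linarith)
    rw [show -(1 - κ) = κ - 1 by ring] at h4
    have h5 : Real.log x ^ (κ - 1) ≤ Real.log (x / d) ^ (κ - 1) :=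
      Real.rpow_le_rpow_of_nonpos (by linarith) (by linarith) (by linarith)
    have h6 : Real.log x ^ (κ - 1) / Real.log x ≤ Real.log x ^ (κ / 2 - 1) := by
      rw [← Real.rpow_sub_one hL0.ne']
      exact Real.rpow_le_rpow_of_exponent_le (by linarith) (by linarith)
    have h7 : x / d * Real.log d ≤ 4 * (x * d ^ (-(3 / 4) : ℝ)) := by
      have e : d ^ (-(3 / 4) : ℝ) = d ^ (1 / 4 : ℝ) / d := by
        rw [← Real.rpow_sub_one hd0.ne']; norm_num
      have := Real.log_le_rpow_div hd0.le (show (0 : ℝ) < 1 / 4 by norm_num)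
      rw [e]
      calc x / d * Real.log d ≤ x / d * (d ^ (1 / 4 : ℝ) / (1 / 4)) := by gcongr
        _ = _ := by ring
    have h8 : |Gq q * (x / d) * Real.log (x / d) ^ (κ - 1) -
        Gq q * (x / d) * Real.log x ^ (κ - 1)| ≤ 8 * Gq q * B := by
      rw [← mul_sub, abs_of_nonneg (mul_nonneg (by positivity) (by linarith))]
      calc Gq q * (x / d) * (Real.log (x / d) ^ (κ - 1) - Real.log x ^ (κ - 1))
          ≤ Gq q * (x / d) * (2 * Real.log x ^ (κ - 1) *
            ((Real.log x - Real.log (x / d)) / Real.log x)) := by gcongr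
        _ = 2 * Gq q * (x / d * Real.log d) * (Real.log x ^ (κ - 1) / Real.log x) := by
          rw [hlog]; ring
        _ ≤ 2 * Gq q * (4 * (x * d ^ (-(3 / 4) : ℝ))) * Real.log x ^ (κ / 2 - 1) := by
          gcongr
        _ = _ := by rw [hB]; ring
    have h9 := abs_sub_le (oneModCount q (x / d)) (Gq q * (x / d) * Real.log (x / d) ^ (κ - 1))
      (Gq q * (x / d) * Real.log x ^ (κ - 1))
    nlinarith [mul_nonneg hG hB0.le]
  · have h3 : 1 / Real.log x ≤ Real.log x ^ (κ / 2 - 1) := by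
      rw [one_div, ← Real.rpow_neg_one]
      exact Real.rpow_le_rpow_of_exponent_le (by linarith) (by linarith)
    have h4 : x / d ≤ 8 * B := by
      calc x / d ≤ 8 * (x * d ^ (-(3 / 4) : ℝ)) * (1 / Real.log x) := by rw [mul_one_div]; exact h
        _ ≤ 8 * (x * d ^ (-(3 / 4) : ℝ)) * Real.log x ^ (κ / 2 - 1) := by gcongr
        _ = _ := by rw [hB]; ring
    have h5 := oneModCount_le q hxd.le
    have h6 := oneModCount_nonneg q (x / d)
    have h7 : Real.log x ^ (κ - 1) ≤ 1 :=
      Real.rpow_le_one_of_one_le_of_nonpos (by linarith) (by linarith)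
    have h8 : 0 ≤ Real.log x ^ (κ - 1) := Real.rpow_nonneg (by linarith) _
    have h9 : Gq q * (x / d) * Real.log x ^ (κ - 1) ≤ Gq q * (x / d) * 1 := by gcongr
    have h10 : 0 ≤ Gq q * (x / d) * Real.log x ^ (κ - 1) := by positivity
    have h11 : |oneModCount q (x / d) - Gq q * (x / d) * Real.log x ^ (κ - 1)| ≤
        (1 + Gq q) * (x / d) := by
      rw [abs_le]
      constructor <;> nlinarith [mul_nonneg hG hxd.le]
    have h12 : 0 ≤ ((1 + Gq q) * (2 * K + 8) + 8 * Gq q) * B := by positivity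
    have h13 : (1 + Gq q) * (x / d) ≤ (1 + Gq q) * (8 * B) := by gcongr
    linarith

end

/-- The product of the cyclic groups of orders `e i`. -/
abbrev CyclicProd {ι : Type*} (e : ι → ℕ) : Type _ := (i : ι) → Multiplicative (ZMod (e i))

theorem card_cyclic_torsion {n : ℕ} (hn : n ≠ 0) (m : ℕ) :
    Nat.card {g : Multiplicative (ZMod n) // g ^ m = 1} = m.gcd n := by
  have : NeZero n := ⟨hn⟩
  have h := IsCyclic.card_powMonoidHom_ker (G := Multiplicative (ZMod n)) m
  rw [Nat.card_congr Multiplicative.toAdd, Nat.card_zmod, Nat.gcd_comm] at h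
  rw [← h]
  exact Nat.card_congr (Equiv.subtypeEquivRight fun g => by simp [MonoidHom.mem_ker])

theorem card_cyclicProd_torsion {ι : Type*} [Fintype ι] {e : ι → ℕ} (he : ∀ i, e i ≠ 0) (m : ℕ) :
    Nat.card {g : CyclicProd e // g ^ m = 1} = ∏ i, m.gcd (e i) := by
  simp_rw [← fun i => card_cyclic_torsion (he i) m, ← Nat.card_pi]
  exact Nat.card_congr <|
    (Equiv.subtypeEquivRight fun g => by simp [funext_iff]).trans
    (Equiv.subtypePiEquivPi (p := fun i (g : Multiplicative (ZMod (e i))) => g ^ m = 1))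

theorem prod_gcd_eq_of_mulEquiv {ι κ : Type*} [Fintype ι] [Fintype κ] {e : ι → ℕ} {d : κ → ℕ}
    (he : ∀ i, e i ≠ 0) (hd : ∀ i, d i ≠ 0) (f : CyclicProd e ≃* CyclicProd d) (m : ℕ) :
    ∏ i, m.gcd (e i) = ∏ i, m.gcd (d i) := by
  rw [← card_cyclicProd_torsion he, ← card_cyclicProd_torsion hd]
  refine Nat.card_congr (f.toEquiv.subtypeEquiv fun g => ?_)
  rw [MulEquiv.toEquiv_eq_coe, MulEquiv.coe_toEquiv, ← map_pow, map_eq_one_iff f f.injective]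

theorem dvd_of_prod_gcd_eq_pow {ι : Type*} [Fintype ι] {e : ι → ℕ} {m : ℕ} (hm : m ≠ 0)
    (h : m ^ Fintype.card ι ≤ ∏ i, m.gcd (e i)) (i : ι) : m ∣ e i := by
  have hle : ∀ i, m.gcd (e i) ≤ m := fun i => Nat.gcd_le_left _ (Nat.pos_of_ne_zero hm)
  by_contra hc
  have hlt : m.gcd (e i) < m := lt_of_le_of_ne (hle i) fun h => hc (Nat.gcd_eq_left_iff_dvd.mp h)
  have := Finset.prod_lt_prod (s := Finset.univ) (f := fun i => m.gcd (e i)) (g := fun _ => m)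
    (fun i _ => Nat.gcd_pos_of_pos_left _ (Nat.pos_of_ne_zero hm)) (fun i _ => hle i)
    ⟨i, Finset.mem_univ i, hlt⟩
  simp only [Finset.prod_const, Finset.card_univ] at this
  omega

/-- For a product of cyclic groups of even orders, the first invariant factor is the gcd of the
orders. -/
theorem dvd_first_invFactor_iff {ι : Type*} [Fintype ι] {e : ι → ℕ} (he : ∀ i, e i ≠ 0)
    (he2 : ∀ i, 2 ∣ e i) {k : ℕ} {d : Fin (k + 1) → ℕ}
    (hd : IsInvFactorDecomp (CyclicProd e) d) (m : ℕ) : m ∣ d 0 ↔ ∀ i, m ∣ e i := by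
  obtain ⟨hd1, hdd, ⟨f⟩⟩ := hd
  have hd0 : ∀ i, d i ≠ 0 := fun i => by have := hd1 i; omega
  have key := prod_gcd_eq_of_mulEquiv he hd0 f
  have hcard : Fintype.card ι ≤ k + 1 := by
    have h1 : ∏ i, Nat.gcd 2 (e i) = 2 ^ Fintype.card ι := by
      rw [Finset.prod_congr rfl fun i _ => Nat.gcd_eq_left (he2 i)]
      simp
    have h2 : ∏ i, Nat.gcd 2 (d i) ≤ 2 ^ (k + 1) := by
      calc ∏ i, Nat.gcd 2 (d i) ≤ ∏ _i : Fin (k + 1), 2 :=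
            Finset.prod_le_prod' fun i _ => Nat.gcd_le_left _ two_pos
        _ = _ := by simp
    rw [← key, h1] at h2
    exact (Nat.pow_le_pow_iff_right (by norm_num)).mp h2
  have hd0e : ∀ i, d 0 ∣ e i := by
    apply dvd_of_prod_gcd_eq_pow (hd0 0)
    rw [key, Finset.prod_congr rfl fun i _ => Nat.gcd_eq_left (hdd 0 i (Fin.zero_le i))]
    simpa using Nat.pow_le_pow_right (Nat.pos_of_ne_zero (hd0 0)) hcard
  have hcard' : k + 1 = Fintype.card ι := by
    have h := key (d 0)
    rw [Finset.prod_congr rfl fun i _ => Nat.gcd_eq_left (hd0e i),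
      Finset.prod_congr (g := fun _ => d 0) rfl
        fun i _ => Nat.gcd_eq_left (hdd 0 i (Fin.zero_le i))] at h
    simp only [Finset.prod_const, Finset.card_univ, Fintype.card_fin] at h
    exact (Nat.pow_right_injective (hd1 0) h).symm
  refine ⟨fun h i => h.trans (hd0e i), fun h => ?_⟩
  rcases Nat.eq_zero_or_pos m with rfl | hm
  · have : Nonempty ι := Fintype.card_pos_iff.mp (by omega)
    exact absurd (zero_dvd_iff.mp (h this.some)) (he _)
  refine dvd_of_prod_gcd_eq_pow (e := d) hm.ne' ?_ 0
  rw [← key, Finset.prod_congr rfl fun i _ => Nat.gcd_eq_left (h i)]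
  simp [hcard']

theorem exists_coprime_splitting {a b : ℕ} (ha : a ≠ 0) (hb : b ≠ 0) :
    ∃ a₁ a₂ b₁ b₂ : ℕ, a = a₁ * a₂ ∧ b = b₁ * b₂ ∧ a₁.Coprime a₂ ∧ b₁.Coprime b₂ ∧
      a₁.Coprime b₂ ∧ b₁.Coprime a₂ ∧ a₂ ∣ b₂ ∧ b₁ ∣ a₁ := by
  classical
  set P := (a * b).primeFactors with hP
  have hPp : ∀ p ∈ P, p.Prime := fun p hp => Nat.prime_of_mem_primeFactors hp
  have hprod : ∀ c, c ≠ 0 → c.primeFactors ⊆ P → c = ∏ p ∈ P, p ^ c.factorization p := by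
    intro c hc hcP
    conv_lhs => rw [← Nat.prod_factorization_pow_eq_self hc]
    exact Finsupp.prod_of_support_subset _ hcP _ fun _ _ => pow_zero _
  have haP : a.primeFactors ⊆ P := by
    rw [hP, Nat.primeFactors_mul ha hb]; exact Finset.subset_union_left
  have hbP : b.primeFactors ⊆ P := by
    rw [hP, Nat.primeFactors_mul ha hb]; exact Finset.subset_union_right
  have hcop : ∀ u v : ℕ → ℕ,
      (∏ p ∈ P with b.factorization p ≤ a.factorization p, p ^ u p).Coprime
      (∏ p ∈ P with ¬ b.factorization p ≤ a.factorization p, p ^ v p) := by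
    intro u v
    refine Nat.Coprime.prod_left fun p hp => Nat.Coprime.prod_right fun r hr => ?_
    rw [Finset.mem_filter] at hp hr
    refine Nat.Coprime.pow _ _ ((Nat.coprime_primes (hPp p hp.1) (hPp r hr.1)).mpr ?_)
    rintro rfl
    exact hr.2 hp.2
  refine ⟨_, _, _, _, (hprod a ha haP).trans (Finset.prod_filter_mul_prod_filter_not P
    (fun p => b.factorization p ≤ a.factorization p) _).symm,
    (hprod b hb hbP).trans (Finset.prod_filter_mul_prod_filter_not P
    (fun p => b.factorization p ≤ a.factorization p) _).symm, hcop _ _, hcop _ _, hcop _ _,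
    hcop _ _, ?_, ?_⟩
  · refine Finset.prod_dvd_prod_of_dvd _ _ fun p hp => pow_dvd_pow _ ?_
    rw [Finset.mem_filter] at hp; omega
  · refine Finset.prod_dvd_prod_of_dvd _ _ fun p hp => pow_dvd_pow _ ?_
    rw [Finset.mem_filter] at hp; omega

/-- The Chinese remainder theorem for multiplicatively written cyclic groups. -/
def mulChinese {m n : ℕ} (h : m.Coprime n) :
    Multiplicative (ZMod (m * n)) ≃* Multiplicative (ZMod m) × Multiplicative (ZMod n) :=
  (AddEquiv.toMultiplicative (ZMod.chineseRemainder h).toAddEquiv).trans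
    (MulEquiv.prodMultiplicative _ _)

theorem exists_cyclic_prod_equiv {a b : ℕ} (ha : a ≠ 0) (hb : b ≠ 0) :
    ∃ g l : ℕ, g ≠ 0 ∧ l ≠ 0 ∧ g ∣ l ∧ g ∣ b ∧ (∀ c, c ∣ a → c ∣ b → c ∣ g) ∧
      Nonempty (Multiplicative (ZMod a) × Multiplicative (ZMod b) ≃*
        Multiplicative (ZMod g) × Multiplicative (ZMod l)) := by
  obtain ⟨a₁, a₂, b₁, b₂, rfl, rfl, h1, h2, h3, h4, h5, h6⟩ := exists_coprime_splitting ha hb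
  refine ⟨b₁ * a₂, a₁ * b₂, mul_ne_zero (left_ne_zero_of_mul hb) (right_ne_zero_of_mul ha),
    mul_ne_zero (left_ne_zero_of_mul ha) (right_ne_zero_of_mul hb), mul_dvd_mul h6 h5,
    mul_dvd_mul_left _ h5, ?_, ?_⟩
  · intro c hca hcb
    have hg : (a₁ * a₂).gcd (b₁ * b₂) = b₁ * a₂ := by
      rw [Nat.Coprime.gcd_mul _ h2, Nat.gcd_eq_right (h6.mul_right a₂),
        Nat.Coprime.gcd_mul_left_cancel _ h3, Nat.gcd_eq_left h5]
    rw [← hg]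
    exact Nat.dvd_gcd hca hcb
  · refine ⟨((mulChinese h1).prodCongr (mulChinese h2)).trans (MulEquiv.trans ?_
      ((mulChinese h4).prodCongr (mulChinese h3)).symm)⟩
    exact
      { toFun := fun x => ((x.2.1, x.1.2), (x.1.1, x.2.2))
        invFun := fun x => ((x.2.1, x.1.2), (x.1.1, x.2.2))
        left_inv := fun _ => rfl
        right_inv := fun _ => rfl
        map_mul' := fun _ _ => rfl }

/-- Splitting off the first factor of a product over `Fin (k + 1)`. -/
def cyclicProdSucc {k : ℕ} (e : Fin (k + 1) → ℕ) :
    CyclicProd e ≃* Multiplicative (ZMod (e 0)) × CyclicProd (fun i : Fin k => e i.succ) where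
  toEquiv := (Fin.consEquiv _).symm
  map_mul' _ _ := rfl

theorem exists_chain_insert (k : ℕ) : ∀ (a : ℕ) (d : Fin k → ℕ), a ≠ 0 → (∀ i, d i ≠ 0) →
    (∀ i j, i ≤ j → d i ∣ d j) → ∃ D : Fin (k + 1) → ℕ, (∀ i, D i ≠ 0) ∧
      (∀ i j, i ≤ j → D i ∣ D j) ∧ (∀ c, c ∣ a → (∀ i, c ∣ d i) → ∀ i, c ∣ D i) ∧
      Nonempty (Multiplicative (ZMod a) × CyclicProd d ≃* CyclicProd D) := by
  induction k with
  | zero =>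
    intro a d ha _ _
    refine ⟨fun _ => a, fun _ => ha, fun _ _ _ => dvd_rfl, fun c hc _ _ => hc, ⟨?_⟩⟩
    refine MulEquiv.trans ?_ (cyclicProdSucc (fun _ => a)).symm
    exact (MulEquiv.refl _).prodCongr (MulEquiv.ofUnique (M := CyclicProd d))
  | succ k ih =>
    intro a d ha hd hdd
    obtain ⟨g, l, hg, hl, hgl, hgb, hc, ⟨f⟩⟩ := exists_cyclic_prod_equiv ha (hd 0)
    obtain ⟨D, hD0, hDD, hDc, ⟨f'⟩⟩ := ih l (fun i => d i.succ) hl (fun i => hd _)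
      (fun i j hij => hdd _ _ (Fin.succ_le_succ_iff.mpr hij))
    refine ⟨Fin.cons g D, Fin.cases hg hD0, ?_, ?_, ⟨?_⟩⟩
    · refine Fin.cases (fun j _ => ?_) fun i => Fin.cases (fun h => ?_) fun j hij => ?_
      · refine Fin.cases dvd_rfl (fun j => ?_) j
        exact hDc g hgl (fun i => hgb.trans (hdd 0 _ (Fin.zero_le _))) j
      · exact absurd (le_antisymm h (Fin.zero_le _)) (Fin.succ_ne_zero i)
      · exact hDD i j (Fin.succ_le_succ_iff.mp hij)
    · intro c hca hcd
      have hcg := hc c hca (hcd 0)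
      exact Fin.cases hcg (hDc c (hcg.trans hgl) fun i => hcd _)
    · refine MulEquiv.trans ?_ (cyclicProdSucc (Fin.cons g D)).symm
      refine MulEquiv.trans ?_ ((MulEquiv.refl _).prodCongr f')
      refine MulEquiv.trans ((MulEquiv.refl _).prodCongr (cyclicProdSucc d)) ?_
      exact (MulEquiv.prodAssoc.symm.trans (f.prodCongr (MulEquiv.refl _))).trans
        MulEquiv.prodAssoc

theorem exists_chain (k : ℕ) : ∀ e : Fin k → ℕ, (∀ i, e i ≠ 0) →
    ∃ D : Fin k → ℕ, (∀ i, D i ≠ 0) ∧ (∀ i j, i ≤ j → D i ∣ D j) ∧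
      (∀ c, (∀ i, c ∣ e i) → ∀ i, c ∣ D i) ∧ Nonempty (CyclicProd e ≃* CyclicProd D) := by
  induction k with
  | zero => exact fun e _ => ⟨e, fun i => i.elim0, fun i => i.elim0, fun _ h => h, ⟨.refl _⟩⟩
  | succ k ih =>
    intro e he
    obtain ⟨d, hd, hdd, hdc, ⟨f⟩⟩ := ih (fun i => e i.succ) fun i => he _
    obtain ⟨D, hD, hDD, hDc, ⟨f'⟩⟩ := exists_chain_insert k (e 0) d (he 0) hd hdd
    exact ⟨D, hD, hDD, fun c hc => hDc c (hc 0) (hdc c fun i => hc _),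
      ⟨((cyclicProdSucc e).trans ((MulEquiv.refl _).prodCongr f)).trans f'⟩⟩

theorem exists_isInvFactorDecomp {ι : Type*} [Fintype ι] [Nonempty ι] {e : ι → ℕ}
    (he : ∀ i, e i ≠ 0) (he2 : ∀ i, 2 ∣ e i) :
    ∃ (k : ℕ) (d : Fin (k + 1) → ℕ), IsInvFactorDecomp (CyclicProd e) d := by
  obtain ⟨k, hk⟩ := Nat.exists_eq_succ_of_ne_zero (Fintype.card_ne_zero (α := ι))
  have E : Fin (k + 1) ≃ ι := (Fintype.equivFinOfCardEq hk).symm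
  obtain ⟨D, hD, hDD, hDc, ⟨f⟩⟩ := exists_chain (k + 1) (fun i => e (E i)) fun i => he _
  refine ⟨k, D, fun i => ?_, hDD, ⟨MulEquiv.trans ?_ f⟩⟩
  · have h1 := Nat.le_of_dvd (Nat.pos_of_ne_zero (hD i)) (hDc 2 (fun i => he2 _) i)
    omega
  · exact
      { toEquiv := (Equiv.piCongrLeft (fun i => Multiplicative (ZMod (e i))) E).symm
        map_mul' := fun _ _ => rfl }

theorem IsInvFactorDecomp.congr {G H : Type*} [CommGroup G] [CommGroup H] (f : G ≃* H) {k : ℕ}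
    {d : Fin k → ℕ} (h : IsInvFactorDecomp G d) : IsInvFactorDecomp H d :=
  ⟨h.1, h.2.1, h.2.2.map f.symm.trans⟩

theorem dvd_leastInvFactor_iff {G ι : Type*} [CommGroup G] [Fintype ι] [Nonempty ι] {e : ι → ℕ}
    (he : ∀ i, e i ≠ 0) (he2 : ∀ i, 2 ∣ e i) (f : G ≃* CyclicProd e) (m : ℕ) :
    m ∣ leastInvFactor G ↔ ∀ i, m ∣ e i := by
  obtain ⟨k, d, hd⟩ := exists_isInvFactorDecomp he he2
  obtain ⟨k', d', hd', h0⟩ := Nat.sInf_mem (s := {m | ∃ (k : ℕ) (d : Fin (k + 1) → ℕ),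
    IsInvFactorDecomp G d ∧ d 0 = m}) ⟨d 0, k, d, hd.congr f.symm, rfl⟩
  rw [leastInvFactor, ← h0]
  exact dvd_first_invFactor_iff he he2 (hd'.congr f) m

noncomputable section

/-- The arithmetic condition equivalent to `q ∣ λ₁(n)` for even `q ≥ 4` and `n ≥ 3`. -/
def UnitsDvd (q n : ℕ) : Prop :=
  ¬ 4 ∣ n ∧ ∀ p : ℕ, p.Prime → p ≠ 2 → p ∣ n → q ∣ (p ^ n.factorization p).totient

theorem unitsDvd_mul {q a b : ℕ} (h : a.Coprime b) :
    UnitsDvd q (a * b) ↔ UnitsDvd q a ∧ UnitsDvd q b := by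
  have h4 : 4 ∣ a * b ↔ 4 ∣ a ∨ 4 ∣ b :=
    Nat.Coprime.isPrimePow_dvd_mul h (show IsPrimePow 4 from
      (isPrimePow_nat_iff _).mpr ⟨2, 2, Nat.prime_two, by norm_num, by norm_num⟩)
  have hl : ∀ p : ℕ, p.Prime → p ∣ a → (a * b).factorization p = a.factorization p := by
    intro p hp hpa
    rcases eq_or_ne a 0 with rfl | ha
    · have hb : b = 1 := by simpa using h
      simp [hb]
    exact Nat.factorization_eq_of_coprime_left h (Nat.mem_primeFactorsList ha |>.mpr ⟨hp, hpa⟩)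
  have hr : ∀ p : ℕ, p.Prime → p ∣ b → (a * b).factorization p = b.factorization p := by
    intro p hp hpb
    rcases eq_or_ne b 0 with rfl | hb
    · have ha : a = 1 := by simpa using h
      simp [ha]
    exact Nat.factorization_eq_of_coprime_right h (Nat.mem_primeFactorsList hb |>.mpr ⟨hp, hpb⟩)
  unfold UnitsDvd
  rw [h4, not_or]
  constructor
  · rintro ⟨⟨h1, h2⟩, h3⟩
    refine ⟨⟨h1, fun p hp hp2 hd => ?_⟩, ⟨h2, fun p hp hp2 hd => ?_⟩⟩
    · rw [← hl p hp hd]; exact h3 p hp hp2 (hd.mul_right b)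
    · rw [← hr p hp hd]; exact h3 p hp hp2 (hd.mul_left a)
  · rintro ⟨⟨h1, h3⟩, h2, h4⟩
    refine ⟨⟨h1, h2⟩, fun p hp hp2 hd => ?_⟩
    rcases hp.dvd_mul.mp hd with hd | hd
    · rw [hl p hp hd]; exact h3 p hp hp2 hd
    · rw [hr p hp hd]; exact h4 p hp hp2 hd

theorem neg_one_not_square_two_pow {k : ℕ} (hk : 2 ≤ k) (y : (ZMod (2 ^ k))ˣ) : y ^ 2 ≠ -1 := by
  intro h
  have hd : 4 ∣ 2 ^ k := pow_dvd_pow 2 hk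
  have h1 := congrArg (fun u : (ZMod (2 ^ k))ˣ => ZMod.castHom hd (ZMod 4) (u : ZMod (2 ^ k))) h
  simp only [Units.val_pow_eq_pow_val, map_pow, Units.val_neg, Units.val_one, map_neg,
    map_one] at h1
  revert h1
  generalize ZMod.castHom hd (ZMod 4) (y : ZMod (2 ^ k)) = z
  revert z
  decide

theorem exists_sq_of_sq_eq_one {n : ℕ} (hn : n ≠ 0) (h4 : 4 ∣ n) (g : Multiplicative (ZMod n))
    (hg : g ^ 2 = 1) : ∃ y, y ^ 2 = g := by
  obtain ⟨m, rfl⟩ := h4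
  have : NeZero (4 * m) := ⟨hn⟩
  have h1 : (2 : ℕ) • g.toAdd = 0 := by rw [← toAdd_pow, hg]; rfl
  have h2 : ((2 * g.toAdd.val : ℕ) : ZMod (4 * m)) = 0 := by
    rw [Nat.cast_mul, ZMod.natCast_val, ZMod.cast_id', id, Nat.cast_ofNat]
    simpa [two_mul, two_nsmul] using h1
  rw [ZMod.natCast_eq_zero_iff] at h2
  obtain ⟨c, hc⟩ := h2
  refine ⟨Multiplicative.ofAdd ((m * c : ℕ) : ZMod (4 * m)), ?_⟩
  have h3 : g.toAdd = ((2 * (m * c) : ℕ) : ZMod (4 * m)) := by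
    have h5 : g.toAdd.val = 2 * (m * c) := by linarith
    rw [← h5, ZMod.natCast_val, ZMod.cast_id', id]
  apply Multiplicative.toAdd.injective
  rw [toAdd_pow, h3]
  simp

theorem exists_even_cyclic_decomp_units (n : ℕ) : n ≠ 0 →
    ∃ (ι : Type) (_ : Fintype ι) (e : ι → ℕ), (∀ i, e i ≠ 0) ∧ (∀ i, 2 ∣ e i) ∧
      Nonempty ((ZMod n)ˣ ≃* CyclicProd e) ∧
      ∀ q, 4 ≤ q → 2 ∣ q → ((∀ i, q ∣ e i) ↔ UnitsDvd q n) := by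
  induction n using Nat.recOnPosPrimePosCoprime with
  | prime_pow p k hp hk =>
    intro _
    rcases eq_or_ne p 2 with rfl | hp2
    · rcases Nat.lt_or_ge k 2 with hk2 | hk2
      · obtain rfl : k = 1 := by omega
        refine ⟨Empty, inferInstance, fun i => i.elim, fun i => i.elim, fun i => i.elim,
          ⟨?_⟩, fun q _ _ => ?_⟩
        · haveI : Subsingleton (ZMod (2 ^ 1))ˣ := by
            rw [pow_one]; infer_instance
          haveI : Unique (ZMod (2 ^ 1))ˣ := ⟨⟨1⟩, fun _ => Subsingleton.elim _ _⟩
          exact MulEquiv.ofUnique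
        · refine iff_of_true (fun i => i.elim) ⟨by norm_num, fun p hp hp2 hd => ?_⟩
          rw [pow_one, Nat.prime_dvd_prime_iff_eq hp Nat.prime_two] at hd
          exact absurd hd hp2
      · obtain ⟨ι, hι, e, he, ⟨f⟩⟩ := CommGroup.equiv_prod_multiplicative_zmod_of_finite
          (ZMod (2 ^ k))ˣ
        have hcard : ∏ i, e i = 2 ^ (k - 1) := by
          have h1 := Nat.card_congr f.toEquiv
          rw [Nat.card_pi] at h1
          have h2 : Nat.card (ZMod (2 ^ k))ˣ = 2 ^ (k - 1) := by
            rw [Nat.card_eq_fintype_card, ZMod.card_units_eq_totient,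
              Nat.totient_prime_pow Nat.prime_two hk]
            simp
          rw [← h2, h1]
          refine Finset.prod_congr rfl fun i _ => ?_
          rw [Nat.card_congr Multiplicative.toAdd, Nat.card_zmod]
        have hpow : ∀ i, ∃ j, 1 ≤ j ∧ e i = 2 ^ j := by
          intro i
          have h1 : e i ∣ 2 ^ (k - 1) := hcard ▸ Finset.dvd_prod_of_mem e (Finset.mem_univ i)
          obtain ⟨j, _, hj⟩ := (Nat.dvd_prime_pow Nat.prime_two).mp h1
          refine ⟨j, Nat.one_le_iff_ne_zero.mpr ?_, hj⟩
          rintro rfl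
          have := he i
          rw [hj] at this
          omega
        have hne : Nonempty ι := by
          by_contra hc
          rw [not_nonempty_iff] at hc
          rw [Finset.univ_eq_empty, Finset.prod_empty] at hcard
          have : 2 ^ 1 ≤ 2 ^ (k - 1) := Nat.pow_le_pow_right two_pos (by omega)
          omega
        refine ⟨ι, hι, e, fun i => by have := he i; omega, fun i => ?_, ⟨f⟩, fun q hq hq2 => ?_⟩
        · obtain ⟨j, hj, hej⟩ := hpow i
          rw [hej]; exact dvd_pow_self 2 (by omega)
        · refine iff_of_false (fun h => ?_) fun h => h.1 (pow_dvd_pow 2 hk2)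
          have h4 : 4 ∣ q := by
            obtain ⟨j, hj, hej⟩ := hpow hne.some
            obtain ⟨s, _, rfl⟩ := (Nat.dvd_prime_pow Nat.prime_two).mp (hej ▸ h hne.some)
            refine pow_dvd_pow 2 (show 2 ≤ s from ?_)
            by_contra! hs
            have : 2 ^ s ≤ 2 ^ 1 := Nat.pow_le_pow_right two_pos (by omega)
            omega
          have hsq : ∀ i, ∃ y, y ^ 2 = f (-1) i := by
            intro i
            refine exists_sq_of_sq_eq_one (by have := he i; omega) (h4.trans (h i)) _ ?_
            rw [← Pi.pow_apply, ← map_pow]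
            simp
          choose y hy using hsq
          refine neg_one_not_square_two_pow hk2 (f.symm y) ?_
          rw [← map_pow, MulEquiv.symm_apply_eq]
          exact funext hy
    · refine ⟨Unit, inferInstance, fun _ => (p ^ k).totient, fun _ => ?_, fun _ => ?_, ⟨?_⟩,
        fun q _ _ => ?_⟩
      · exact (Nat.totient_pos.mpr (pow_pos hp.pos k)).ne'
      · refine (Nat.totient_even ?_).two_dvd
        exact (lt_of_le_of_ne hp.two_le hp2.symm).trans_le (Nat.le_self_pow hk.ne' p)
      · have hc := ZMod.isCyclic_units_of_prime_pow p hp hp2 k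
        have : NeZero (p ^ k) := ⟨(pow_pos hp.pos k).ne'⟩
        have hcard : Nat.card (ZMod (p ^ k))ˣ = (p ^ k).totient := by
          rw [Nat.card_eq_fintype_card, ZMod.card_units_eq_totient]
        refine MulEquiv.trans (hcard ▸ (zmodCyclicMulEquiv hc).symm) ?_
        exact (MulEquiv.piUnique (fun _ : Unit => Multiplicative (ZMod (p ^ k).totient))).symm
      · constructor
        · refine fun h => ⟨fun h4 => ?_, fun r hr hr2 hd => ?_⟩
          · have : 2 ∣ p ^ k := (by norm_num : 2 ∣ 4).trans h4
            have := Nat.prime_two.dvd_of_dvd_pow this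
            exact hp2 ((Nat.prime_dvd_prime_iff_eq Nat.prime_two hp).mp this).symm
          · obtain rfl := (Nat.prime_dvd_prime_iff_eq hr hp).mp (hr.dvd_of_dvd_pow hd)
            rw [hp.factorization_pow, Finsupp.single_eq_same]
            exact h ()
        · intro h _
          have := h.2 p hp hp2 (dvd_pow_self p hk.ne')
          rwa [hp.factorization_pow, Finsupp.single_eq_same] at this
  | zero => exact fun h => absurd rfl h
  | one =>
    refine fun _ => ⟨Empty, inferInstance, fun i => i.elim, fun i => i.elim, fun i => i.elim,
      ⟨?_⟩, fun q _ _ => ?_⟩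
    · haveI : Unique (ZMod 1)ˣ := ⟨⟨1⟩, fun _ => Subsingleton.elim _ _⟩
      exact MulEquiv.ofUnique
    · refine iff_of_true (fun i => i.elim) ⟨by norm_num, fun p hp _ hd => ?_⟩
      exact absurd (Nat.dvd_one.mp hd) hp.ne_one
  | coprime a b ha hb hab iha ihb =>
    intro _
    obtain ⟨ι, _, e, he, he2, ⟨f⟩, hf⟩ := iha (by omega)
    obtain ⟨κ, _, d, hd, hd2, ⟨g⟩, hg⟩ := ihb (by omega)
    refine ⟨ι ⊕ κ, inferInstance, Sum.elim e d, by simp [he, hd], by simp [he2, hd2], ⟨?_⟩,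
      fun q h1 h2 => ?_⟩
    · refine ((Units.mapEquiv (ZMod.chineseRemainder hab).toMulEquiv).trans
        MulEquiv.prodUnits).trans ((f.prodCongr g).trans ?_)
      exact MulEquiv.symm
        { toEquiv := Equiv.sumPiEquivProdPi (fun i => Multiplicative (ZMod (Sum.elim e d i)))
          map_mul' := fun _ _ => rfl }
    · rw [unitsDvd_mul hab, ← hf q h1 h2, ← hg q h1 h2]
      simp

/-- Divisibility of the least invariant factor of `(ℤ/nℤ)ˣ` by an even `q ≥ 4`. -/
theorem dvd_lambda1_iff {n q : ℕ} (hn : 3 ≤ n) (hq : 4 ≤ q) (hq2 : 2 ∣ q) :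
    q ∣ lambda1 n ↔ UnitsDvd q n := by
  obtain ⟨ι, _, e, he, he2, ⟨f⟩, h⟩ := exists_even_cyclic_decomp_units n (by omega)
  have hne : Nonempty ι := by
    by_contra hc
    rw [not_nonempty_iff] at hc
    have h1 : (1 : (ZMod n)ˣ) = -1 := f.injective (Subsingleton.elim _ _)
    have h2 := congrArg Units.val h1
    have : Fact (2 < n) := ⟨by omega⟩
    exact ZMod.neg_one_ne_one (by simpa using h2.symm)
  rw [lambda1, if_neg (by omega), dvd_leastInvFactor_iff he he2 f, h q hq hq2]

/-- `λ₁(n) = q` exactly when `q ∣ λ₁(n)` but `q ℓ ∤ λ₁(n)` for every prime `ℓ`. -/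
theorem lambda1_eq_iff {n q : ℕ} (hn : 3 ≤ n) (hq : 4 ≤ q) (hq2 : 2 ∣ q) :
    lambda1 n = q ↔ UnitsDvd q n ∧ ∀ l : ℕ, l.Prime → ¬ UnitsDvd (q * l) n := by
  rw [← dvd_lambda1_iff hn hq hq2]
  have hl : ∀ l : ℕ, l.Prime → (UnitsDvd (q * l) n ↔ q * l ∣ lambda1 n) := fun l hl =>
    (dvd_lambda1_iff hn (by nlinarith [hl.two_le]) (hq2.mul_right l)).symm
  constructor
  · refine fun h => ⟨h ▸ dvd_rfl, fun l hlp => ?_⟩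
    rw [hl l hlp, h]
    intro hd
    have := Nat.le_of_dvd (by omega) hd
    nlinarith [hlp.two_le]
  · rintro ⟨⟨c, hc⟩, h2⟩
    rcases eq_or_ne c 1 with rfl | hc1
    · simpa using hc
    · obtain ⟨l, hlp, hd⟩ := Nat.exists_prime_and_dvd hc1
      exact absurd ((hl l hlp).mpr (hc ▸ mul_dvd_mul_left q hd)) (h2 l hlp)

end

noncomputable section

/-- The integers `d` with `UnitsDvd q d` without prime factor congruent to `1` modulo `q`. -/
def unitsCore (q : ℕ) : Set ℕ :=
  {d | UnitsDvd q d ∧ ∀ p : ℕ, p.Prime → p ∣ d → (p : ZMod q) ≠ 1}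

theorem natCast_eq_one_iff_dvd {p q : ℕ} (hp : 1 ≤ p) : (p : ZMod q) = 1 ↔ q ∣ p - 1 := by
  rw [← ZMod.natCast_eq_zero_iff, Nat.cast_sub hp, sub_eq_zero, Nat.cast_one]

theorem UnitsDvd.ne_zero {q n : ℕ} (h : UnitsDvd q n) : n ≠ 0 := by
  rintro rfl
  exact h.1 (dvd_zero 4)

theorem two_ne_one_zmod {q : ℕ} (hq : 2 ≤ q) : ((2 : ℕ) : ZMod q) ≠ 1 := by
  rw [Ne, natCast_eq_one_iff_dvd one_le_two]
  intro h
  have := Nat.le_of_dvd (by norm_num) h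
  omega

theorem PrimesOneMod.unitsDvd {q m : ℕ} (hq : 2 ≤ q) (h : PrimesOneMod q m) : UnitsDvd q m := by
  refine ⟨fun h4 => two_ne_one_zmod hq (h.2 2 Nat.prime_two ((by norm_num : 2 ∣ 4).trans h4)),
    fun p hp _ hd => ?_⟩
  rw [Nat.totient_prime_pow hp (hp.factorization_pos_of_dvd h.1 hd)]
  exact ((natCast_eq_one_iff_dvd hp.one_le).mp (h.2 p hp hd)).mul_left _

theorem coprime_of_primesOneMod {q d m : ℕ} (hd : ∀ p : ℕ, p.Prime → p ∣ d → (p : ZMod q) ≠ 1)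
    (hm : PrimesOneMod q m) : d.Coprime m :=
  Nat.Coprime.symm <| Nat.coprime_of_dvd fun p hp h1 h2 => hd p hp h2 (hm.2 p hp h1)

theorem exists_core_mul (q n : ℕ) : n ≠ 0 → ∃ d m : ℕ, n = d * m ∧ PrimesOneMod q m ∧
    ∀ p : ℕ, p.Prime → p ∣ d → (p : ZMod q) ≠ 1 := by
  induction n using Nat.recOnMul with
  | zero => exact fun h => absurd rfl h
  | one => exact fun _ => ⟨1, 1, rfl, PrimesOneMod.one q,
      fun p hp hd => absurd (Nat.dvd_one.mp hd) hp.ne_one⟩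
  | prime p hp =>
    intro _
    by_cases h : (p : ZMod q) = 1
    · exact ⟨1, p, (one_mul p).symm, (primesOneMod_prime hp).mpr h,
        fun p hp hd => absurd (Nat.dvd_one.mp hd) hp.ne_one⟩
    · refine ⟨p, 1, (mul_one p).symm, PrimesOneMod.one q, fun r hr hd => ?_⟩
      rwa [(Nat.prime_dvd_prime_iff_eq hr hp).mp hd]
  | mul a b iha ihb =>
    intro h
    obtain ⟨d, m, rfl, hm, hd⟩ := iha (left_ne_zero_of_mul h)
    obtain ⟨d', m', rfl, hm', hd'⟩ := ihb (right_ne_zero_of_mul h)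
    refine ⟨d * d', m * m', by ring, primesOneMod_mul.mpr ⟨hm, hm'⟩, fun p hp hdd => ?_⟩
    exact (hp.dvd_mul.mp hdd).elim (hd p hp) (hd' p hp)

theorem unitsDvd_iff_exists {q n : ℕ} (hq : 2 ≤ q) :
    UnitsDvd q n ↔ ∃ d m : ℕ, n = d * m ∧ d ∈ unitsCore q ∧ PrimesOneMod q m := by
  constructor
  · intro h
    obtain ⟨d, m, rfl, hm, hd⟩ := exists_core_mul q n h.ne_zero
    have := (unitsDvd_mul (coprime_of_primesOneMod hd hm)).mp h
    exact ⟨d, m, rfl, ⟨this.1, hd⟩, hm⟩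
  · rintro ⟨d, m, rfl, hd, hm⟩
    exact (unitsDvd_mul (coprime_of_primesOneMod hd.2 hm)).mpr ⟨hd.1, hm.unitsDvd hq⟩

theorem core_mul_injective {q d m d' m' : ℕ} (hd : d ∈ unitsCore q) (hd' : d' ∈ unitsCore q)
    (hm : PrimesOneMod q m) (hm' : PrimesOneMod q m') (h : d * m = d' * m') :
    d = d' ∧ m = m' := by
  have h1 : d ∣ d' := (coprime_of_primesOneMod hd.2 hm').dvd_of_dvd_mul_right (h ▸ dvd_mul_right d m)
  have h2 : d' ∣ d := (coprime_of_primesOneMod hd'.2 hm).dvd_of_dvd_mul_right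
    (h ▸ dvd_mul_right d' m')
  obtain rfl := Nat.dvd_antisymm h1 h2
  exact ⟨rfl, Nat.eq_of_mul_eq_mul_left (Nat.pos_of_ne_zero hd.1.ne_zero) h⟩

open scoped Classical in
/-- The number of positive integers `n ≤ x` with `UnitsDvd q n`. -/
def unitsCount (q : ℕ) (x : ℝ) : ℕ := ((Finset.Icc 1 ⌊x⌋₊).filter (UnitsDvd q)).card

theorem oneModCount_eq_card (q : ℕ) (u : ℝ) [DecidablePred (PrimesOneMod q)] :
    oneModCount q u = (((Finset.Icc 1 ⌊u⌋₊).filter (PrimesOneMod q)).card : ℝ) := by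
  simp only [oneModCount, oneModInd, Finset.card_filter, Nat.cast_sum, Nat.cast_ite, Nat.cast_one,
    Nat.cast_zero]
  refine Finset.sum_congr rfl fun n _ => ?_
  split_ifs <;> rfl

open scoped Classical in
theorem unitsCount_eq_sum {q : ℕ} (hq : 2 ≤ q) (x : ℝ) :
    (unitsCount q x : ℝ) =
      ∑ d ∈ (Finset.Icc 1 ⌊x⌋₊).filter (· ∈ unitsCore q), oneModCount q (x / d) := by
  simp only [oneModCount_eq_card, Nat.floor_div_natCast]
  rw [← Nat.cast_sum, ← Finset.card_sigma, unitsCount, Nat.cast_inj]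
  symm
  refine Finset.card_bij (fun a _ => a.1 * a.2) ?_ ?_ ?_
  · rintro ⟨d, m⟩ h
    simp only [Finset.mem_sigma, Finset.mem_filter, Finset.mem_Icc] at h ⊢
    obtain ⟨⟨⟨h1, h2⟩, h3⟩, ⟨h4, h5⟩, h6⟩ := h
    refine ⟨⟨Nat.mul_pos h1 h4, ?_⟩, (unitsDvd_iff_exists hq).mpr ⟨d, m, rfl, h3, h6⟩⟩
    rw [mul_comm]
    exact (Nat.le_div_iff_mul_le h1).mp h5
  · rintro ⟨d, m⟩ h ⟨d', m'⟩ h' he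
    simp only [Finset.mem_sigma, Finset.mem_filter, Finset.mem_Icc] at h h' he
    obtain ⟨rfl, rfl⟩ := core_mul_injective h.1.2 h'.1.2 h.2.2 h'.2.2 he
    rfl
  · intro n hn
    simp only [Finset.mem_filter, Finset.mem_Icc] at hn
    obtain ⟨d, m, rfl, hd, hm⟩ := (unitsDvd_iff_exists hq).mp hn.2
    have hd0 := Nat.pos_of_ne_zero hd.1.ne_zero
    have hm0 := Nat.pos_of_ne_zero hm.1
    refine ⟨⟨d, m⟩, ?_, rfl⟩
    simp only [Finset.mem_sigma, Finset.mem_filter, Finset.mem_Icc]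
    refine ⟨⟨⟨hd0, le_trans (Nat.le_mul_of_pos_right d hm0) hn.1.2⟩, hd⟩, ⟨hm0, ?_⟩, hm⟩
    rw [Nat.le_div_iff_mul_le hd0, mul_comm]
    exact hn.1.2

theorem hasSum_unitsCount {q : ℕ} (hq : 2 ≤ q) (x : ℝ) :
    HasSum (fun d : unitsCore q => oneModCount q (x / (d : ℕ))) (unitsCount q x) := by
  classical
  rw [unitsCount_eq_sum hq, Finset.sum_filter]
  refine (hasSum_subtype_iff_indicator (f := fun d : ℕ => oneModCount q (x / d))).mpr ?_
  have h : ∀ d : ℕ, (if d ∈ unitsCore q then oneModCount q (x / d) else 0) =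
      (unitsCore q).indicator (fun d : ℕ => oneModCount q (x / d)) d := fun d => by
    simp [Set.indicator_apply]
  simp_rw [h]
  refine hasSum_sum_of_ne_finset_zero fun d hd => ?_
  by_cases hdc : d ∈ unitsCore q
  · have hd0 := Nat.pos_of_ne_zero hdc.1.ne_zero
    rw [Set.indicator_of_mem hdc]
    rw [Finset.mem_Icc, not_and, not_le] at hd
    apply oneModCount_eq_zero
    rw [div_lt_one (by exact_mod_cast hd0)]
    exact Nat.lt_of_floor_lt (hd hd0)
  · exact Set.indicator_of_notMem hdc _

/-- `p` is an odd prime factor of `q` with `q / p ^ r ∣ p - 1`, where `p ^ r ∥ q`. -/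
def IsSpecialPrime (q p : ℕ) : Prop :=
  p.Prime ∧ p ≠ 2 ∧ p ∣ q ∧ (q / p ^ (q.factorization p)) ∣ (p - 1)

theorem dvd_totient_iff {q p v : ℕ} (hq : q ≠ 0) (hp : p.Prime) (hp2 : p ≠ 2) (hv : 1 ≤ v)
    (h1 : ¬ q ∣ p - 1) :
    q ∣ (p ^ v).totient ↔ IsSpecialPrime q p ∧ q.factorization p + 1 ≤ v := by
  rw [Nat.totient_prime_pow hp hv]
  have hcop : (p - 1).Coprime p := by
    rw [Nat.coprime_comm, hp.coprime_iff_not_dvd]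
    intro h
    have := Nat.le_of_dvd (Nat.sub_pos_of_lt hp.one_lt) h
    have := hp.one_lt
    omega
  have hfac := Nat.ordProj_mul_ordCompl_eq_self q p
  have hcc : (q / p ^ q.factorization p).Coprime p := (Nat.coprime_ordCompl hp hq).symm
  constructor
  · intro h
    have hpq : p ∣ q := by
      by_contra hc
      have : q.Coprime (p ^ (v - 1)) := ((hp.coprime_iff_not_dvd.mpr hc).symm).pow_right _
      exact h1 (this.dvd_of_dvd_mul_left h)
    have h2 : q / p ^ q.factorization p ∣ p - 1 :=
      (hcc.pow_right (v - 1)).dvd_of_dvd_mul_left ((Nat.ordCompl_dvd q p).trans h)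
    have h3 : p ^ q.factorization p ∣ p ^ (v - 1) :=
      ((hcop.symm).pow_left _).dvd_of_dvd_mul_right ((Nat.ordProj_dvd q p).trans h)
    have := (Nat.pow_dvd_pow_iff_le_right hp.one_lt).mp h3
    exact ⟨⟨hp, hp2, hpq, h2⟩, by omega⟩
  · rintro ⟨h2, h3⟩
    rw [← hfac]
    exact mul_dvd_mul (pow_dvd_pow p (by omega)) h2.2.2.2

theorem IsSpecialPrime.not_dvd {q p : ℕ} (h : IsSpecialPrime q p) : ¬ q ∣ p - 1 := by
  intro hd
  have h1 := Nat.le_of_dvd (Nat.sub_pos_of_lt h.1.one_lt) (h.2.2.1.trans hd)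
  have := h.1.one_lt
  omega

theorem IsSpecialPrime.unique {q p p' : ℕ} (h : IsSpecialPrime q p) (h' : IsSpecialPrime q p') :
    p = p' := by
  have key : ∀ {a b : ℕ}, IsSpecialPrime q a → IsSpecialPrime q b → a ≠ b → b < a := by
    intro a b ha hb hab
    have h1 : b ∣ q / a ^ q.factorization a := by
      have h2 : b ∣ a ^ q.factorization a * (q / a ^ q.factorization a) := by
        rw [Nat.ordProj_mul_ordCompl_eq_self]; exact hb.2.2.1
      refine (hb.1.dvd_mul.mp h2).resolve_left fun h3 => hab ?_
      exact ((Nat.prime_dvd_prime_iff_eq hb.1 ha.1).mp (hb.1.dvd_of_dvd_pow h3)).symm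
    have := Nat.le_of_dvd (Nat.sub_pos_of_lt ha.1.one_lt) (h1.trans ha.2.2.2)
    have := ha.1.one_lt
    omega
  by_contra hc
  exact lt_asymm (key h h' hc) (key h' h (Ne.symm hc))

theorem exists_eq_of_mem_unitsCore {q d : ℕ} (hq : 2 ≤ q) (hd : d ∈ unitsCore q) :
    ∃ a w : ℕ, a < 2 ∧ d = 2 ^ a * w ∧ (∀ p : ℕ, p.Prime → p ∣ w →
      IsSpecialPrime q p ∧ q.factorization p + 1 ≤ w.factorization p) := by
  obtain ⟨a, w, hw, rfl⟩ := Nat.exists_eq_two_pow_mul_odd hd.1.ne_zero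
  have hcop : (2 ^ a).Coprime w := (Nat.coprime_two_left.mpr hw).pow_left a
  have hu := (unitsDvd_mul hcop).mp hd.1
  refine ⟨a, w, ?_, rfl, fun p hp hpw => ?_⟩
  · by_contra! h
    exact hu.1.1 (pow_dvd_pow 2 h)
  · have hp2 : p ≠ 2 := by
      rintro rfl
      exact (Nat.not_even_iff_odd.mpr hw) (even_iff_two_dvd.mpr hpw)
    refine (dvd_totient_iff (by omega) hp hp2 (hp.factorization_pos_of_dvd hu.2.ne_zero hpw)
      ?_).mp (hu.2.2 p hp hp2 hpw)
    rw [← natCast_eq_one_iff_dvd hp.one_le]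
    exact hd.2 p hp (hpw.mul_left _)

theorem one_mem_unitsCore (q : ℕ) : 1 ∈ unitsCore q :=
  ⟨⟨by norm_num, fun _ hp _ hd => absurd (Nat.dvd_one.mp hd) hp.ne_one⟩,
    fun _ hp hd => absurd (Nat.dvd_one.mp hd) hp.ne_one⟩

theorem mul_mem_unitsCore {q a b : ℕ} (h : a.Coprime b) (ha : a ∈ unitsCore q)
    (hb : b ∈ unitsCore q) : a * b ∈ unitsCore q :=
  ⟨(unitsDvd_mul h).mpr ⟨ha.1, hb.1⟩, fun p hp hd => (hp.dvd_mul.mp hd).elim (ha.2 p hp) (hb.2 p hp)⟩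

theorem two_mem_unitsCore {q : ℕ} (hq : 2 ≤ q) : 2 ∈ unitsCore q := by
  refine ⟨⟨by norm_num, fun p hp hp2 hd => ?_⟩, fun p hp hd => ?_⟩
  · exact absurd ((Nat.prime_dvd_prime_iff_eq hp Nat.prime_two).mp hd) hp2
  · rw [(Nat.prime_dvd_prime_iff_eq hp Nat.prime_two).mp hd]
    exact two_ne_one_zmod hq

theorem two_pow_mem_unitsCore {q : ℕ} (hq : 2 ≤ q) (a : Fin 2) : 2 ^ (a : ℕ) ∈ unitsCore q := by
  fin_cases a
  · exact one_mem_unitsCore q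
  · exact two_mem_unitsCore hq

theorem IsSpecialPrime.pow_mem_unitsCore {q p k : ℕ} (hq : q ≠ 0) (h : IsSpecialPrime q p)
    (hk : q.factorization p + 1 ≤ k) : p ^ k ∈ unitsCore q := by
  have hp := h.1
  have hr : ∀ r : ℕ, r.Prime → r ∣ p ^ k → r = p := fun r hr hd =>
    (Nat.prime_dvd_prime_iff_eq hr hp).mp (hr.dvd_of_dvd_pow hd)
  refine ⟨⟨fun h4 => ?_, fun r hr' hr2 hd => ?_⟩, fun r hr' hd => ?_⟩
  · exact h.2.1 (hr 2 Nat.prime_two ((by norm_num : 2 ∣ 4).trans h4)).symm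
  · obtain rfl := hr r hr' hd
    rw [hp.factorization_pow, Finsupp.single_eq_same]
    exact (dvd_totient_iff hq hp hr2 (by omega) h.not_dvd).mpr ⟨h, hk⟩
  · obtain rfl := hr r hr' hd
    rw [Ne, natCast_eq_one_iff_dvd hp.one_le]
    exact h.not_dvd

/-- The element of `unitsCore q` with index `(a, j)`, for a special prime `p` of `q`. -/
def coreParam (q p : ℕ) (i : Fin 2 × ℕ) : ℕ :=
  2 ^ (i.1 : ℕ) * if i.2 = 0 then 1 else p ^ (q.factorization p + i.2)

theorem IsSpecialPrime.coreParam_injective {q p : ℕ} (h : IsSpecialPrime q p) :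
    Function.Injective (coreParam q p) := by
  have hodd : ∀ j : ℕ, Odd (if j = 0 then 1 else p ^ (q.factorization p + j)) := by
    intro j
    split_ifs
    · exact odd_one
    · exact (h.1.odd_of_ne_two h.2.1).pow
  have hp1 := h.1.one_lt
  rintro ⟨a, j⟩ ⟨a', j'⟩ he
  simp only [coreParam] at he
  have haa : a = a' := by
    have h1 := hodd j
    have h2 := hodd j'
    generalize (if j = 0 then 1 else p ^ (q.factorization p + j)) = w at he h1
    generalize (if j' = 0 then 1 else p ^ (q.factorization p + j')) = w' at he h2
    obtain ⟨s, rfl⟩ := h1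
    obtain ⟨t, rfl⟩ := h2
    fin_cases a <;> fin_cases a' <;> simp_all <;> omega
  subst haa
  have hw := Nat.eq_of_mul_eq_mul_left (pow_pos two_pos (a : ℕ)) he
  have hlt : ∀ i : ℕ, i ≠ 0 → 1 < p ^ (q.factorization p + i) := fun i hi =>
    Nat.one_lt_pow (by omega) hp1
  have : j = j' := by
    split_ifs at hw with h1 h2 h2
    · rw [h1, h2]
    · exact absurd hw (hlt _ h2).ne
    · exact absurd hw (hlt _ h1).ne'
    · have := Nat.pow_right_injective hp1 hw
      omega
  rw [this]

theorem IsSpecialPrime.range_coreParam {q p : ℕ} (hq : 2 ≤ q) (h : IsSpecialPrime q p) :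
    Set.range (coreParam q p) = unitsCore q := by
  have hodd := h.1.odd_of_ne_two h.2.1
  ext d
  constructor
  · rintro ⟨⟨a, j⟩, rfl⟩
    rw [coreParam]
    split_ifs with hj
    · simpa using two_pow_mem_unitsCore hq a
    · refine mul_mem_unitsCore ?_ (two_pow_mem_unitsCore hq a)
        (h.pow_mem_unitsCore (by omega) (by dsimp only at hj ⊢; omega))
      exact ((Nat.coprime_two_left.mpr hodd).pow_left _).pow_right _
  · intro hd
    obtain ⟨a, w, ha, rfl, hw⟩ := exists_eq_of_mem_unitsCore hq hd
    have hw0 : w ≠ 0 := right_ne_zero_of_mul hd.1.ne_zero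
    have hwp := Nat.eq_prime_pow_of_unique_prime_dvd (p := p) hw0
      fun hr hrd => (hw _ hr hrd).1.unique h
    rcases eq_or_ne w 1 with rfl | hw1
    · exact ⟨(⟨a, ha⟩, 0), by simp [coreParam]⟩
    · have hpw : p ∣ w := by
        obtain ⟨r, hr, hrd⟩ := Nat.exists_prime_and_dvd hw1
        rwa [(hw r hr hrd).1.unique h] at hrd
      have hk := (hw p h.1 hpw).2
      refine ⟨(⟨a, ha⟩, w.factorization p - q.factorization p), ?_⟩
      have hfac : w.factorization p = w.primeFactorsList.length := by
        conv_lhs => rw [hwp, h.1.factorization_pow, Finsupp.single_eq_same]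
      rw [coreParam, if_neg (by dsimp only; omega)]
      dsimp only
      rw [Nat.add_sub_cancel' (by omega), hfac, ← hwp]

theorem unitsCore_eq_of_not_special {q : ℕ} (hq : 2 ≤ q) (h : ¬ ∃ p, IsSpecialPrime q p) :
    Set.range (fun a : Fin 2 => 2 ^ (a : ℕ)) = unitsCore q := by
  ext d
  constructor
  · rintro ⟨a, rfl⟩
    exact two_pow_mem_unitsCore hq a
  · intro hd
    obtain ⟨a, w, ha, rfl, hw⟩ := exists_eq_of_mem_unitsCore hq hd
    rcases eq_or_ne w 1 with rfl | hw1
    · exact ⟨⟨a, ha⟩, by simp⟩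
    · obtain ⟨r, hr, hrd⟩ := Nat.exists_prime_and_dvd hw1
      exact absurd ⟨r, (hw r hr hrd).1⟩ h

end

noncomputable section

theorem hasSum_geometric_skip {y : ℝ} (hy0 : 0 ≤ y) (hy1 : y < 1) (r : ℕ) :
    HasSum (fun j : ℕ => if j = 0 then 1 else y ^ (r + j)) (1 + y ^ (r + 1) / (1 - y)) := by
  have h := (hasSum_geometric_of_lt_one hy0 hy1).mul_left (y ^ (r + 1))
  have h2 : HasSum (fun j : ℕ => if j + 1 = 0 then (1 : ℝ) else y ^ (r + (j + 1)))
      (y ^ (r + 1) / (1 - y)) := by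
    rw [div_eq_mul_inv]
    have e : (fun j : ℕ => if j + 1 = 0 then (1 : ℝ) else y ^ (r + (j + 1))) =
        fun j => y ^ (r + 1) * y ^ j := by
      funext j
      rw [if_neg (by omega)]
      ring
    rw [e]
    exact h
  have h3 := (hasSum_nat_add_iff (f := fun j : ℕ => if j = 0 then (1 : ℝ) else y ^ (r + j)) 1).mp h2
  rw [add_comm]
  simpa using h3

theorem hasSum_fin_two_pow (v : ℝ) : HasSum (fun a : Fin 2 => v ^ (a : ℕ)) (1 + v) := by
  simpa using hasSum_fintype (fun a : Fin 2 => v ^ (a : ℕ))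

theorem hasSum_coreParam {q p : ℕ} (h : IsSpecialPrime q p) {s : ℝ} (hs : 0 < s) :
    HasSum (fun i => (coreParam q p i : ℝ) ^ (-s)) ((1 + (2 : ℝ) ^ (-s)) *
      (1 + ((p : ℝ) ^ (-s)) ^ (q.factorization p + 1) / (1 - (p : ℝ) ^ (-s)))) := by
  have hp1 : (1 : ℝ) < p := by exact_mod_cast h.1.one_lt
  have hy0 : 0 ≤ (p : ℝ) ^ (-s) := by positivity
  have hy1 : (p : ℝ) ^ (-s) < 1 := Real.rpow_lt_one_of_one_lt_of_neg hp1 (by linarith)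
  have h1 := hasSum_fin_two_pow ((2 : ℝ) ^ (-s))
  have h2 := hasSum_geometric_skip hy0 hy1 (q.factorization p)
  have h3 := h1.mul h2 (h1.summable.mul_of_nonneg h2.summable (fun _ => by positivity)
    (fun j => by dsimp only; split_ifs <;> positivity))
  have e : (fun i => (coreParam q p i : ℝ) ^ (-s)) = fun i : Fin 2 × ℕ =>
      ((2 : ℝ) ^ (-s)) ^ (i.1 : ℕ) *
        if i.2 = 0 then 1 else ((p : ℝ) ^ (-s)) ^ (q.factorization p + i.2) := by
    funext i
    rw [coreParam, Nat.cast_mul, Real.mul_rpow (by positivity) (by positivity), Nat.cast_pow,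
      ← Real.rpow_natCast, ← Real.rpow_natCast, ← Real.rpow_mul (by positivity),
      ← Real.rpow_mul (by positivity), mul_comm (-s)]
    congr 1
    split_ifs
    · simp
    · rw [Nat.cast_pow, ← Real.rpow_natCast, ← Real.rpow_natCast, ← Real.rpow_mul (by positivity),
        ← Real.rpow_mul (by positivity), mul_comm (-s)]
  rw [e]
  exact h3

theorem hasSum_unitsCore_of_special {q p : ℕ} (hq : 2 ≤ q) (h : IsSpecialPrime q p) {s : ℝ}
    (hs : 0 < s) :
    HasSum (fun d : unitsCore q => ((d : ℕ) : ℝ) ^ (-s)) ((1 + (2 : ℝ) ^ (-s)) *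
      (1 + ((p : ℝ) ^ (-s)) ^ (q.factorization p + 1) / (1 - (p : ℝ) ^ (-s)))) := by
  rw [← h.range_coreParam hq]
  exact (h.coreParam_injective.hasSum_range_iff (f := fun d : ℕ => (d : ℝ) ^ (-s))).mpr
    (hasSum_coreParam h hs)

theorem hasSum_unitsCore_of_not_special {q : ℕ} (hq : 2 ≤ q) (h : ¬ ∃ p, IsSpecialPrime q p)
    {s : ℝ} : HasSum (fun d : unitsCore q => ((d : ℕ) : ℝ) ^ (-s)) (1 + (2 : ℝ) ^ (-s)) := by
  rw [← unitsCore_eq_of_not_special hq h]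
  have hinj : Function.Injective (fun a : Fin 2 => 2 ^ (a : ℕ)) := fun a b hab =>
    Fin.ext (Nat.pow_right_injective le_rfl hab)
  refine (hinj.hasSum_range_iff (f := fun d : ℕ => (d : ℝ) ^ (-s))).mpr ?_
  have e : (fun d : ℕ => (d : ℝ) ^ (-s)) ∘ (fun a : Fin 2 => 2 ^ (a : ℕ)) =
      fun a : Fin 2 => ((2 : ℝ) ^ (-s)) ^ (a : ℕ) := by
    funext a
    simp only [Function.comp_apply, Nat.cast_pow, Nat.cast_ofNat]
    rw [← Real.rpow_natCast, ← Real.rpow_natCast, ← Real.rpow_mul (by positivity),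
      ← Real.rpow_mul (by positivity), mul_comm (-s)]
  rw [e]
  exact hasSum_fin_two_pow _

theorem summable_unitsCore {q : ℕ} (hq : 2 ≤ q) {s : ℝ} (hs : 0 < s) :
    Summable (fun d : unitsCore q => ((d : ℕ) : ℝ) ^ (-s)) := by
  by_cases h : ∃ p, IsSpecialPrime q p
  · obtain ⟨p, hp⟩ := h
    exact (hasSum_unitsCore_of_special hq hp hs).summable
  · exact (hasSum_unitsCore_of_not_special hq h).summable

theorem exists_hasSum_inv_unitsCore {q : ℕ} (hq : 2 ≤ q) :
    ∃ c, HasSum (fun d : unitsCore q => (((d : ℕ) : ℝ))⁻¹) c ∧ Hq q = Gq q * c := by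
  simp_rw [← Real.rpow_neg_one]
  by_cases h : ∃ p, IsSpecialPrime q p
  · have hp : IsSpecialPrime q h.choose := h.choose_spec
    refine ⟨_, hasSum_unitsCore_of_special hq hp one_pos, ?_⟩
    have hHq : Hq q = 3 * Gq q / 2 *
      (1 + 1 / ((h.choose : ℝ) ^ (q.factorization h.choose) * ((h.choose : ℝ) - 1))) := dif_pos h
    rw [hHq]
    have hp1 : (1 : ℝ) < h.choose := by exact_mod_cast hp.1.one_lt
    generalize (h.choose : ℝ) = P at hp1
    generalize q.factorization h.choose = r
    have : P - 1 ≠ 0 := by linarith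
    have : P ≠ 0 := by linarith
    simp only [Real.rpow_neg_one]
    have e : (P⁻¹) ^ (r + 1) / (1 - P⁻¹) = 1 / (P ^ r * (P - 1)) := by
      have : 1 - P⁻¹ = (P - 1) / P := by field_simp
      rw [this, inv_pow, pow_succ]
      field_simp
    rw [e]
    ring
  · refine ⟨_, hasSum_unitsCore_of_not_special hq h, ?_⟩
    have hHq : Hq q = 3 * Gq q / 2 := dif_neg h
    rw [hHq, Real.rpow_neg_one]
    ring

theorem two_le_totient {q : ℕ} (hq : 3 ≤ q) : 2 ≤ q.totient := by
  have h1 := Nat.totient_even (show 2 < q by omega)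
  have h2 := Nat.totient_pos.mpr (show 0 < q by omega)
  obtain ⟨k, hk⟩ := h1
  omega

theorem exists_abs_unitsCount_sub_le {q : ℕ} (hq : 3 ≤ q) :
    ∃ K > 0, ∀ x : ℝ, 2 ≤ Real.log x → 0 < x →
      |(unitsCount q x : ℝ) - Hq q * x * Real.log x ^ (1 / q.totient - 1 : ℝ)| ≤
        K * x * Real.log x ^ (1 / q.totient / 2 - 1 : ℝ) := by
  have : NeZero q := ⟨by omega⟩
  obtain ⟨K, hK, h⟩ := exists_abs_oneModCount_div_sub_le q (two_le_totient hq)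
  obtain ⟨c, hc, hH⟩ := exists_hasSum_inv_unitsCore (q := q) (by omega)
  obtain ⟨b, hb⟩ := summable_unitsCore (q := q) (by omega) (show (0 : ℝ) < 3 / 4 by norm_num)
  have hb0 : 0 ≤ b := hb.nonneg fun d => by positivity
  refine ⟨K * (b + 1), by positivity, fun x hL hx => ?_⟩
  have h1 := hasSum_unitsCount (q := q) (by omega) x
  have h2 := hc.mul_left (Gq q * x * Real.log x ^ (1 / q.totient - 1 : ℝ))
  have h3 := h1.sub h2
  have h4 := hb.mul_left (K * x * Real.log x ^ (1 / q.totient / 2 - 1 : ℝ))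
  have h5 := h3.norm_le_of_bounded h4 fun d => by
    have hd : (1 : ℝ) ≤ (d : ℕ) := by
      exact_mod_cast Nat.one_le_iff_ne_zero.mpr d.2.1.ne_zero
    have := h x hL hx _ hd
    rw [Real.norm_eq_abs]
    refine le_trans (le_of_eq ?_) (this.trans (le_of_eq ?_))
    · congr 1; ring
    · ring
  rw [Real.norm_eq_abs] at h5
  rw [hH]
  have h6 : 0 ≤ Real.log x ^ (1 / q.totient / 2 - 1 : ℝ) := Real.rpow_nonneg (by linarith) _
  calc _ = |(unitsCount q x : ℝ) - Gq q * x * Real.log x ^ (1 / q.totient - 1 : ℝ) * c| := by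
        congr 1; ring
    _ ≤ _ := h5
    _ ≤ K * x * Real.log x ^ (1 / q.totient / 2 - 1 : ℝ) * (b + 1) := by gcongr; linarith
    _ = _ := by ring

end

/-! ### An upper bound of Chebyshev type in the residue class `1` modulo a prime -/

noncomputable section

open ArithmeticFunction (vonMangoldt)
open scoped ArithmeticFunction.vonMangoldt

/-- The von Mangoldt sum over the integers `n ≤ N` congruent to `1` modulo `l`. -/
def psiOne (l N : ℕ) : ℝ := ∑ n ∈ (Finset.Icc 1 N).filter (fun n : ℕ => (n : ZMod l) = 1), Λ n

lemma sum_log_eq_sum_vonMangoldt {N M : ℕ} (f : ℕ → ℕ) (hf : ∀ j < N, 0 < f j ∧ f j ≤ M) :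
    ∑ j ∈ Finset.range N, Real.log (f j) =
      ∑ d ∈ Finset.Icc 1 M, Λ d * (((Finset.range N).filter (fun j => d ∣ f j)).card : ℝ) := by
  have h1 : ∀ j ∈ Finset.range N, Real.log (f j) =
      ∑ d ∈ Finset.Icc 1 M, if d ∣ f j then Λ d else 0 := by
    intro j hj
    obtain ⟨h0, hM⟩ := hf j (Finset.mem_range.1 hj)
    rw [← ArithmeticFunction.vonMangoldt_sum, ← Finset.sum_filter]
    refine Finset.sum_congr ?_ fun _ _ => rfl
    ext d
    simp only [Nat.mem_divisors, Finset.mem_filter, Finset.mem_Icc]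
    constructor
    · rintro ⟨hd, -⟩
      exact ⟨⟨Nat.pos_of_dvd_of_pos hd h0, (Nat.le_of_dvd h0 hd).trans hM⟩, hd⟩
    · rintro ⟨-, hd⟩
      exact ⟨hd, h0.ne'⟩
  rw [Finset.sum_congr rfl h1, Finset.sum_comm]
  refine Finset.sum_congr rfl fun d _ => ?_
  rw [← Finset.sum_filter, Finset.sum_const, nsmul_eq_mul, mul_comm]

lemma div_le_card_filter_dvd {d l N : ℕ} (hd : 0 < d) (h : Nat.Coprime d l) :
    N / d ≤ ((Finset.range N).filter (fun j => d ∣ (j + 1) * l + 1)).card := by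
  obtain ⟨v, hv⟩ : ∃ v, d ∣ (v + 1) * l + 1 := by
    have : NeZero d := ⟨hd.ne'⟩
    let u := ZMod.unitOfCoprime l h.symm
    refine ⟨(-(((u⁻¹ : (ZMod d)ˣ) : ZMod d)) - 1).val, ?_⟩
    rw [← ZMod.natCast_eq_zero_iff]
    push_cast
    rw [ZMod.natCast_val, ZMod.cast_id', id_eq, sub_add_cancel]
    have : (l : ZMod d) = (u : ZMod d) := (ZMod.coe_unitOfCoprime l h.symm).symm
    rw [this, neg_mul, Units.inv_mul]
    simp
  have h1 := Nat.count_modEq_card N hd v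
  rw [Nat.count_eq_card_filter_range] at h1
  calc N / d ≤ ((Finset.range N).filter (fun j => j ≡ v [MOD d])).card := by omega
    _ ≤ _ := by
      refine Finset.card_le_card fun j hj => ?_
      rw [Finset.mem_filter] at hj ⊢
      refine ⟨hj.1, ?_⟩
      have : (j + 1) * l + 1 ≡ (v + 1) * l + 1 [MOD d] :=
        ((hj.2.add_right 1).mul_right l).add_right 1
      exact (this.dvd_iff dvd_rfl).2 hv

lemma sum_vonMangoldt_multiples_le {l : ℕ} (hl : l.Prime) (N M : ℕ) :
    ∑ d ∈ (Finset.Icc 1 M).filter (fun d => ¬ Nat.Coprime d l), Λ d * ((N / d : ℕ) : ℝ) ≤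
      N * Real.log l := by
  have hlog : 0 ≤ Real.log l := Real.log_natCast_nonneg l
  calc ∑ d ∈ (Finset.Icc 1 M).filter (fun d => ¬ Nat.Coprime d l), Λ d * ((N / d : ℕ) : ℝ)
      ≤ ∑ d ∈ (Finset.Icc 1 M).image (fun i => l ^ i), Λ d * ((N / d : ℕ) : ℝ) := by
        have hs : ∑ d ∈ (Finset.Icc 1 M).filter (fun d => ¬ Nat.Coprime d l),
            Λ d * ((N / d : ℕ) : ℝ) =
            ∑ d ∈ ((Finset.Icc 1 M).filter (fun d => ¬ Nat.Coprime d l)).filter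
              (fun d => IsPrimePow d), Λ d * ((N / d : ℕ) : ℝ) := by
          symm
          refine Finset.sum_filter_of_ne fun d _ h => ?_
          exact ArithmeticFunction.vonMangoldt_ne_zero_iff.1 (left_ne_zero_of_mul h)
        rw [hs]
        refine Finset.sum_le_sum_of_subset_of_nonneg ?_ fun d _ _ =>
          mul_nonneg ArithmeticFunction.vonMangoldt_nonneg (Nat.cast_nonneg _)
        intro d hd
        simp only [Finset.mem_filter, Finset.mem_Icc, Finset.mem_image] at hd ⊢
        obtain ⟨⟨⟨h1, hM⟩, hc⟩, hpow⟩ := hd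
        obtain ⟨p, k, hp, hk, rfl⟩ := (isPrimePow_nat_iff _).1 hpow
        have hpl : p = l := by
          by_contra hne
          exact hc (((Nat.coprime_primes hp hl).2 hne).pow_left k)
        subst hpl
        exact ⟨k, ⟨hk, (Nat.lt_pow_self hp.one_lt).le.trans hM⟩, rfl⟩
    _ = ∑ i ∈ Finset.Icc 1 M, Λ (l ^ i) * ((N / l ^ i : ℕ) : ℝ) :=
        Finset.sum_image fun _ _ _ _ h => Nat.pow_right_injective hl.two_le h
    _ ≤ ∑ i ∈ Finset.Icc 1 M, (N * Real.log l) * (1 / 2 : ℝ) ^ i := by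
        refine Finset.sum_le_sum fun i hi => ?_
        rw [ArithmeticFunction.vonMangoldt_apply_pow (by have := (Finset.mem_Icc.1 hi).1; omega),
          ArithmeticFunction.vonMangoldt_apply_prime hl]
        have h2 : ((N / l ^ i : ℕ) : ℝ) ≤ N * (1 / 2 : ℝ) ^ i := by
          refine Nat.cast_div_le.trans ?_
          push_cast
          rw [div_eq_mul_inv, one_div, inv_pow]
          gcongr
          exact_mod_cast hl.two_le
        calc Real.log l * ((N / l ^ i : ℕ) : ℝ) ≤ Real.log l * (N * (1 / 2 : ℝ) ^ i) := by gcongr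
          _ = _ := by ring
    _ = (N * Real.log l) * ∑ i ∈ Finset.Icc 1 M, (1 / 2 : ℝ) ^ i := by rw [Finset.mul_sum]
    _ ≤ (N * Real.log l) * 1 := by
        gcongr
        have hg : ∀ M : ℕ, ∑ i ∈ Finset.Icc 1 M, (1 / 2 : ℝ) ^ i = 1 - (1 / 2) ^ M := by
          intro M
          induction M with
          | zero => simp
          | succ n ih => rw [Finset.sum_Icc_succ_top (by omega), ih]; ring
        rw [hg]
        have : (0 : ℝ) ≤ (1 / 2) ^ M := by positivity
        linarith
    _ = _ := mul_one _

lemma psiOne_mul_add_one_le {l : ℕ} (hl : l.Prime) (N : ℕ) :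
    psiOne l (N * l + 1) ≤ (Real.log 4 + 4) * N + 3 * (N * Real.log l) := by
  set M := N * l + 1 with hM
  have hl2 : 2 ≤ l := hl.two_le
  have hNM : N ≤ M := by nlinarith
  have hF := sum_log_eq_sum_vonMangoldt (N := N) (M := M) (fun j => (j + 1) * l + 1)
    (fun j hj => ⟨by positivity, by simp only [hM]; gcongr; omega⟩)
  have hG := sum_log_eq_sum_vonMangoldt (N := N) (M := M) (fun j => j + 1)
    (fun j hj => ⟨by positivity, by omega⟩)
  have hll : Real.log (l + 1) ≤ 2 * Real.log l := by
    have h2 : (2 : ℝ) ≤ l := by exact_mod_cast hl2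
    rw [← Real.log_rpow (by positivity)]
    refine Real.log_le_log (by positivity) ?_
    norm_num
    nlinarith
  have hdiff : ∑ j ∈ Finset.range N, Real.log (((j + 1) * l + 1 : ℕ) : ℝ) -
      ∑ j ∈ Finset.range N, Real.log ((j + 1 : ℕ) : ℝ) ≤ N * (2 * Real.log l) := by
    rw [← Finset.sum_sub_distrib]
    calc _ ≤ ∑ j ∈ Finset.range N, 2 * Real.log l := by
          refine Finset.sum_le_sum fun j _ => ?_
          refine le_trans ?_ hll
          rw [← Real.log_div (by positivity) (by positivity)]
          refine Real.log_le_log (by positivity) ?_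
          rw [div_le_iff₀ (by positivity)]
          push_cast
          have : (0 : ℝ) ≤ j := by positivity
          nlinarith
      _ = _ := by simp
  simp only [Nat.card_multiples] at hG
  have hmul := sum_vonMangoldt_multiples_le hl N M
  have hpsi : ∑ d ∈ (Finset.Icc 1 M).filter (fun d => d ≤ N), Λ d ≤ (Real.log 4 + 4) * N := by
    refine le_trans ?_ (Chebyshev.psi_le_const_mul_self (x := N) (by positivity))
    rw [Chebyshev.psi_eq_sum_Icc, Nat.floor_natCast]
    refine Finset.sum_le_sum_of_subset_of_nonneg ?_ fun _ _ _ =>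
      ArithmeticFunction.vonMangoldt_nonneg
    intro d hd
    simp only [Finset.mem_filter, Finset.mem_Icc] at hd ⊢
    omega
  have hkey : psiOne l M + ∑ d ∈ Finset.Icc 1 M, Λ d * ((N / d : ℕ) : ℝ) ≤
      ∑ d ∈ Finset.Icc 1 M,
        Λ d * (((Finset.range N).filter (fun j => d ∣ (j + 1) * l + 1)).card : ℝ) +
      ∑ d ∈ (Finset.Icc 1 M).filter (fun d => d ≤ N), Λ d +
      ∑ d ∈ (Finset.Icc 1 M).filter (fun d => ¬ Nat.Coprime d l), Λ d * ((N / d : ℕ) : ℝ) := by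
    rw [psiOne, Finset.sum_filter, Finset.sum_filter, Finset.sum_filter, ← Finset.sum_add_distrib,
      ← Finset.sum_add_distrib, ← Finset.sum_add_distrib]
    refine Finset.sum_le_sum fun d hd => ?_
    obtain ⟨hd1, hdM⟩ := Finset.mem_Icc.1 hd
    have hΛ : 0 ≤ Λ d := ArithmeticFunction.vonMangoldt_nonneg
    rcases eq_or_ne d 1 with rfl | hd2
    · simp
    set A := ((Finset.range N).filter (fun j => d ∣ (j + 1) * l + 1)).card
    by_cases hc : Nat.Coprime d l
    · have hA : ((N / d : ℕ) : ℝ) ≤ A := by exact_mod_cast div_le_card_filter_dvd hd1 hc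
      have h1 := mul_le_mul_of_nonneg_left hA hΛ
      by_cases hdN : d ≤ N
      · simp only [hdN, if_true]
        split_ifs <;> linarith
      · simp only [hdN, if_false]
        split_ifs with h
        · have hA1 : 1 ≤ A := by
            have : Fact l.Prime := ⟨hl⟩
            have hdl : l ∣ d - 1 := (natCast_eq_one_iff_dvd hd1).1 h
            obtain ⟨k, hk⟩ := hdl
            have hk0 : k ≠ 0 := by
              rintro rfl
              omega
            have hkN : k ≤ N := by
              have : l * k ≤ N * l := by omega
              rw [mul_comm] at this
              exact Nat.le_of_mul_le_mul_right this hl.pos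
            refine Finset.card_pos.2 ⟨k - 1, ?_⟩
            simp only [Finset.mem_filter, Finset.mem_range]
            refine ⟨by omega, ?_⟩
            rw [Nat.sub_add_cancel (by omega)]
            refine dvd_of_eq ?_
            rw [mul_comm]
            omega
          have hA1' : (1 : ℝ) ≤ A := by exact_mod_cast hA1
          have h0 : N / d = 0 := Nat.div_eq_of_lt (by omega)
          rw [h0]
          push_cast
          nlinarith
        · linarith
    · have hne : ¬ ((d : ZMod l) = 1) := by
        intro h
        have hdl : l ∣ d - 1 := (natCast_eq_one_iff_dvd hd1).1 h
        refine hc ?_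
        rw [Nat.coprime_comm, hl.coprime_iff_not_dvd]
        intro hld
        have := (Nat.dvd_sub hld hdl)
        rw [Nat.sub_sub_self hd1] at this
        exact hl.one_lt.ne' (Nat.dvd_one.1 this)
      simp only [hc, hne, if_false, not_false_eq_true, if_true]
      have hA : (0 : ℝ) ≤ Λ d * (A : ℝ) := by positivity
      split_ifs <;> linarith
  rw [hF, hG] at hdiff
  linarith

lemma exists_psiOne_le : ∃ K : ℝ, 1 ≤ K ∧ ∀ l : ℕ, l.Prime → ∀ N : ℕ,
    psiOne l N ≤ K * (Real.log l / l) * N := by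
  have hlog4 : 0 ≤ Real.log 4 := Real.log_nonneg (by norm_num)
  refine ⟨(Real.log 4 + 4) / Real.log 2 + 3, ?_, fun l hl N => ?_⟩
  · have : 0 ≤ (Real.log 4 + 4) / Real.log 2 := by positivity
    linarith
  have hl0 : (0 : ℝ) < l := by exact_mod_cast hl.pos
  have hl2 : Real.log 2 ≤ Real.log l :=
    Real.log_le_log (by norm_num) (by exact_mod_cast hl.two_le)
  have hlog2 : 0 < Real.log 2 := Real.log_pos (by norm_num)
  have h1 : psiOne l N ≤ psiOne l (N / l * l + 1) := by
    refine Finset.sum_le_sum_of_subset_of_nonneg ?_ fun _ _ _ =>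
      ArithmeticFunction.vonMangoldt_nonneg
    intro d hd
    simp only [Finset.mem_filter, Finset.mem_Icc] at hd ⊢
    refine ⟨⟨hd.1.1, ?_⟩, hd.2⟩
    obtain ⟨k, hk⟩ := (natCast_eq_one_iff_dvd hd.1.1).1 hd.2
    have : k ≤ N / l := by
      rw [Nat.le_div_iff_mul_le hl.pos, mul_comm]
      omega
    have := Nat.mul_le_mul_right l this
    rw [mul_comm k] at this
    omega
  refine h1.trans ((psiOne_mul_add_one_le hl _).trans ?_)
  have h2 : ((N / l : ℕ) : ℝ) ≤ N / l := Nat.cast_div_le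
  have h3 : (Real.log 4 + 4) ≤ (Real.log 4 + 4) / Real.log 2 * Real.log l := by
    rw [div_mul_eq_mul_div, le_div_iff₀ hlog2]
    gcongr
  calc (Real.log 4 + 4) * ((N / l : ℕ) : ℝ) + 3 * (((N / l : ℕ) : ℝ) * Real.log l)
      ≤ ((Real.log 4 + 4) / Real.log 2 * Real.log l) * ((N / l : ℕ) : ℝ) +
          3 * (((N / l : ℕ) : ℝ) * Real.log l) := by gcongr
    _ = ((Real.log 4 + 4) / Real.log 2 + 3) * Real.log l * ((N / l : ℕ) : ℝ) := by ring
    _ ≤ ((Real.log 4 + 4) / Real.log 2 + 3) * Real.log l * (N / l) := by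
        have : 0 ≤ Real.log l := by linarith
        gcongr
    _ = _ := by ring

end

/-! ### Reciprocal sums over integers composed of primes congruent to `1` -/

noncomputable section

open ArithmeticFunction (vonMangoldt)
open scoped ArithmeticFunction.vonMangoldt

/-- The primes up to `N` congruent to `1` modulo `l`. -/
def oneModPrimes (l N : ℕ) : Finset ℕ :=
  (Finset.Icc 1 N).filter (fun p : ℕ => p.Prime ∧ (p : ZMod l) = 1)

open scoped Classical in
/-- The integers in `[1, N]` composed of primes congruent to `1` modulo `l`. -/
def oneModFinset (l N : ℕ) : Finset ℕ := (Finset.Icc 1 N).filter (PrimesOneMod l)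

lemma mem_oneModFinset {l N m : ℕ} :
    m ∈ oneModFinset l N ↔ (1 ≤ m ∧ m ≤ N) ∧ PrimesOneMod l m := by
  simp [oneModFinset]

lemma sum_inv_block_le {l : ℕ} {η : ℝ} (h : ∀ n : ℕ, psiOne l n ≤ η * n) {j : ℕ} (hj : 1 ≤ j)
    (N : ℕ) :
    ∑ p ∈ (oneModPrimes l N).filter (fun p => Nat.log 2 p = j), (1 / p : ℝ) ≤
      2 * η / Real.log 2 * (1 / j) := by
  have hlog2 : 0 < Real.log 2 := Real.log_pos (by norm_num)
  have hj0 : (0 : ℝ) < j := by exact_mod_cast hj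
  calc ∑ p ∈ (oneModPrimes l N).filter (fun p => Nat.log 2 p = j), (1 / p : ℝ)
      ≤ ∑ p ∈ (oneModPrimes l N).filter (fun p => Nat.log 2 p = j),
          Λ p * (1 / (2 ^ j * (j * Real.log 2))) := by
        refine Finset.sum_le_sum fun p hp => ?_
        simp only [oneModPrimes, Finset.mem_filter, Finset.mem_Icc] at hp
        obtain ⟨⟨-, hp, -⟩, hpj⟩ := hp
        have h2 : (2 : ℝ) ^ j ≤ p := by
          have := Nat.pow_log_le_self 2 hp.ne_zero
          rw [hpj] at this
          exact_mod_cast this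
        have h3 : j * Real.log 2 ≤ Real.log p := by
          rw [← Real.log_pow]
          exact Real.log_le_log (by positivity) h2
        rw [ArithmeticFunction.vonMangoldt_apply_prime hp, mul_one_div, div_le_div_iff₀
          (by exact_mod_cast hp.pos) (by positivity), one_mul, mul_comm]
        gcongr
    _ = (∑ p ∈ (oneModPrimes l N).filter (fun p => Nat.log 2 p = j), Λ p) *
          (1 / (2 ^ j * (j * Real.log 2))) := by rw [Finset.sum_mul]
    _ ≤ psiOne l (2 ^ (j + 1)) * (1 / (2 ^ j * (j * Real.log 2))) := by
        gcongr
        refine Finset.sum_le_sum_of_subset_of_nonneg ?_ fun _ _ _ =>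
          ArithmeticFunction.vonMangoldt_nonneg
        intro p hp
        simp only [oneModPrimes, Finset.mem_filter, Finset.mem_Icc] at hp ⊢
        refine ⟨⟨hp.1.1.1, ?_⟩, hp.1.2.2⟩
        have := Nat.lt_pow_succ_log_self (b := 2) (by norm_num) p
        rw [hp.2] at this
        exact this.le
    _ ≤ (η * (2 ^ (j + 1) : ℕ)) * (1 / (2 ^ j * (j * Real.log 2))) := by
        gcongr
        exact h _
    _ = _ := by
        push_cast
        field_simp
        ring

lemma sum_inv_oneModPrimes_le {l : ℕ} {η : ℝ} (hη : 0 ≤ η) (h : ∀ n : ℕ, psiOne l n ≤ η * n)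
    {x : ℝ} (hx : 0 < x) (hL : 2 ≤ Real.log x) :
    ∑ p ∈ oneModPrimes l ⌊x⌋₊, (1 / p : ℝ) ≤ 15 * η * Real.log (Real.log x) := by
  set N := ⌊x⌋₊
  have hlog2 : 0.6931471803 < Real.log 2 := Real.log_two_gt_d9
  have hx1 : 1 ≤ x := by
    by_contra hlt
    have := Real.log_nonpos hx.le (by linarith : x ≤ 1)
    linarith
  have hN : (N : ℝ) ≤ x := Nat.floor_le hx.le
  have hN1 : 1 ≤ N := (Nat.one_le_floor_iff x).2 hx1
  set J := Nat.log 2 N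
  calc ∑ p ∈ oneModPrimes l N, (1 / p : ℝ)
      = ∑ j ∈ Finset.Icc 1 J,
          ∑ p ∈ (oneModPrimes l N).filter (fun p => Nat.log 2 p = j), (1 / p : ℝ) := by
        refine (Finset.sum_fiberwise_of_maps_to (fun p hp => ?_) _).symm
        simp only [oneModPrimes, Finset.mem_filter, Finset.mem_Icc] at hp ⊢
        exact ⟨Nat.log_pos (by norm_num) hp.2.1.two_le, Nat.log_mono_right hp.1.2⟩
    _ ≤ ∑ j ∈ Finset.Icc 1 J, 2 * η / Real.log 2 * (1 / j) :=
        Finset.sum_le_sum fun j hj => sum_inv_block_le h (Finset.mem_Icc.1 hj).1 N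
    _ = 2 * η / Real.log 2 * ((harmonic J : ℚ) : ℝ) := by
        rw [← Finset.mul_sum, harmonic_eq_sum_Icc]
        push_cast
        simp only [one_div]
    _ ≤ 2 * η / Real.log 2 * (5 * Real.log (Real.log x)) := by
        gcongr
        refine (harmonic_le_one_add_log J).trans ?_
        have hll : Real.log 2 ≤ Real.log (Real.log x) := Real.log_le_log (by norm_num) hL
        rcases Nat.eq_zero_or_pos J with hJ | hJ
        · rw [hJ]
          simp
          linarith
        have hJ' : (J : ℝ) * Real.log 2 ≤ Real.log x := by
          rw [← Real.log_pow]
          refine Real.log_le_log (by positivity) (le_trans ?_ hN)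
          exact_mod_cast Nat.pow_log_le_self 2 (by omega)
        have hJ0 : (0 : ℝ) < J := by exact_mod_cast hJ
        have h1 : Real.log J + Real.log (Real.log 2) ≤ Real.log (Real.log x) := by
          rw [← Real.log_mul hJ0.ne' (by linarith)]
          exact Real.log_le_log (by positivity) hJ'
        have h2 : -Real.log (Real.log 2) ≤ 1 := by
          have := Real.log_le_sub_one_of_pos (x := (Real.log 2)⁻¹) (by positivity)
          rw [Real.log_inv] at this
          refine this.trans ?_
          have h3 : (Real.log 2)⁻¹ ≤ 2 := by
            rw [inv_le_comm₀ (by positivity) (by norm_num)]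
            linarith
          linarith
        linarith
    _ ≤ _ := by
        have hll : 0 ≤ Real.log (Real.log x) := Real.log_nonneg (by linarith)
        have h3 : 10 / Real.log 2 ≤ 15 := by
          rw [div_le_iff₀ (by positivity)]
          linarith
        calc 2 * η / Real.log 2 * (5 * Real.log (Real.log x))
            = (10 / Real.log 2) * (η * Real.log (Real.log x)) := by ring
          _ ≤ 15 * (η * Real.log (Real.log x)) := by gcongr
          _ = _ := by ring

/-- The map `n ↦ 1 / n` as a monoid homomorphism. -/
def invNatHom : ℕ →* ℝ where
  toFun n := (n : ℝ)⁻¹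
  map_one' := by simp
  map_mul' m n := by push_cast; rw [mul_inv]

lemma sum_inv_oneModFinset_le (l N : ℕ) :
    ∑ m ∈ oneModFinset l N, (1 / m : ℝ) ≤ Real.exp (2 * ∑ p ∈ oneModPrimes l N, (1 / p : ℝ)) := by
  have hE := EulerProduct.summable_and_hasSum_factoredNumbers_prod_filter_prime_geometric
    (f := invNatHom) (fun {p} hp => by
      have : (1 : ℝ) < p := by exact_mod_cast hp.one_lt
      change ‖(p : ℝ)⁻¹‖ < 1
      rw [norm_inv, Real.norm_natCast]
      exact inv_lt_one_of_one_lt₀ this) (oneModPrimes l N)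
  have hsub : ∀ m ∈ oneModFinset l N, m ∈ Nat.factoredNumbers (oneModPrimes l N) := by
    intro m hm
    rw [mem_oneModFinset] at hm
    rw [Nat.mem_factoredNumbers']
    intro p hp hpm
    simp only [oneModPrimes, Finset.mem_filter, Finset.mem_Icc]
    exact ⟨⟨hp.one_le, (Nat.le_of_dvd (by omega) hpm).trans hm.1.2⟩, hp, hm.2.2 p hp hpm⟩
  calc ∑ m ∈ oneModFinset l N, (1 / m : ℝ)
      = ∑ m ∈ (oneModFinset l N).attach.map
          ⟨fun m => (⟨m.1, hsub m.1 m.2⟩ : Nat.factoredNumbers (oneModPrimes l N)),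
            fun a b hab => Subtype.ext (congrArg (fun z => z.1) hab)⟩, invNatHom m := by
        rw [Finset.sum_map, ← Finset.sum_attach]
        refine Finset.sum_congr rfl fun m _ => ?_
        simp only [invNatHom, MonoidHom.coe_mk, OneHom.coe_mk, one_div]
        rfl
    _ ≤ ∏ p ∈ oneModPrimes l N with p.Prime, (1 - invNatHom p)⁻¹ := by
        refine sum_le_hasSum _ (fun m _ => ?_) hE.2
        change (0 : ℝ) ≤ ((m : ℕ) : ℝ)⁻¹
        positivity
    _ ≤ ∏ p ∈ oneModPrimes l N with p.Prime, Real.exp (2 * (1 / p : ℝ)) := by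
        refine Finset.prod_le_prod (fun p hp => ?_) fun p hp => ?_
        all_goals
          have hp := (Finset.mem_filter.1 hp).2
          have h2 : (p : ℝ)⁻¹ ≤ 1 / 2 := by
            rw [inv_le_comm₀ (by exact_mod_cast hp.pos) (by norm_num)]
            norm_num
            exact_mod_cast hp.two_le
          have h0 : (0 : ℝ) ≤ (p : ℝ)⁻¹ := by positivity
          change _ ≤ _
          simp only [invNatHom, MonoidHom.coe_mk, OneHom.coe_mk]
        · rw [inv_nonneg]
          linarith
        · have h3 := Real.add_one_le_exp (2 * (1 / p : ℝ))
          refine le_trans ?_ h3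
          rw [inv_le_iff_one_le_mul₀ (by linarith), one_div]
          nlinarith
    _ = Real.exp (2 * ∑ p ∈ oneModPrimes l N, (1 / p : ℝ)) := by
        rw [← Real.exp_sum, ← Finset.mul_sum]
        congr 2
        refine Finset.sum_congr ?_ fun _ _ => rfl
        rw [Finset.filter_eq_self]
        intro p hp
        exact (Finset.mem_filter.1 hp).2.1

lemma sum_vonMangoldt_div_le {l : ℕ} {η : ℝ} (h : ∀ n : ℕ, psiOne l n ≤ η * n) (hη : 0 ≤ η)
    (N e₀ : ℕ) :
    ∑ m ∈ oneModFinset l N, ∑ e ∈ m.divisors.filter (fun e => e₀ < e), Λ (m / e) ≤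
      η * N * ∑ e ∈ (oneModFinset l N).filter (fun e => e₀ < e), (1 / e : ℝ) := by
  calc ∑ m ∈ oneModFinset l N, ∑ e ∈ m.divisors.filter (fun e => e₀ < e), Λ (m / e)
      = ∑ e ∈ (oneModFinset l N).filter (fun e => e₀ < e),
          ∑ m ∈ (oneModFinset l N).filter (fun m => e ∣ m), Λ (m / e) := by
        refine Finset.sum_comm' fun m e => ?_
        simp only [Finset.mem_filter, mem_oneModFinset, Nat.mem_divisors]
        constructor
        · rintro ⟨⟨⟨h1, h2⟩, h3⟩, ⟨h4, h5⟩, h6⟩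
          have hT : PrimesOneMod l e := by
            obtain ⟨k, rfl⟩ := h4
            exact (primesOneMod_mul.1 h3).1
          have he := Nat.le_of_dvd h1 h4
          exact ⟨⟨⟨⟨h1, h2⟩, h3⟩, h4⟩, ⟨⟨by omega, by omega⟩, hT⟩, h6⟩
        · rintro ⟨⟨⟨⟨h1, h2⟩, h3⟩, h4⟩, ⟨-, -⟩, h6⟩
          exact ⟨⟨⟨h1, h2⟩, h3⟩, ⟨h4, by omega⟩, h6⟩
    _ ≤ ∑ e ∈ (oneModFinset l N).filter (fun e => e₀ < e), η * N * (1 / e : ℝ) := by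
        refine Finset.sum_le_sum fun e he => ?_
        simp only [Finset.mem_filter, mem_oneModFinset] at he
        have he0 : 0 < e := by omega
        calc ∑ m ∈ (oneModFinset l N).filter (fun m => e ∣ m), Λ (m / e)
            = ∑ d ∈ ((oneModFinset l N).filter (fun m => e ∣ m)).image (fun m => m / e), Λ d := by
              rw [Finset.sum_image]
              intro a ha b hb hab
              simp only [Finset.coe_filter, Set.mem_ofPred_eq] at ha hb
              rw [← Nat.div_mul_cancel ha.2, ← Nat.div_mul_cancel hb.2]
              exact congrArg (· * e) hab
          _ = ∑ d ∈ (((oneModFinset l N).filter (fun m => e ∣ m)).image (fun m => m / e)).filter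
                (fun d => IsPrimePow d), Λ d := by
              symm
              exact Finset.sum_filter_of_ne fun d _ hd =>
                ArithmeticFunction.vonMangoldt_ne_zero_iff.1 hd
          _ ≤ psiOne l (N / e) := by
              refine Finset.sum_le_sum_of_subset_of_nonneg ?_ fun _ _ _ =>
                ArithmeticFunction.vonMangoldt_nonneg
              intro d hd
              simp only [Finset.mem_filter, Finset.mem_image, mem_oneModFinset,
                Finset.mem_Icc] at hd ⊢
              obtain ⟨⟨m, ⟨⟨⟨h1, h2⟩, h3⟩, ⟨k, rfl⟩⟩, rfl⟩, hpp⟩ := hd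
              rw [Nat.mul_div_cancel_left k he0] at hpp ⊢
              refine ⟨⟨hpp.pos, ?_⟩, ?_⟩
              · rw [Nat.le_div_iff_mul_le he0, mul_comm]
                exact h2
              · obtain ⟨p, r, hp, hr, rfl⟩ := (isPrimePow_nat_iff _).1 hpp
                have := (primesOneMod_mul.1 h3).2.2 p hp (dvd_pow_self p hr.ne')
                push_cast
                rw [this, one_pow]
          _ ≤ η * ((N / e : ℕ) : ℝ) := h _
          _ ≤ η * (N / e) := by
              gcongr
              exact Nat.cast_div_le
          _ = _ := by ring
    _ = _ := by rw [Finset.mul_sum]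

lemma sum_log_oneModFinset_le {l : ℕ} {η : ℝ} (h : ∀ n : ℕ, psiOne l n ≤ η * n) (hη : 0 ≤ η)
    (N : ℕ) :
    ∑ m ∈ oneModFinset l N, Real.log m ≤ η * N * ∑ e ∈ oneModFinset l N, (1 / e : ℝ) := by
  have h1 := sum_vonMangoldt_div_le h hη N 0
  have h2 : (oneModFinset l N).filter (fun e => 0 < e) = oneModFinset l N := by
    rw [Finset.filter_eq_self]
    intro m hm
    exact (mem_oneModFinset.1 hm).1.1
  rw [h2] at h1
  refine le_trans (le_of_eq (Finset.sum_congr rfl fun m _ => ?_)) h1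
  rw [← ArithmeticFunction.vonMangoldt_sum, ← Nat.sum_div_divisors]
  refine Finset.sum_congr ?_ fun _ _ => rfl
  symm
  rw [Finset.filter_eq_self]
  intro e he
  exact Nat.pos_of_mem_divisors he

lemma two_mul_vonMangoldt_le_log {m : ℕ} (hm : ¬ m.Prime) : 2 * Λ m ≤ Real.log m := by
  by_cases hpp : IsPrimePow m
  · obtain ⟨p, k, hp, hk, rfl⟩ := (isPrimePow_nat_iff _).1 hpp
    have hk2 : 2 ≤ k := by
      rcases Nat.lt_or_ge k 2 with h | h
      · have : k = 1 := by omega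
        subst this
        rw [pow_one] at hm
        exact absurd hp hm
      · exact h
    rw [ArithmeticFunction.vonMangoldt_apply_pow hk.ne',
      ArithmeticFunction.vonMangoldt_apply_prime hp]
    push_cast
    rw [Real.log_pow]
    have : (2 : ℝ) ≤ k := by exact_mod_cast hk2
    have h0 := Real.log_natCast_nonneg p
    gcongr
  · have : Λ m = 0 := by
      by_contra hne
      exact hpp (ArithmeticFunction.vonMangoldt_ne_zero_iff.1 hne)
    rw [this, mul_zero]
    exact Real.log_natCast_nonneg m

lemma sum_log_nonprime_le {l : ℕ} {η : ℝ} (h : ∀ n : ℕ, psiOne l n ≤ η * n) (hη : 0 ≤ η)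
    (N : ℕ) :
    ∑ m ∈ (oneModFinset l N).filter (fun m => ¬ m.Prime), Real.log m ≤
      2 * (η * N * ∑ e ∈ (oneModFinset l N).filter (fun e => 1 < e), (1 / e : ℝ)) := by
  refine le_trans ?_ (mul_le_mul_of_nonneg_left (sum_vonMangoldt_div_le h hη N 1) zero_le_two)
  rw [Finset.mul_sum]
  have hΛ : ∀ n, 0 ≤ Λ n := fun n => ArithmeticFunction.vonMangoldt_nonneg
  refine le_trans (Finset.sum_le_sum fun m hm => ?_) (Finset.sum_le_sum_of_subset_of_nonneg
    (Finset.filter_subset _ _) fun m _ _ =>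
      mul_nonneg zero_le_two (Finset.sum_nonneg fun e _ => hΛ _))
  rw [Finset.mem_filter, mem_oneModFinset] at hm
  have h2 := two_mul_vonMangoldt_le_log hm.2
  have h3 : Real.log m = Λ m + ∑ e ∈ m.divisors.filter (fun e => 1 < e), Λ (m / e) := by
    have h4 : ¬ (1 ∈ m.divisors.filter (fun e => 1 < e)) := by simp
    have h5 : m.divisors = insert 1 (m.divisors.filter (fun e => 1 < e)) := by
      ext e
      simp only [Nat.mem_divisors, Finset.mem_insert, Finset.mem_filter]
      constructor
      · rintro ⟨h, h'⟩
        have := Nat.pos_of_dvd_of_pos h (by omega)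
        by_cases he : e = 1
        · exact Or.inl he
        · exact Or.inr ⟨⟨h, h'⟩, by omega⟩
      · rintro (rfl | h)
        · exact ⟨one_dvd _, by omega⟩
        · exact h.1
    rw [← ArithmeticFunction.vonMangoldt_sum, ← Nat.sum_div_divisors]
    conv_lhs => rw [h5]
    rw [Finset.sum_insert h4, Nat.div_one]
  linarith

end

/-! ### Integers all of whose unit group factors are divisible by a large prime -/

noncomputable section

lemma one_le_of_two_le_log {x : ℝ} (hx : 0 < x) (hL : 2 ≤ Real.log x) : 1 ≤ x := by
  by_contra hlt
  have := Real.log_nonpos hx.le (by linarith : x ≤ 1)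
  linarith

lemma sqrt_le_two_mul_div_log {x : ℝ} (hx : 0 < x) (hL : 2 ≤ Real.log x) :
    √x ≤ 2 * x / Real.log x := by
  rw [le_div_iff₀ (by linarith)]
  have h1 : Real.log x ≤ 2 * √x := by
    have h2 : Real.log x = 2 * Real.log √x := by rw [Real.log_sqrt hx.le]; ring
    have h3 := Real.log_le_sub_one_of_pos (Real.sqrt_pos.2 hx)
    linarith
  have h4 := Real.mul_self_sqrt hx.le
  nlinarith [Real.sqrt_nonneg x]

lemma sum_inv_le_rpow {l : ℕ} {η b : ℝ} (hη : 0 ≤ η) (h : ∀ n : ℕ, psiOne l n ≤ η * n)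
    (hb : 30 * η ≤ b) {x : ℝ} (hx : 0 < x) (hL : 2 ≤ Real.log x) :
    ∑ m ∈ oneModFinset l ⌊x⌋₊, (1 / m : ℝ) ≤ Real.log x ^ b := by
  refine (sum_inv_oneModFinset_le _ _).trans ?_
  have h1 := sum_inv_oneModPrimes_le hη h hx hL
  have hll : 0 ≤ Real.log (Real.log x) := Real.log_nonneg (by linarith)
  rw [Real.rpow_def_of_pos (by linarith), Real.exp_le_exp]
  nlinarith

lemma sum_inv_one_lt_le {l : ℕ} {η b : ℝ} (hη : 0 ≤ η) (h : ∀ n : ℕ, psiOne l n ≤ η * n)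
    (hb : 30 * η ≤ b) {x : ℝ} (hx : 0 < x) (hL : 2 ≤ Real.log x) :
    ∑ m ∈ (oneModFinset l ⌊x⌋₊).filter (fun m => 1 < m), (1 / m : ℝ) ≤
      30 * η * Real.log (Real.log x) * Real.log x ^ b := by
  have hll : 0 ≤ Real.log (Real.log x) := Real.log_nonneg (by linarith)
  have hL0 : 0 < Real.log x := by linarith
  have h1 := sum_inv_oneModPrimes_le hη h hx hL
  have h2 := sum_inv_oneModFinset_le l ⌊x⌋₊
  set t := 30 * η * Real.log (Real.log x) with ht
  have h3 : ∑ m ∈ oneModFinset l ⌊x⌋₊, (1 / m : ℝ) ≤ Real.exp t :=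
    h2.trans (Real.exp_le_exp.2 (by linarith))
  have hmem : 1 ∈ oneModFinset l ⌊x⌋₊ := by
    rw [mem_oneModFinset]
    exact ⟨⟨le_rfl, (Nat.one_le_floor_iff x).2 (one_le_of_two_le_log hx hL)⟩, PrimesOneMod.one l⟩
  have h4 : ∑ m ∈ (oneModFinset l ⌊x⌋₊).filter (fun m => 1 < m), (1 / m : ℝ) + 1 ≤
      ∑ m ∈ oneModFinset l ⌊x⌋₊, (1 / m : ℝ) := by
    rw [← Finset.add_sum_erase _ _ hmem, add_comm]
    simp only [Nat.cast_one, div_one, add_le_add_iff_left]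
    refine Finset.sum_le_sum_of_subset_of_nonneg ?_ fun _ _ _ => by positivity
    intro m hm
    rw [Finset.mem_filter] at hm
    exact Finset.mem_erase.2 ⟨by omega, hm.1⟩
  have h5 : Real.exp t - 1 ≤ t * Real.exp t := by
    have h6 := Real.add_one_le_exp (-t)
    have h7 : Real.exp (-t) * Real.exp t = 1 := by rw [← Real.exp_add]; simp
    nlinarith [Real.exp_pos t]
  have h8 : Real.exp t ≤ Real.log x ^ b := by
    rw [Real.rpow_def_of_pos hL0, Real.exp_le_exp]
    nlinarith
  have ht0 : 0 ≤ t := by positivity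
  nlinarith

lemma card_sqrt_lt_le {S : Finset ℕ} {x : ℝ} (hx : 0 < x) (hL : 2 ≤ Real.log x) :
    ((S.filter (fun m : ℕ => √x < m)).card : ℝ) ≤ 2 / Real.log x * ∑ m ∈ S, Real.log m := by
  rw [Finset.card_eq_sum_ones]
  push_cast
  rw [Finset.mul_sum]
  refine le_trans (Finset.sum_le_sum fun m hm => ?_) (Finset.sum_le_sum_of_subset_of_nonneg
    (Finset.filter_subset _ _) fun m _ _ =>
      mul_nonneg (by positivity) (Real.log_natCast_nonneg m))
  rw [Finset.mem_filter] at hm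
  have h1 : Real.log √x ≤ Real.log m := Real.log_le_log (Real.sqrt_pos.2 hx) hm.2.le
  rw [Real.log_sqrt hx.le] at h1
  rw [div_mul_eq_mul_div, le_div_iff₀ (by linarith)]
  linarith

lemma card_filter_le_sqrt (S : Finset ℕ) (hS : ∀ m ∈ S, 1 ≤ m) {x : ℝ} :
    ((S.filter (fun m : ℕ => ¬ √x < m)).card : ℝ) ≤ √x := by
  refine le_trans ?_ (Nat.floor_le (Real.sqrt_nonneg x))
  have : (S.filter (fun m : ℕ => ¬ √x < m)) ⊆ Finset.Icc 1 ⌊√x⌋₊ := by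
    intro m hm
    rw [Finset.mem_filter, not_lt] at hm
    exact Finset.mem_Icc.2 ⟨hS m hm.1, Nat.le_floor hm.2⟩
  exact_mod_cast (Finset.card_le_card this).trans (by simp)

lemma oneModCount_le_rpow {l : ℕ} {η b : ℝ} (hη : 0 ≤ η) (h : ∀ n : ℕ, psiOne l n ≤ η * n)
    (hb : 30 * η ≤ b) (hb1 : b ≤ 1) {x : ℝ} (hx : 0 < x) (hL : 2 ≤ Real.log x) :
    oneModCount l x ≤ 4 * x * Real.log x ^ (-(1 - b)) := by
  classical
  have hL0 : 0 < Real.log x := by linarith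
  have hS : ∀ m ∈ oneModFinset l ⌊x⌋₊, 1 ≤ m := fun m hm => (mem_oneModFinset.1 hm).1.1
  have h1 : oneModCount l x = ((oneModFinset l ⌊x⌋₊).card : ℝ) := by
    rw [oneModCount_eq_card]
    rfl
  have hNx : ((⌊x⌋₊ : ℕ) : ℝ) ≤ x := Nat.floor_le hx.le
  have hM := sum_inv_le_rpow hη h hb hx hL
  have hlogs : ∑ m ∈ oneModFinset l ⌊x⌋₊, Real.log m ≤ x * Real.log x ^ b := by
    refine (sum_log_oneModFinset_le h hη _).trans ?_
    have hη1 : η * ((⌊x⌋₊ : ℕ) : ℝ) ≤ x := by nlinarith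
    have h0 : (0 : ℝ) ≤ ∑ m ∈ oneModFinset l ⌊x⌋₊, (1 / m : ℝ) :=
      Finset.sum_nonneg fun _ _ => by positivity
    gcongr
  have hpow : Real.log x ^ (-(1 - b)) = Real.log x ^ b / Real.log x := by
    rw [show -(1 - b) = b - 1 by ring, Real.rpow_sub_one hL0.ne']
  have hLb : 1 ≤ Real.log x ^ b := Real.one_le_rpow (by linarith) (by linarith)
  rw [h1, ← Finset.card_filter_add_card_filter_not (fun m : ℕ => √x < m)]
  push_cast
  have h2 := card_sqrt_lt_le (S := oneModFinset l ⌊x⌋₊) hx hL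
  have h3 := card_filter_le_sqrt (oneModFinset l ⌊x⌋₊) hS (x := x)
  have h4 := sqrt_le_two_mul_div_log hx hL
  calc _ ≤ 2 / Real.log x * (x * Real.log x ^ b) + 2 * x / Real.log x * Real.log x ^ b := by
        refine add_le_add (h2.trans (by gcongr)) (h3.trans (h4.trans ?_))
        exact le_mul_of_one_le_right (by positivity) hLb
    _ = _ := by
        rw [hpow]
        field_simp
        ring

lemma exists_eq_of_unitsDvd_mul {q l n : ℕ} (hq : 2 ≤ q) (hl : l.Prime) (hql : q < l)
    (h : UnitsDvd (q * l) n) : ∃ a m : ℕ, a < 2 ∧ PrimesOneMod l m ∧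
      (n = 2 ^ a * m ∨ ∃ k : ℕ, n = 2 ^ a * l ^ (k + 2) * m) := by
  have hn := h.ne_zero
  have hql2 : 2 ≤ q * l := by nlinarith [hl.two_le]
  obtain ⟨d, m, rfl, hd, hm⟩ := (unitsDvd_iff_exists hql2).1 h
  obtain ⟨a, w, ha, rfl, hw⟩ := exists_eq_of_mem_unitsCore hql2 hd
  have hml : PrimesOneMod l m := by
    refine ⟨hm.1, fun p hp hpm => ?_⟩
    have := hm.2 p hp hpm
    rw [natCast_eq_one_iff_dvd hp.one_le] at this ⊢
    exact (dvd_mul_left l q).trans this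
  have hw0 : w ≠ 0 := right_ne_zero_of_mul (left_ne_zero_of_mul hn)
  have hall : ∀ {p : ℕ}, p.Prime → p ∣ w → p = l := by
    intro p hp hpw
    by_contra hne
    obtain ⟨⟨-, -, hpq, hdv⟩, -⟩ := hw p hp hpw
    have hpq' : p ∣ q := by
      rcases hp.dvd_mul.1 hpq with h | h
      · exact h
      · exact absurd ((Nat.prime_dvd_prime_iff_eq hp hl).1 h) hne
    have hle := Nat.le_of_dvd (by omega) hpq'
    have h1 : l ∣ (q * l) / p ^ ((q * l).factorization p) * p ^ ((q * l).factorization p) := by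
      rw [Nat.div_mul_cancel (Nat.ordProj_dvd _ _)]
      exact dvd_mul_left l q
    have h2 : l ∣ (q * l) / p ^ ((q * l).factorization p) := by
      refine Nat.Coprime.dvd_of_dvd_mul_right ?_ h1
      exact ((Nat.coprime_primes hl hp).2 (Ne.symm hne)).pow_right _
    have h3 := Nat.le_of_dvd (by have := hp.two_le; omega) (h2.trans hdv)
    omega
  refine ⟨a, m, ha, hml, ?_⟩
  have hwl := Nat.eq_prime_pow_of_unique_prime_dvd hw0 hall
  rcases Nat.eq_zero_or_pos w.primeFactorsList.length with h0 | h0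
  · left
    rw [h0, pow_zero] at hwl
    rw [hwl, mul_one]
  · right
    have hlw : l ∣ w := by
      rw [hwl]
      exact dvd_pow_self l (by omega)
    obtain ⟨-, hf⟩ := hw l hl hlw
    have hf1 : 1 ≤ (q * l).factorization l := by
      refine (hl.dvd_iff_one_le_factorization (by positivity)).1 (dvd_mul_left l q)
    have hwf : w.factorization l = w.primeFactorsList.length := by
      conv_lhs => rw [hwl]
      simp [hl.factorization]
    obtain ⟨k, hk⟩ : ∃ k, w.primeFactorsList.length = k + 2 :=
      ⟨w.primeFactorsList.length - 2, by omega⟩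
    rw [hk] at hwl
    exact ⟨k, by rw [hwl]⟩

end

noncomputable section

/-- The primes `l` with `L₀ < l ≤ N`. -/
def largePrimes (L₀ N : ℕ) : Finset ℕ := (Nat.primesLE N).filter (fun l => L₀ < l)

open scoped Classical in
/-- The integers `3 ≤ n ≤ N` with `UnitsDvd (q * l) n` for some prime `l > L₀`. -/
def largeExceptions (q L₀ N : ℕ) : Finset ℕ :=
  (Finset.Icc 3 N).filter (fun n => ∃ l : ℕ, l.Prime ∧ L₀ < l ∧ UnitsDvd (q * l) n)

/-- The non-prime integers up to `N` all of whose prime factors are `1` modulo a common prime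
`l > L₀`. -/
def nonprimeOneMod (L₀ N : ℕ) : Finset ℕ :=
  (largePrimes L₀ N).biUnion (fun l => (oneModFinset l N).filter (fun m => ¬ m.Prime))

lemma card_twoPow_image_le (S : Finset ℕ) :
    ((Finset.range 2).biUnion (fun a => S.image (fun m => 2 ^ a * m))).card ≤ 2 * S.card := by
  refine Finset.card_biUnion_le.trans ?_
  calc ∑ a ∈ Finset.range 2, (S.image (fun m => 2 ^ a * m)).card
      ≤ ∑ a ∈ Finset.range 2, S.card := Finset.sum_le_sum fun a _ => Finset.card_image_le
    _ = 2 * S.card := by simp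

lemma card_largeExceptions_le {q L₀ : ℕ} (hq : 2 ≤ q) (hL₀ : q ≤ L₀) (N : ℕ) :
    (largeExceptions q L₀ N).card ≤ 2 * (Nat.primesLE N).card + 2 * (nonprimeOneMod L₀ N).card +
      ∑ a ∈ Finset.range 2, ∑ l ∈ largePrimes L₀ N, ∑ k ∈ Finset.range N,
        (oneModFinset l (N / (2 ^ a * l ^ (k + 2)))).card := by
  classical
  have hsub : largeExceptions q L₀ N ⊆
      ((Finset.range 2).biUnion (fun a => (Nat.primesLE N).image (fun m => 2 ^ a * m)) ∪
      (Finset.range 2).biUnion (fun a => (nonprimeOneMod L₀ N).image (fun m => 2 ^ a * m))) ∪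
      (Finset.range 2).biUnion (fun a => (largePrimes L₀ N).biUnion (fun l =>
        (Finset.range N).biUnion (fun k =>
          (oneModFinset l (N / (2 ^ a * l ^ (k + 2)))).image
            (fun m => 2 ^ a * l ^ (k + 2) * m)))) := by
    intro n hn
    simp only [largeExceptions, Finset.mem_filter, Finset.mem_Icc] at hn
    obtain ⟨⟨hn3, hnN⟩, l, hl, hlL, hU⟩ := hn
    obtain ⟨a, m, ha, hm, h | ⟨k, h⟩⟩ := exists_eq_of_unitsDvd_mul hq hl (by omega) hU
    · refine Finset.mem_union_left _ ?_
      have hm0 : 1 ≤ m := Nat.one_le_iff_ne_zero.2 hm.1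
      have hmn : m ≤ n := by
        rw [h]
        exact Nat.le_mul_of_pos_left m (by positivity)
      by_cases hmp : m.Prime
      · refine Finset.mem_union_left _ ?_
        simp only [Finset.mem_biUnion, Finset.mem_range, Finset.mem_image, Nat.mem_primesLE]
        exact ⟨a, ha, m, ⟨by omega, hmp⟩, h.symm⟩
      · refine Finset.mem_union_right _ ?_
        simp only [Finset.mem_biUnion, Finset.mem_range, Finset.mem_image, nonprimeOneMod,
          largePrimes, Nat.mem_primesLE, Finset.mem_filter, mem_oneModFinset]
        refine ⟨a, ha, m, ⟨l, ⟨⟨?_, hl⟩, hlL⟩, ⟨⟨hm0, by omega⟩, hm⟩, hmp⟩, h.symm⟩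
        have hm1 : m ≠ 1 := by
          rintro rfl
          have : 2 ^ a ≤ 2 ^ 1 := Nat.pow_le_pow_right (by norm_num) (by omega)
          omega
        have hp := Nat.minFac_prime hm1
        have h1 := hm.2 _ hp (Nat.minFac_dvd m)
        rw [natCast_eq_one_iff_dvd hp.one_le] at h1
        have h2 := Nat.le_of_dvd (by have := hp.two_le; omega) h1
        have h3 := Nat.minFac_le hm0
        omega
    · refine Finset.mem_union_right _ ?_
      have hD : 0 < 2 ^ a * l ^ (k + 2) := by
        have := hl.pos
        positivity
      have hm0 : 1 ≤ m := Nat.one_le_iff_ne_zero.2 hm.1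
      have hln : l ^ (k + 2) ≤ n := by
        rw [h, mul_right_comm]
        exact Nat.le_mul_of_pos_left _ (by positivity)
      have hlN : l ≤ N := (Nat.le_self_pow (by omega) l).trans (hln.trans hnN)
      have hkN : k < N := by
        have := (Nat.lt_pow_self hl.one_lt : k + 2 < l ^ (k + 2))
        omega
      simp only [Finset.mem_biUnion, Finset.mem_range, Finset.mem_image, largePrimes,
        Nat.mem_primesLE, Finset.mem_filter, mem_oneModFinset]
      refine ⟨a, ha, l, ⟨⟨hlN, hl⟩, hlL⟩, k, hkN, m, ⟨⟨hm0, ?_⟩, hm⟩, h.symm⟩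
      rw [Nat.le_div_iff_mul_le hD, mul_comm, ← h]
      exact hnN
  refine (Finset.card_le_card hsub).trans ((Finset.card_union_le _ _).trans (add_le_add
    ((Finset.card_union_le _ _).trans (add_le_add (card_twoPow_image_le _)
      (card_twoPow_image_le _))) ?_))
  refine Finset.card_biUnion_le.trans (Finset.sum_le_sum fun a _ => ?_)
  refine Finset.card_biUnion_le.trans (Finset.sum_le_sum fun l _ => ?_)
  refine Finset.card_biUnion_le.trans (Finset.sum_le_sum fun k _ => ?_)
  exact Finset.card_image_le

lemma card_primesLE_le {x : ℝ} (hx : 0 < x) (hL : 2 ≤ Real.log x) :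
    ((Nat.primesLE ⌊x⌋₊).card : ℝ) ≤ 6 * (x / Real.log x) := by
  have hx1 : 1 < x := by
    refine lt_of_le_of_ne (one_le_of_two_le_log hx hL) ?_
    rintro rfl
    simp at hL
    linarith
  rw [Nat.primesLE_card_eq_primeCounting]
  refine (Chebyshev.pi_le_log4_mul_div hx1).trans ?_
  have h1 := sqrt_le_two_mul_div_log hx hL
  have h4 : Real.log 4 ≤ 2 := by
    have h5 : Real.log 4 = 2 * Real.log 2 := by
      rw [show (4 : ℝ) = 2 ^ 2 by norm_num, Real.log_pow]
      norm_num
    linarith [Real.log_two_lt_d9]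
  rw [Real.log_sqrt hx.le]
  calc Real.log 4 * x / (Real.log x / 2) + √x ≤ 2 * x / (Real.log x / 2) + 2 * x / Real.log x := by
        gcongr
    _ = _ := by
        field_simp
        ring

lemma card_nonprimeOneMod_le {L₀ : ℕ} {η : ℕ → ℝ} {b : ℝ} (hη : ∀ l, 0 ≤ η l)
    (h : ∀ l : ℕ, l.Prime → ∀ n : ℕ, psiOne l n ≤ η l * n)
    (hb : ∀ l : ℕ, l.Prime → L₀ < l → 30 * η l ≤ b)
    {x : ℝ} (hx : 0 < x) (hL : 2 ≤ Real.log x) :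
    ((nonprimeOneMod L₀ ⌊x⌋₊).card : ℝ) ≤ 2 * x / Real.log x +
      120 * (x * Real.log (Real.log x) * (Real.log x ^ b / Real.log x)) *
        ∑ l ∈ largePrimes L₀ ⌊x⌋₊, η l ^ 2 := by
  classical
  have hL0 : 0 < Real.log x := by linarith
  have hll : 0 ≤ Real.log (Real.log x) := Real.log_nonneg (by linarith)
  have hNx : ((⌊x⌋₊ : ℕ) : ℝ) ≤ x := Nat.floor_le hx.le
  set S := nonprimeOneMod L₀ ⌊x⌋₊ with hSdef
  have hS : ∀ m ∈ S, 1 ≤ m := by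
    intro m hm
    simp only [hSdef, nonprimeOneMod, Finset.mem_biUnion, Finset.mem_filter,
      mem_oneModFinset] at hm
    obtain ⟨l, -, hm, -⟩ := hm
    exact hm.1.1
  rw [← Finset.card_filter_add_card_filter_not (fun m : ℕ => √x < m)]
  push_cast
  rw [add_comm]
  refine add_le_add ((card_filter_le_sqrt S hS).trans (sqrt_le_two_mul_div_log hx hL)) ?_
  have h1 : (S.filter (fun m : ℕ => √x < m)).card ≤ ∑ l ∈ largePrimes L₀ ⌊x⌋₊,
      (((oneModFinset l ⌊x⌋₊).filter (fun m => ¬ m.Prime)).filter (fun m : ℕ => √x < m)).card := by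
    rw [hSdef, nonprimeOneMod, Finset.filter_biUnion]
    exact Finset.card_biUnion_le
  calc ((S.filter (fun m : ℕ => √x < m)).card : ℝ)
      ≤ ∑ l ∈ largePrimes L₀ ⌊x⌋₊, ((((oneModFinset l ⌊x⌋₊).filter
          (fun m => ¬ m.Prime)).filter (fun m : ℕ => √x < m)).card : ℝ) := by exact_mod_cast h1
    _ ≤ ∑ l ∈ largePrimes L₀ ⌊x⌋₊,
          120 * (x * Real.log (Real.log x) * (Real.log x ^ b / Real.log x)) * η l ^ 2 := by
        refine Finset.sum_le_sum fun l hl => ?_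
        simp only [largePrimes, Finset.mem_filter, Nat.mem_primesLE] at hl
        obtain ⟨⟨-, hlp⟩, hlL⟩ := hl
        have hηl := hη l
        refine (card_sqrt_lt_le hx hL).trans ?_
        have h2 := sum_log_nonprime_le (h l hlp) hηl ⌊x⌋₊
        have h3 := sum_inv_one_lt_le hηl (h l hlp) (hb l hlp hlL) hx hL
        calc _ ≤ 2 / Real.log x * (2 * (η l * x *
              (30 * η l * Real.log (Real.log x) * Real.log x ^ b))) := by
              refine mul_le_mul_of_nonneg_left (h2.trans ?_) (by positivity)
              have h0 : (0 : ℝ) ≤ ∑ m ∈ (oneModFinset l ⌊x⌋₊).filter (fun m => 1 < m),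
                  (1 / m : ℝ) := Finset.sum_nonneg fun _ _ => by positivity
              gcongr
          _ = _ := by ring
    _ = _ := by rw [Finset.mul_sum]

lemma sum_oneModFinset_card_le {L₀ : ℕ} {η : ℕ → ℝ} {b : ℝ} (hη : ∀ l, 0 ≤ η l)
    (h : ∀ l : ℕ, l.Prime → ∀ n : ℕ, psiOne l n ≤ η l * n) (hb0 : 0 ≤ b) (hb1 : b ≤ 1)
    (hb : ∀ l : ℕ, l.Prime → L₀ < l → 30 * η l ≤ b)
    {x : ℝ} (hx : 0 < x) (hL : 2 ≤ Real.log x) :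
    ∑ a ∈ Finset.range 2, ∑ l ∈ largePrimes L₀ ⌊x⌋₊, ∑ k ∈ Finset.range ⌊x⌋₊,
        ((oneModFinset l (⌊x⌋₊ / (2 ^ a * l ^ (k + 2)))).card : ℝ) ≤
      32 * (1 - (2 : ℝ) ^ (-(3 / 4) : ℝ))⁻¹ * (x * (Real.log x ^ b / Real.log x)) *
        ∑ l ∈ largePrimes L₀ ⌊x⌋₊, (l : ℝ) ^ (-(3 / 2) : ℝ) := by
  classical
  have hL0 : 0 < Real.log x := by linarith
  set r : ℝ := (2 : ℝ) ^ (-(3 / 4) : ℝ) with hr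
  have hr1 : r < 1 := Real.rpow_lt_one_of_one_lt_of_neg (by norm_num) (by norm_num)
  have hr0 : 0 ≤ r := by positivity
  set Y := x * (Real.log x ^ b / Real.log x) with hY
  have hY0 : 0 ≤ Y := by positivity
  have hpow : Real.log x ^ (-(1 - b)) = Real.log x ^ b / Real.log x := by
    rw [show -(1 - b) = b - 1 by ring, Real.rpow_sub_one hL0.ne']
  have hmain : ∀ a ∈ Finset.range 2, ∀ l ∈ largePrimes L₀ ⌊x⌋₊,
      ∑ k ∈ Finset.range ⌊x⌋₊, ((oneModFinset l (⌊x⌋₊ / (2 ^ a * l ^ (k + 2)))).card : ℝ) ≤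
        16 * (1 - r)⁻¹ * Y * (l : ℝ) ^ (-(3 / 2) : ℝ) := by
    intro a _ l hl
    simp only [largePrimes, Finset.mem_filter, Nat.mem_primesLE] at hl
    obtain ⟨⟨-, hlp⟩, hlL⟩ := hl
    have hl0 : (0 : ℝ) < l := by exact_mod_cast hlp.pos
    have hl2 : (2 : ℝ) ≤ l := by exact_mod_cast hlp.two_le
    set t : ℝ := (l : ℝ) ^ (-(3 / 4) : ℝ) with ht
    have ht0 : 0 ≤ t := by positivity
    have htr : t ≤ r := Real.rpow_le_rpow_of_nonpos (by norm_num) hl2 (by norm_num)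
    have ht2 : t ^ 2 = (l : ℝ) ^ (-(3 / 2) : ℝ) := by
      rw [ht, ← Real.rpow_natCast, ← Real.rpow_mul hl0.le]
      norm_num
    calc ∑ k ∈ Finset.range ⌊x⌋₊, ((oneModFinset l (⌊x⌋₊ / (2 ^ a * l ^ (k + 2)))).card : ℝ)
        ≤ ∑ k ∈ Finset.range ⌊x⌋₊, 16 * Y * t ^ 2 * r ^ k := by
          refine Finset.sum_le_sum fun k _ => ?_
          have h1 : ((oneModFinset l (⌊x⌋₊ / (2 ^ a * l ^ (k + 2)))).card : ℝ) =
              oneModCount l (x / ((2 ^ a * l ^ (k + 2) : ℕ) : ℝ)) := by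
            rw [oneModCount_eq_card, Nat.floor_div_natCast]
            rfl
          have hone : 1 ≤ 2 ^ a * l ^ (k + 2) := Nat.one_le_iff_ne_zero.2 (by
            have := hlp.pos
            positivity)
          have h2 := bound_div_of_bound (F := oneModCount l) (K := 4) (a := 1 - b) (by norm_num)
            (by linarith) (by linarith) (fun y hy => oneModCount_le l hy)
            (fun y hy hLy => oneModCount_le_rpow (hη l) (h l hlp) (hb l hlp hlL) hb1 hy hLy)
            hx hL (d := ((2 ^ a * l ^ (k + 2) : ℕ) : ℝ)) (by exact_mod_cast hone)
          rw [h1]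
          refine h2.trans ?_
          have h3 : ((2 ^ a * l ^ (k + 2) : ℕ) : ℝ) ^ (-(3 / 4) : ℝ) ≤ t ^ (k + 2) := by
            have h4 : (l : ℝ) ^ (k + 2) ≤ ((2 ^ a * l ^ (k + 2) : ℕ) : ℝ) := by
              push_cast
              exact le_mul_of_one_le_left (by positivity) (one_le_pow₀ (by norm_num))
            refine (Real.rpow_le_rpow_of_nonpos (by positivity) h4 (by norm_num)).trans ?_
            rw [ht, ← Real.rpow_natCast, ← Real.rpow_natCast, ← Real.rpow_mul hl0.le,
              ← Real.rpow_mul hl0.le, mul_comm]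
          rw [hpow]
          calc _ ≤ (2 * 4 + 8) * (x * t ^ (k + 2)) * (Real.log x ^ b / Real.log x) := by gcongr
            _ = 16 * Y * t ^ 2 * t ^ k := by rw [hY]; ring
            _ ≤ _ := by gcongr
      _ = 16 * Y * t ^ 2 * ∑ k ∈ Finset.range ⌊x⌋₊, r ^ k := by rw [Finset.mul_sum]
      _ ≤ 16 * Y * t ^ 2 * (1 - r)⁻¹ := by
          gcongr
          rw [← tsum_geometric_of_lt_one hr0 hr1]
          exact (summable_geometric_of_lt_one hr0 hr1).sum_le_tsum _ fun _ _ => by positivity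
      _ = _ := by rw [ht2]; ring
  calc _ ≤ ∑ a ∈ Finset.range 2, ∑ l ∈ largePrimes L₀ ⌊x⌋₊,
        16 * (1 - r)⁻¹ * Y * (l : ℝ) ^ (-(3 / 2) : ℝ) :=
        Finset.sum_le_sum fun a ha => Finset.sum_le_sum fun l hl => hmain a ha l hl
    _ = _ := by
        rw [← Finset.mul_sum, Finset.sum_const, Finset.card_range]
        simp only [nsmul_eq_mul, Nat.cast_ofNat]
        ring

lemma log_div_self_sq_le {l : ℕ} (hl : 1 ≤ l) :
    (Real.log l / l) ^ 2 ≤ 16 * (l : ℝ) ^ (-(3 / 2) : ℝ) := by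
  have hl0 : (0 : ℝ) < l := by exact_mod_cast hl
  have h1 := Real.log_le_rpow_div hl0.le (ε := 1 / 4) (by norm_num)
  have h2 : (l : ℝ) ^ (-(3 / 2) : ℝ) = ((l : ℝ) ^ (1 / 4 : ℝ) / l) ^ 2 := by
    rw [← Real.rpow_sub_one hl0.ne', ← Real.rpow_natCast, ← Real.rpow_mul hl0.le]
    norm_num
  have h3 : Real.log l / l ≤ 4 * ((l : ℝ) ^ (1 / 4 : ℝ) / l) := by
    rw [← mul_div_assoc]
    gcongr
    linarith
  have h0 : 0 ≤ Real.log l / l := div_nonneg (Real.log_natCast_nonneg l) hl0.le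
  rw [h2]
  nlinarith

lemma exists_card_largeExceptions_le {q : ℕ} (hq : 2 ≤ q) {b : ℝ} (hb0 : 0 < b) (hb1 : b ≤ 1) :
    ∃ L₀ : ℕ, ∃ C : ℝ, 0 ≤ C ∧ ∀ x : ℝ, 0 < x → 2 ≤ Real.log x →
      ((largeExceptions q L₀ ⌊x⌋₊).card : ℝ) ≤
        C * (x * (1 + Real.log (Real.log x)) * (Real.log x ^ b / Real.log x)) := by
  obtain ⟨K, hK1, hK⟩ := exists_psiOne_le
  set η : ℕ → ℝ := fun l => K * (Real.log l / l) with hηdef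
  have hη : ∀ l, 0 ≤ η l := fun l => mul_nonneg (by linarith)
    (div_nonneg (Real.log_natCast_nonneg l) (Nat.cast_nonneg l))
  obtain ⟨L₁, hL₁⟩ : ∃ L₁ : ℕ, ∀ l : ℕ, L₁ ≤ l → 30 * η l ≤ b := by
    have h1 := Real.isLittleO_log_id_atTop.bound (c := b / (30 * K)) (by positivity)
    have h2 := tendsto_natCast_atTop_atTop (R := ℝ) |>.eventually h1
    obtain ⟨L, hL⟩ := Filter.eventually_atTop.1 h2
    refine ⟨max L 1, fun l hl => ?_⟩
    have h3 := hL l (le_of_max_le_left hl)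
    have hl0 : (0 : ℝ) < l := by exact_mod_cast (le_of_max_le_right hl : 1 ≤ l)
    rw [id_eq, Real.norm_of_nonneg (Real.log_natCast_nonneg l), Real.norm_of_nonneg hl0.le] at h3
    have h4 : Real.log l / l ≤ b / (30 * K) := by rwa [div_le_iff₀ hl0]
    calc 30 * η l = 30 * K * (Real.log l / l) := by rw [hηdef]; ring
      _ ≤ 30 * K * (b / (30 * K)) := by gcongr
      _ = b := by field_simp
  have hsum : Summable (fun n : ℕ => (n : ℝ) ^ (-(3 / 2) : ℝ)) :=
    Real.summable_nat_rpow.2 (by norm_num)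
  set S := ∑' n : ℕ, (n : ℝ) ^ (-(3 / 2) : ℝ)
  have hS0 : 0 ≤ S := tsum_nonneg fun n => by positivity
  set R := (1 - (2 : ℝ) ^ (-(3 / 4) : ℝ))⁻¹ with hRdef
  have hR0 : 0 ≤ R := inv_nonneg.2 (sub_nonneg.2
    (Real.rpow_le_one_of_one_le_of_nonpos (by norm_num) (by norm_num)))
  set L₀ := max q L₁
  have hb : ∀ l : ℕ, l.Prime → L₀ < l → 30 * η l ≤ b := fun l _ hl =>
    hL₁ l ((le_max_right _ _).trans hl.le)
  refine ⟨L₀, 16 + 240 * (K ^ 2 * (16 * S)) + 32 * R * S, by positivity, fun x hx hL => ?_⟩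
  have hL0 : 0 < Real.log x := by linarith
  have hll : 0 ≤ Real.log (Real.log x) := Real.log_nonneg (by linarith)
  have hLb : 1 ≤ Real.log x ^ b := Real.one_le_rpow (by linarith) hb0.le
  have hcard := card_largeExceptions_le hq (le_max_left q L₁) ⌊x⌋₊
  have hA := card_primesLE_le hx hL
  have hB := card_nonprimeOneMod_le hη hK hb hx hL
  have hC := sum_oneModFinset_card_le hη hK hb0.le hb1 hb hx hL
  have hS1 : ∑ l ∈ largePrimes L₀ ⌊x⌋₊, (l : ℝ) ^ (-(3 / 2) : ℝ) ≤ S :=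
    hsum.sum_le_tsum _ fun _ _ => by positivity
  have hS2 : ∑ l ∈ largePrimes L₀ ⌊x⌋₊, η l ^ 2 ≤ K ^ 2 * (16 * S) := by
    calc ∑ l ∈ largePrimes L₀ ⌊x⌋₊, η l ^ 2
        ≤ ∑ l ∈ largePrimes L₀ ⌊x⌋₊, K ^ 2 * (16 * (l : ℝ) ^ (-(3 / 2) : ℝ)) := by
          refine Finset.sum_le_sum fun l hl => ?_
          simp only [largePrimes, Finset.mem_filter, Nat.mem_primesLE] at hl
          rw [hηdef]
          simp only [mul_pow]
          gcongr
          exact log_div_self_sq_le hl.1.2.one_le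
      _ = K ^ 2 * (16 * ∑ l ∈ largePrimes L₀ ⌊x⌋₊, (l : ℝ) ^ (-(3 / 2) : ℝ)) := by
          rw [← Finset.mul_sum, ← Finset.mul_sum]
      _ ≤ _ := by gcongr
  set Y := x * (Real.log x ^ b / Real.log x) with hY
  have hY0 : 0 ≤ Y := by positivity
  set ll := Real.log (Real.log x)
  have hYx : x / Real.log x ≤ Y := by
    rw [hY, ← mul_div_assoc]
    gcongr
    exact le_mul_of_one_le_right hx.le hLb
  have hB' : ((nonprimeOneMod L₀ ⌊x⌋₊).card : ℝ) ≤ 2 * Y + 120 * (Y * ll) * (K ^ 2 * (16 * S)) := by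
    refine hB.trans ?_
    have e1 : 2 * x / Real.log x = 2 * (x / Real.log x) := by ring
    have e2 : x * ll * (Real.log x ^ b / Real.log x) = Y * ll := by rw [hY]; ring
    rw [e1, e2]
    gcongr
  have hC' := hC.trans (mul_le_mul_of_nonneg_left hS1 (by positivity))
  have hcard' : ((largeExceptions q L₀ ⌊x⌋₊).card : ℝ) ≤ 2 * ((Nat.primesLE ⌊x⌋₊).card : ℝ) +
      2 * ((nonprimeOneMod L₀ ⌊x⌋₊).card : ℝ) +
      ∑ a ∈ Finset.range 2, ∑ l ∈ largePrimes L₀ ⌊x⌋₊, ∑ k ∈ Finset.range ⌊x⌋₊,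
        ((oneModFinset l (⌊x⌋₊ / (2 ^ a * l ^ (k + 2)))).card : ℝ) := by exact_mod_cast hcard
  have hkey : ((largeExceptions q L₀ ⌊x⌋₊).card : ℝ) ≤
      16 * Y + 240 * (K ^ 2 * (16 * S)) * (Y * ll) + 32 * R * S * Y := by
    linarith
  have hYll : 0 ≤ Y * ll := by positivity
  have hc1 : 0 ≤ 240 * (K ^ 2 * (16 * S)) * Y := by positivity
  have hc2 : 0 ≤ 32 * R * S * (Y * ll) := by positivity
  calc _ ≤ _ := hkey
    _ ≤ (16 + 240 * (K ^ 2 * (16 * S)) + 32 * R * S) * (Y * (1 + ll)) := by nlinarith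
    _ = _ := by rw [hY]; ring

end

/-! ### The main estimate -/

noncomputable section

lemma two_mul_totient_le {q l : ℕ} (hq : Even q) (hl : l.Prime) :
    2 * q.totient ≤ (q * l).totient := by
  rw [mul_comm q l]
  by_cases h : l ∣ q
  · rw [Nat.totient_mul_of_prime_of_dvd hl h]
    exact Nat.mul_le_mul_right _ hl.two_le
  · rw [Nat.totient_mul_of_prime_of_not_dvd hl h]
    refine Nat.mul_le_mul_right _ ?_
    have h2 : l ≠ 2 := by
      rintro rfl
      exact h hq.two_dvd
    have := hl.two_le
    omega

lemma exists_unitsCount_mul_le {q l : ℕ} (hq : 4 ≤ q) (hqe : Even q) (hl : l.Prime) :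
    ∃ K : ℝ, 0 ≤ K ∧ ∀ x : ℝ, 0 < x → 2 ≤ Real.log x →
      (unitsCount (q * l) x : ℝ) ≤ K * (x * Real.log x ^ (1 / (q.totient : ℝ) / 2 - 1)) := by
  have hql : 3 ≤ q * l := by nlinarith [hl.two_le]
  obtain ⟨K, hK, h⟩ := exists_abs_unitsCount_sub_le hql
  refine ⟨|Hq (q * l)| + K, by positivity, fun x hx hL => ?_⟩
  have hφ : (0 : ℝ) < q.totient := by exact_mod_cast Nat.totient_pos.2 (by omega)
  have hφ2 : 2 * (q.totient : ℝ) ≤ ((q * l).totient : ℝ) := by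
    exact_mod_cast two_mul_totient_le hqe hl
  have hκ : 1 / ((q * l).totient : ℝ) ≤ 1 / (q.totient : ℝ) / 2 := by
    rw [div_div, mul_comm (q.totient : ℝ) 2]
    exact one_div_le_one_div_of_le (by positivity) hφ2
  have hκ0 : 0 ≤ 1 / ((q * l).totient : ℝ) := by positivity
  have hL1 : 1 ≤ Real.log x := by linarith
  have h1 := (abs_sub_le_iff.1 (h x hL hx)).1
  have h2 : Real.log x ^ (1 / ((q * l).totient : ℝ) - 1) ≤
      Real.log x ^ (1 / (q.totient : ℝ) / 2 - 1) :=
    Real.rpow_le_rpow_of_exponent_le hL1 (by linarith)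
  have h3 : Real.log x ^ (1 / ((q * l).totient : ℝ) / 2 - 1) ≤
      Real.log x ^ (1 / (q.totient : ℝ) / 2 - 1) :=
    Real.rpow_le_rpow_of_exponent_le hL1 (by linarith)
  have h0 : 0 ≤ Real.log x ^ (1 / ((q * l).totient : ℝ) - 1) := by positivity
  calc (unitsCount (q * l) x : ℝ)
      ≤ Hq (q * l) * x * Real.log x ^ (1 / ((q * l).totient : ℝ) - 1) +
          K * x * Real.log x ^ (1 / ((q * l).totient : ℝ) / 2 - 1) := by linarith
    _ ≤ |Hq (q * l)| * x * Real.log x ^ (1 / (q.totient : ℝ) / 2 - 1) +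
          K * x * Real.log x ^ (1 / (q.totient : ℝ) / 2 - 1) := by
        gcongr
        exact le_abs_self _
    _ = _ := by ring

open scoped Classical in
lemma Ecount_eq_card {q : ℕ} (hq : 4 ≤ q) (hqe : Even q) (x : ℝ) :
    Ecount q x = ((Finset.Icc 3 ⌊x⌋₊).filter
      (fun n => UnitsDvd q n ∧ ∀ l : ℕ, l.Prime → ¬ UnitsDvd (q * l) n)).card := by
  rw [Ecount, ← Set.ncard_coe_finset]
  congr 1
  ext n
  simp only [Set.mem_ofPred_eq, Finset.coe_filter, Finset.mem_Icc]
  constructor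
  · rintro ⟨hn0, hnx, hn⟩
    have hn3 : 3 ≤ n := by
      by_contra hlt
      rw [lambda1, if_pos (by omega)] at hn
      omega
    exact ⟨⟨hn3, Nat.le_floor hnx⟩, (lambda1_eq_iff hn3 hq hqe.two_dvd).1 hn⟩
  · rintro ⟨⟨hn3, hnx⟩, hn⟩
    exact ⟨by omega, (Nat.le_floor_iff' (by omega)).1 hnx,
      (lambda1_eq_iff hn3 hq hqe.two_dvd).2 hn⟩

lemma Ecount_le_unitsCount {q : ℕ} (hq : 4 ≤ q) (hqe : Even q) (x : ℝ) :
    Ecount q x ≤ unitsCount q x := by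
  rw [Ecount_eq_card hq hqe, unitsCount]
  refine Finset.card_le_card fun n hn => ?_
  simp only [Finset.mem_filter, Finset.mem_Icc] at hn ⊢
  exact ⟨⟨by omega, hn.1.2⟩, hn.2.1⟩

lemma unitsCount_le_Ecount_add {q : ℕ} (hq : 4 ≤ q) (hqe : Even q) (L₀ : ℕ) (x : ℝ) :
    unitsCount q x ≤ Ecount q x + 2 + ∑ l ∈ Nat.primesLE L₀, unitsCount (q * l) x +
      (largeExceptions q L₀ ⌊x⌋₊).card := by
  classical
  rw [Ecount_eq_card hq hqe, unitsCount]
  have hsub : (Finset.Icc 1 ⌊x⌋₊).filter (UnitsDvd q) ⊆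
      (((Finset.Icc 3 ⌊x⌋₊).filter
        (fun n => UnitsDvd q n ∧ ∀ l : ℕ, l.Prime → ¬ UnitsDvd (q * l) n) ∪ {1, 2}) ∪
      (Nat.primesLE L₀).biUnion
        (fun l => (Finset.Icc 1 ⌊x⌋₊).filter (UnitsDvd (q * l)))) ∪
      largeExceptions q L₀ ⌊x⌋₊ := by
    intro n hn
    simp only [largeExceptions, Finset.mem_filter, Finset.mem_Icc, Finset.mem_union,
      Finset.mem_insert, Finset.mem_singleton, Finset.mem_biUnion, Nat.mem_primesLE] at hn ⊢
    obtain ⟨⟨hn1, hnx⟩, hU⟩ := hn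
    by_cases hn3 : 3 ≤ n
    · by_cases hex : ∃ l : ℕ, l.Prime ∧ UnitsDvd (q * l) n
      · obtain ⟨l, hl, hlU⟩ := hex
        by_cases hlL : l ≤ L₀
        · exact Or.inl (Or.inr ⟨l, ⟨hlL, hl⟩, ⟨hn1, hnx⟩, hlU⟩)
        · exact Or.inr ⟨⟨hn3, hnx⟩, l, hl, by omega, hlU⟩
      · push Not at hex
        exact Or.inl (Or.inl (Or.inl ⟨⟨hn3, hnx⟩, hU, hex⟩))
    · exact Or.inl (Or.inl (Or.inr (by omega)))
  refine (Finset.card_le_card hsub).trans ((Finset.card_union_le _ _).trans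
    (add_le_add_left ((Finset.card_union_le _ _).trans (add_le_add
      ((Finset.card_union_le _ _).trans (add_le_add le_rfl (by simp)))
      (Finset.card_biUnion_le.trans (le_of_eq ?_)))) _))
  refine Finset.sum_congr rfl fun l _ => ?_
  rw [unitsCount]

lemma exists_abs_Ecount_sub_le {q : ℕ} (hq : 4 ≤ q) (hqe : Even q) :
    ∃ C : ℝ, 0 < C ∧ ∀ x : ℝ, 0 < x → 2 ≤ Real.log x →
      |(Ecount q x : ℝ) - Hq q * x * Real.log x ^ (1 / (q.totient : ℝ) - 1)| ≤
        C * (x * (1 + Real.log (Real.log x)) * Real.log x ^ (1 / (q.totient : ℝ) / 2 - 1)) := by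
  classical
  have hφ : (2 : ℝ) ≤ q.totient := by exact_mod_cast two_le_totient (by omega : 3 ≤ q)
  set b : ℝ := 1 / (q.totient : ℝ) / 2 with hb
  have hb0 : 0 < b := by positivity
  have hb1 : b ≤ 1 := by
    have : 1 / (q.totient : ℝ) ≤ 1 := by
      rw [div_le_one (by linarith)]
      linarith
    linarith
  obtain ⟨K, hK, hN⟩ := exists_abs_unitsCount_sub_le (by omega : 3 ≤ q)
  obtain ⟨L₀, C, hC, hlarge⟩ := exists_card_largeExceptions_le (by omega : 2 ≤ q) hb0 hb1
  have hsmall : ∀ l : ℕ, ∃ K : ℝ, 0 ≤ K ∧ (l.Prime → ∀ x : ℝ, 0 < x → 2 ≤ Real.log x →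
      (unitsCount (q * l) x : ℝ) ≤ K * (x * Real.log x ^ (b - 1))) := by
    intro l
    by_cases hl : l.Prime
    · obtain ⟨K, hK, h⟩ := exists_unitsCount_mul_le hq hqe hl
      exact ⟨K, hK, fun _ => h⟩
    · exact ⟨0, le_rfl, fun h => absurd h hl⟩
  choose κ hκ0 hκ using hsmall
  set D := ∑ l ∈ Nat.primesLE L₀, κ l with hD
  have hD0 : 0 ≤ D := Finset.sum_nonneg fun l _ => hκ0 l
  refine ⟨K + 2 + D + C, by positivity, fun x hx hL => ?_⟩
  have hL0 : 0 < Real.log x := by linarith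
  have hll : 0 ≤ Real.log (Real.log x) := Real.log_nonneg (by linarith)
  set Y := x * Real.log x ^ (b - 1) with hY
  have hpow : Real.log x ^ (b - 1) = Real.log x ^ b / Real.log x := Real.rpow_sub_one hL0.ne' b
  have hY1 : 1 ≤ Y := by
    have hLb : 1 ≤ Real.log x ^ b := Real.one_le_rpow (by linarith) hb0.le
    have hxL : Real.log x ≤ x := (Real.log_le_sub_one_of_pos hx).trans (by linarith)
    rw [hY, hpow, ← mul_div_assoc, le_div_iff₀ hL0]
    nlinarith
  have h1 := hN x hL hx
  have h2 : (Ecount q x : ℝ) ≤ unitsCount q x := by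
    exact_mod_cast Ecount_le_unitsCount hq hqe x
  have h3 : (unitsCount q x : ℝ) ≤ Ecount q x + 2 +
      ∑ l ∈ Nat.primesLE L₀, (unitsCount (q * l) x : ℝ) +
      (largeExceptions q L₀ ⌊x⌋₊).card := by
    exact_mod_cast unitsCount_le_Ecount_add hq hqe L₀ x
  have h4 : ∑ l ∈ Nat.primesLE L₀, (unitsCount (q * l) x : ℝ) ≤ D * Y := by
    rw [hD, Finset.sum_mul]
    exact Finset.sum_le_sum fun l hl => hκ l (Nat.mem_primesLE.1 hl).2 x hx hL
  have h5 := hlarge x hx hL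
  have e1 : x * (1 + Real.log (Real.log x)) * (Real.log x ^ b / Real.log x) =
      Y * (1 + Real.log (Real.log x)) := by rw [hY, hpow]; ring
  have e2 : x * (1 + Real.log (Real.log x)) * Real.log x ^ (b - 1) =
      Y * (1 + Real.log (Real.log x)) := by rw [hY]; ring
  have e3 : K * x * Real.log x ^ (b - 1) = K * Y := by rw [hY]; ring
  rw [e1] at h5
  rw [e3] at h1
  rw [e2]
  set ll := Real.log (Real.log x)
  have hYll : Y ≤ Y * (1 + ll) := le_mul_of_one_le_right (by linarith) (by linarith)
  have f1 : K * Y ≤ K * (Y * (1 + ll)) := by gcongr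
  have f2 : D * Y ≤ D * (Y * (1 + ll)) := by gcongr
  have f3 : 0 ≤ Y * (1 + ll) := by linarith
  have f4 := mul_nonneg hD0 f3
  have f5 := mul_nonneg hC f3
  have g1 := abs_le.1 h1
  rw [abs_le]
  constructor <;> linarith [g1.1, g1.2]

end

theorem stmt1 (q : ℕ) (hq4 : 4 ≤ q) (hqe : Even q) :
    ∃ Cq : ℝ, 0 < Cq ∧ ∀ x : ℝ, Real.exp (Real.exp 1) ≤ x →
      |(Ecount q x : ℝ) - Hq q * x / Real.log x ^ (1 - 1 / (q.totient : ℝ))| ≤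
        Cq * x * Real.log (Real.log x) ^ 2 /
          Real.log x ^ (1 - 1 / (2 * (q.totient : ℝ))) := by
  obtain ⟨C, hC, h⟩ := exists_abs_Ecount_sub_le hq4 hqe
  refine ⟨2 * C, by positivity, fun x hx => ?_⟩
  have hx0 : 0 < x := (Real.exp_pos _).trans_le hx
  have hLe : Real.exp 1 ≤ Real.log x := (Real.le_log_iff_exp_le hx0).2 hx
  have hL : 2 ≤ Real.log x := by
    have := Real.add_one_le_exp (1 : ℝ)
    linarith
  have hL0 : 0 < Real.log x := by linarith
  have hll : 1 ≤ Real.log (Real.log x) := (Real.le_log_iff_exp_le hL0).2 hLe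
  have e1 : Hq q * x / Real.log x ^ (1 - 1 / (q.totient : ℝ)) =
      Hq q * x * Real.log x ^ (1 / (q.totient : ℝ) - 1) := by
    rw [show 1 / (q.totient : ℝ) - 1 = -(1 - 1 / (q.totient : ℝ)) by ring,
      Real.rpow_neg hL0.le, div_eq_mul_inv]
  have e2 : 2 * C * x * Real.log (Real.log x) ^ 2 /
      Real.log x ^ (1 - 1 / (2 * (q.totient : ℝ))) =
      C * (x * (2 * Real.log (Real.log x) ^ 2) *
        Real.log x ^ (1 / (q.totient : ℝ) / 2 - 1)) := by
    rw [show 1 / (q.totient : ℝ) / 2 - 1 = -(1 - 1 / (2 * (q.totient : ℝ))) by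
      rw [div_div, mul_comm (q.totient : ℝ) 2]; ring, Real.rpow_neg hL0.le, div_eq_mul_inv]
    ring
  rw [e1, e2]
  refine (h x hx0 hL).trans ?_
  gcongr
  nlinarith
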